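/- There is an absolute constant c such that for every real p with 4 < p < 6 and all δ, ν with 1/δ ∈ ℕ, 1/ν ∈ ℕ, ν ∈ (0,1/100), and ν/δ ∈ ℕ, the decoupling constant satisfies D_p(δ) ≤ c · (D_p(δ/ν) + ν^{−1} · M_{p,1}(δ,ν)). -/

import Mathlib

open MeasureTheory

noncomputable section

/-- The weight `w_B` attached to the axis-parallel square of center `c` and side length `R`:
`w_B(x) = (1 + |x - c|/R)^(-100)` with `|·|` the Euclidean norm on `ℝ²`. -/
def wB (c : ℝ × ℝ) (R : ℝ) (x : ℝ × ℝ) : ℝ :=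
  (1 + Real.sqrt ((x.1 - c.1) ^ 2 + (x.2 - c.2) ^ 2) / R) ^ (-100 : ℤ)

/-- The product weight `w̃_B(x) = (1 + |x₁ - c₁|/R)^(-100) * (1 + |x₂ - c₂|/R)^(-100)`. -/
def wtB (c : ℝ × ℝ) (R : ℝ) (x : ℝ × ℝ) : ℝ :=
  (1 + |x.1 - c.1| / R) ^ (-100 : ℤ) * (1 + |x.2 - c.2| / R) ^ (-100 : ℤ)

/-- The axis-parallel square `B(c, R)` with center `c` and side length `R`, as a subset of `ℝ²`. -/
def sqr (c : ℝ × ℝ) (R : ℝ) : Set (ℝ × ℝ) :=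
  Set.Icc (c.1 - R / 2) (c.1 + R / 2) ×ˢ Set.Icc (c.2 - R / 2) (c.2 + R / 2)

/-- The extension operator associated to the parabola, over the interval `[a, b]`:
`(E_{[a,b]} g)(x) = ∫_{[a,b]} g(ξ) e(ξ x₁ + ξ² x₂) dξ`. -/
def extOp (a b : ℝ) (g : ℝ → ℂ) (x : ℝ × ℝ) : ℂ :=
  ∫ ξ in Set.Icc a b,
    g ξ * Complex.exp (2 * Real.pi * Complex.I * ((ξ * x.1 + ξ ^ 2 * x.2 : ℝ) : ℂ))

/-- Weighted `L^p` norm `‖f‖_{L^p(w)} = (∫_{ℝ²} |f|^p w)^{1/p}`. -/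
def wLp (p : ℝ) (w : ℝ × ℝ → ℝ) (f : ℝ × ℝ → ℂ) : ℝ :=
  (∫ x : ℝ × ℝ, ‖f x‖ ^ p * w x) ^ (1 / p)

/-- `L^p` norm over the square of center `c` and side `R`. -/
def sqLp (p : ℝ) (c : ℝ × ℝ) (R : ℝ) (f : ℝ × ℝ → ℂ) : ℝ :=
  (∫ x in sqr c R, ‖f x‖ ^ p) ^ (1 / p)

/-- Normalized weighted `L^p` norm `‖f‖_{L^p_#(w)} = (|B|⁻¹ ∫_{ℝ²} |f|^p w)^{1/p}` where the
normalizing square has side length `R` (so `|B| = R²`). -/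
def shLp (p R : ℝ) (w : ℝ × ℝ → ℝ) (f : ℝ × ℝ → ℂ) : ℝ :=
  ((R ^ 2)⁻¹ * ∫ x : ℝ × ℝ, ‖f x‖ ^ p * w x) ^ (1 / p)

/-- Normalized `L^p` norm over the square of center `c` and side `R`:
`‖f‖_{L^p_#(B)} = (|B|⁻¹ ∫_B |f|^p)^{1/p}`. -/
def shLpSq (p : ℝ) (c : ℝ × ℝ) (R : ℝ) (f : ℝ × ℝ → ℂ) : ℝ :=
  ((R ^ 2)⁻¹ * ∫ x in sqr c R, ‖f x‖ ^ p) ^ (1 / p)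

/-- `DecIneq p n D` says that the constant `D` is admissible in the `l²L^p` decoupling
inequality for the parabola at scale `δ = 1/n`: for every integrable `g : [0,1] → ℂ` and every
axis-parallel square `B` of side length `δ⁻² = n²`,
`‖E_{[0,1]} g‖_{L^p(B)} ≤ D (Σ_{J ∈ P_δ([0,1])} ‖E_J g‖_{L^p(w_B)}²)^{1/2}`. -/
def DecIneq (p : ℝ) (n : ℕ) (D : ℝ) : Prop :=
  ∀ g : ℝ → ℂ, IntegrableOn g (Set.Icc 0 1) → ∀ c : ℝ × ℝ,
    sqLp p c ((n : ℝ) ^ 2) (extOp 0 1 g) ≤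
      D * (∑ k ∈ Finset.range n,
        wLp p (wB c ((n : ℝ) ^ 2)) (extOp ((k : ℝ) / (n : ℝ)) (((k : ℝ) + 1) / (n : ℝ)) g) ^ 2)
        ^ (1 / 2 : ℝ)

/-- The decoupling constant `D_p(δ)` for the parabola at scale `δ = 1/n`, i.e. the smallest
admissible constant in the decoupling inequality. -/
def Dconst (p : ℝ) (n : ℕ) : ℝ := sInf {D : ℝ | 0 ≤ D ∧ DecIneq p n D}

/-- Center of the `(i,j)` square in the partition of the axis-parallel square of center `c` and
side length `Rb` into axis-parallel squares of side length `r`. -/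
def subCtr (c : ℝ × ℝ) (Rb r : ℝ) (i j : ℕ) : ℝ × ℝ :=
  (c.1 - Rb / 2 + ((i : ℝ) + 1 / 2) * r, c.2 - Rb / 2 + ((j : ℝ) + 1 / 2) * r)

/-- `BilIneq p n k b M` says `M` is admissible in the bilinear decoupling inequality with
`δ = 1/n`, `ν = 1/k`: for every square `B` of side `δ⁻² = n²`, every integrable `g`, and all
`ν`-separated intervals `I = [i/k, (i+1)/k]`, `I' = [i'/k, (i'+1)/k]` of the partition
`P_ν([0,1])`,
`Avg_{Δ ∈ P_{ν^{-b}}(B)} Π (Σ_{J ∈ P_{ν^b}} ‖E_J g‖_{L²_#(w̃_Δ)}²)^{p/4}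
  ≤ M^p Π (Σ_{J ∈ P_δ} ‖E_J g‖_{L^p_#(w_B)}²)^{p/4}`. -/
def BilIneq (p : ℝ) (n k b : ℕ) (M : ℝ) : Prop :=
  ∀ g : ℝ → ℂ, IntegrableOn g (Set.Icc 0 1) → ∀ c : ℝ × ℝ,
    ∀ i i' : ℕ, i < k → i' < k → (i + 1 < i' ∨ i' + 1 < i) →
    (((n ^ 2 / k ^ b : ℕ) : ℝ) ^ 2)⁻¹ *
        ∑ a ∈ Finset.range (n ^ 2 / k ^ b), ∑ a' ∈ Finset.range (n ^ 2 / k ^ b),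
          ((∑ J ∈ Finset.range (k ^ (b - 1)),
              shLp 2 ((k : ℝ) ^ b)
                (wtB (subCtr c ((n : ℝ) ^ 2) ((k : ℝ) ^ b) a a') ((k : ℝ) ^ b))
                (extOp ((i : ℝ) / (k : ℝ) + (J : ℝ) / (k : ℝ) ^ b)
                  ((i : ℝ) / (k : ℝ) + ((J : ℝ) + 1) / (k : ℝ) ^ b) g) ^ 2) ^ (p / 4) *
            (∑ J ∈ Finset.range (k ^ (b - 1)),
              shLp 2 ((k : ℝ) ^ b)
                (wtB (subCtr c ((n : ℝ) ^ 2) ((k : ℝ) ^ b) a a') ((k : ℝ) ^ b))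
                (extOp ((i' : ℝ) / (k : ℝ) + (J : ℝ) / (k : ℝ) ^ b)
                  ((i' : ℝ) / (k : ℝ) + ((J : ℝ) + 1) / (k : ℝ) ^ b) g) ^ 2) ^ (p / 4))
      ≤ M ^ p *
        ((∑ J ∈ Finset.range (n / k),
            shLp p ((n : ℝ) ^ 2) (wB c ((n : ℝ) ^ 2))
              (extOp ((i : ℝ) / (k : ℝ) + (J : ℝ) / (n : ℝ))
                ((i : ℝ) / (k : ℝ) + ((J : ℝ) + 1) / (n : ℝ)) g) ^ 2) ^ (p / 4) *
          (∑ J ∈ Finset.range (n / k),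
            shLp p ((n : ℝ) ^ 2) (wB c ((n : ℝ) ^ 2))
              (extOp ((i' : ℝ) / (k : ℝ) + (J : ℝ) / (n : ℝ))
                ((i' : ℝ) / (k : ℝ) + ((J : ℝ) + 1) / (n : ℝ)) g) ^ 2) ^ (p / 4))

/-- The bilinear decoupling constant `M_{p,b}(δ, ν)` with `δ = 1/n`, `ν = 1/k`. -/
def Mconst (p : ℝ) (n k b : ℕ) : ℝ := sInf {M : ℝ | 0 ≤ M ∧ BilIneq p n k b M}

/-- The Fourier transform of a function on `ℝ²`. -/
def ftR2 (η : ℝ × ℝ → ℝ) (ξ : ℝ × ℝ) : ℂ :=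
  ∫ x : ℝ × ℝ, (η x : ℂ) * Complex.exp (-(2 * Real.pi * Complex.I) * ((x.1 * ξ.1 + x.2 * ξ.2 : ℝ) : ℂ))

end

noncomputable section

open scoped ContDiff

/-- The character `θ ↦ e^{2πiθ}`. -/
def ex (θ : ℝ) : ℂ := Complex.exp (2 * Real.pi * Complex.I * (θ : ℂ))

lemma ex_add (a b : ℝ) : ex (a + b) = ex a * ex b := by
  simp only [ex, ← Complex.exp_add]; push_cast; ring_nf

lemma ex_zero : ex 0 = 1 := by simp [ex]

lemma norm_ex (a : ℝ) : ‖ex a‖ = 1 := by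
  rw [ex, show (2 * Real.pi * Complex.I * (a : ℂ)) = ((2 * Real.pi * a : ℝ) : ℂ) * Complex.I by
    push_cast; ring]
  exact Complex.norm_exp_ofReal_mul_I _

lemma continuous_ex : Continuous ex := by unfold ex; fun_prop

lemma Continuous.ex_comp {X : Type*} [TopologicalSpace X] {f : X → ℝ} (hf : Continuous f) :
    Continuous fun x => ex (f x) := continuous_ex.comp hf

/-- The oscillatory integral `∫ χ(η) e(ηx + η²τ) dη`. -/
def kap (χ : ℝ → ℂ) (τ x : ℝ) : ℂ := ∫ η, χ η * ex (η * x + η ^ 2 * τ)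

lemma kap_integrable {χ : ℝ → ℂ} (hχ : Continuous χ) (hc : HasCompactSupport χ) (τ x : ℝ) :
    Integrable fun η => χ η * ex (η * x + η ^ 2 * τ) := by
  apply Continuous.integrable_of_hasCompactSupport
  · exact hχ.mul (Continuous.ex_comp (by fun_prop))
  · exact hc.mul_right

lemma kap_norm_le {χ : ℝ → ℂ} (τ x : ℝ) : ‖kap χ τ x‖ ≤ ∫ η, ‖χ η‖ := by
  refine (norm_integral_le_integral_norm _).trans (le_of_eq ?_)
  simp [norm_ex]

lemma hasDerivAt_ex_quadratic (x τ η : ℝ) :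
    HasDerivAt (fun η : ℝ => ex (η * x + η ^ 2 * τ))
      (2 * Real.pi * Complex.I * (x + 2 * η * τ) * ex (η * x + η ^ 2 * τ)) η := by
  have h1 : HasDerivAt (fun η : ℝ => ((η * x + η ^ 2 * τ : ℝ) : ℂ))
      ((x + 2 * η * τ : ℝ) : ℂ) η := by
    apply HasDerivAt.ofReal_comp
    have := ((hasDerivAt_id η).mul_const x).fun_add (((hasDerivAt_id η).fun_pow 2).mul_const τ)
    simpa using this
  have h2 := (h1.const_mul (2 * Real.pi * Complex.I)).cexp
  unfold ex
  convert h2 using 1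
  push_cast; ring

lemma kap_ibp {χ : ℝ → ℂ} (hχ : ContDiff ℝ ∞ χ) (hc : HasCompactSupport χ) (τ x : ℝ) :
    2 * Real.pi * Complex.I * x * kap χ τ x =
      -(kap (deriv χ) τ x + 4 * Real.pi * Complex.I * τ * kap (fun η => η * χ η) τ x) := by
  have hd : ∀ η, HasDerivAt (fun η => χ η * ex (η * x + η ^ 2 * τ))
      (deriv χ η * ex (η * x + η ^ 2 * τ) +
        χ η * (2 * Real.pi * Complex.I * (x + 2 * η * τ) * ex (η * x + η ^ 2 * τ))) η :=
    fun η => ((hχ.differentiable (by simp)) η).hasDerivAt.mul (hasDerivAt_ex_quadratic x τ η)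
  have c1 : Continuous (deriv χ) := hχ.continuous_deriv (by simp)
  have i1 := kap_integrable c1 hc.deriv τ x
  have i2 := (kap_integrable hχ.continuous hc τ x).const_mul (2 * Real.pi * Complex.I * x)
  have i3 := (kap_integrable (χ := fun η => (η : ℂ) * χ η)
    (by have := hχ.continuous; fun_prop) hc.mul_left τ x).const_mul (4 * Real.pi * Complex.I * τ)
  have key := integral_eq_zero_of_hasDerivAt_of_integrable hd
    (by
      refine ((i1.add i2).add i3).congr (Filter.Eventually.of_forall fun η => ?_)
      simp only [Pi.add_apply]; ring)
    (kap_integrable hχ.continuous hc τ x)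
  have e1 : (fun η => deriv χ η * ex (η * x + η ^ 2 * τ) +
        χ η * (2 * Real.pi * Complex.I * (x + 2 * η * τ) * ex (η * x + η ^ 2 * τ))) =
      fun η => (deriv χ η * ex (η * x + η ^ 2 * τ) +
        2 * Real.pi * Complex.I * x * (χ η * ex (η * x + η ^ 2 * τ))) +
        4 * Real.pi * Complex.I * τ * ((η : ℂ) * χ η * ex (η * x + η ^ 2 * τ)) := by
    ext η; ring
  have a1 := integral_add (i1.add i2) i3
  simp only [Pi.add_apply] at a1
  rw [e1, a1, integral_add i1 i2, integral_const_mul,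
    integral_const_mul] at key
  unfold kap
  linear_combination key

lemma kap_decay_pow (N : ℕ) : ∀ χ : ℝ → ℂ, ContDiff ℝ ∞ χ → HasCompactSupport χ →
    ∃ C : ℝ, 0 ≤ C ∧ ∀ τ x : ℝ, |x| ^ N * ‖kap χ τ x‖ ≤ C * (1 + |τ|) ^ N := by
  induction N with
  | zero =>
    intro χ _ _
    exact ⟨∫ η, ‖χ η‖, by positivity, fun τ x => by simpa using kap_norm_le τ x⟩
  | succ N ih =>
    intro χ hχ hc
    have s1 : ContDiff ℝ ∞ (deriv χ) := by
      exact (contDiff_infty_iff_deriv.1 hχ).2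
    have s2 : ContDiff ℝ ∞ (fun η : ℝ => (η : ℂ) * χ η) :=
      (Complex.ofRealCLM.contDiff).mul hχ
    obtain ⟨C1, h1, H1⟩ := ih _ s1 hc.deriv
    obtain ⟨C2, h2, H2⟩ := ih _ s2 hc.mul_left
    refine ⟨C1 + 2 * C2, by positivity, fun τ x => ?_⟩
    have hk := congrArg norm (kap_ibp hχ hc τ x)
    have hpi := Real.pi_gt_three
    rw [norm_neg] at hk
    have hk2 : 2 * Real.pi * |x| * ‖kap χ τ x‖ ≤
        ‖kap (deriv χ) τ x‖ + 4 * Real.pi * |τ| * ‖kap (fun η => η * χ η) τ x‖ := by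
      refine le_trans (le_of_eq ?_) (hk.le.trans ((norm_add_le _ _).trans (le_of_eq ?_)))
      · simp [abs_of_pos Real.pi_pos]
      · simp [abs_of_pos Real.pi_pos]
    have A := H1 τ x
    have B := H2 τ x
    set a := ‖kap (deriv χ) τ x‖
    set b := ‖kap (fun η => η * χ η) τ x‖
    set y := |x| ^ N
    have hy : 0 ≤ y := by positivity
    set T := (1 + |τ|) ^ N
    have hT : 0 ≤ T := by positivity
    have hτ : 0 ≤ |τ| := abs_nonneg _
    have : 2 * Real.pi * (|x| ^ (N + 1) * ‖kap χ τ x‖) ≤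
        C1 * T + 4 * Real.pi * |τ| * (C2 * T) := by
      calc _ = y * (2 * Real.pi * |x| * ‖kap χ τ x‖) := by simp only [y]; ring
        _ ≤ y * (a + 4 * Real.pi * |τ| * b) := by gcongr
        _ = y * a + 4 * Real.pi * |τ| * (y * b) := by ring
        _ ≤ _ := by gcongr
    have h4 : C1 * T + 4 * Real.pi * |τ| * (C2 * T) ≤
        2 * Real.pi * ((C1 + 2 * C2) * (1 + |τ|) ^ (N + 1)) := by
      have e : (1 + |τ|) ^ (N + 1) = T * (1 + |τ|) := by simp only [T]; ring
      rw [e]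
      have q1 : 0 ≤ C1 * T := by positivity
      have q2 : 0 ≤ C2 * T := by positivity
      have q3 : C1 * T ≤ 2 * Real.pi * (C1 * T * (1 + |τ|)) := by
        have : (1:ℝ) ≤ 2 * Real.pi * (1 + |τ|) := by nlinarith
        nlinarith
      have q4 : 4 * Real.pi * |τ| * (C2 * T) ≤ 2 * Real.pi * (2 * (C2 * T) * (1 + |τ|)) := by
        have : 0 ≤ Real.pi * (C2 * T) := by positivity
        nlinarith
      nlinarith
    have h5 : (0:ℝ) < 2 * Real.pi := by positivity
    exact le_of_mul_le_mul_left (this.trans h4) h5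

lemma kap_decay (N : ℕ) {χ : ℝ → ℂ} (hχ : ContDiff ℝ ∞ χ) (hc : HasCompactSupport χ) :
    ∃ C : ℝ, 0 < C ∧ ∀ τ x : ℝ, ‖kap χ τ x‖ ≤ C * (1 + |τ|) ^ N * ((1 + |x|) ^ N)⁻¹ := by
  obtain ⟨C, h, H⟩ := kap_decay_pow N χ hχ hc
  obtain ⟨C', h', H'⟩ := kap_decay_pow 0 χ hχ hc
  refine ⟨2 ^ N * (C + C') + 1, by positivity, fun τ x => ?_⟩
  rw [← div_eq_mul_inv, le_div_iff₀ (by positivity)]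
  have hb : (1 + |x|) ^ N ≤ 2 ^ N * (|x| ^ N + 1) := by
    rcases le_total 1 |x| with h1 | h1
    · calc (1 + |x|) ^ N ≤ (2 * |x|) ^ N := by gcongr; linarith
        _ = 2 ^ N * |x| ^ N := by ring
        _ ≤ _ := by gcongr; linarith
    · calc (1 + |x|) ^ N ≤ 2 ^ N := by gcongr; linarith
        _ ≤ 2 ^ N * (|x| ^ N + 1) := by
          have : 0 ≤ |x| ^ N := by positivity
          exact le_mul_of_one_le_right (by positivity) (by linarith)
  have hT : 1 ≤ (1 + |τ|) ^ N := one_le_pow₀ (by linarith [abs_nonneg τ])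
  have A := H τ x
  have B : ‖kap χ τ x‖ ≤ C' := by simpa using H' τ x
  calc ‖kap χ τ x‖ * (1 + |x|) ^ N ≤ ‖kap χ τ x‖ * (2 ^ N * (|x| ^ N + 1)) := by gcongr
    _ = 2 ^ N * (|x| ^ N * ‖kap χ τ x‖ + ‖kap χ τ x‖) := by ring
    _ ≤ 2 ^ N * (C * (1 + |τ|) ^ N + C' * (1 + |τ|) ^ N) := by
      gcongr; exact B.trans (le_mul_of_one_le_right h' hT)
    _ ≤ (2 ^ N * (C + C') + 1) * (1 + |τ|) ^ N := by
      have : 0 ≤ (1 + |τ|) ^ N := by positivity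
      nlinarith

lemma integrable_one_add_abs_pow {N : ℕ} (hN : 2 ≤ N) :
    Integrable fun x : ℝ => ((1 + |x|) ^ N)⁻¹ := by
  have := integrable_one_add_norm (E := ℝ) (μ := volume) (r := N) (by
    simp; exact_mod_cast hN)
  refine this.congr (Filter.Eventually.of_forall fun x => ?_)
  simp [Real.rpow_neg (by positivity : 0 ≤ 1 + |x|)]

lemma continuous_kap {χ : ℝ → ℂ} (hχ : Continuous χ) (hc : HasCompactSupport χ) :
    Continuous (Function.uncurry (kap χ)) := by
  unfold kap Function.uncurry
  apply continuous_of_dominated (bound := fun η => ‖χ η‖)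
  · intro p
    exact (hχ.mul (Continuous.ex_comp (by fun_prop))).aestronglyMeasurable
  · intro p
    exact Filter.Eventually.of_forall fun η => by simp [norm_ex]
  · exact (hχ.integrable_of_hasCompactSupport hc).norm
  · exact Filter.Eventually.of_forall fun η =>
      continuous_const.mul (Continuous.ex_comp (by fun_prop))

lemma integrable_kap {χ : ℝ → ℂ} (hχ : ContDiff ℝ ∞ χ) (hc : HasCompactSupport χ) (τ : ℝ) :
    Integrable (kap χ τ) := by
  obtain ⟨C, -, H⟩ := kap_decay 2 hχ hc
  refine ((integrable_one_add_abs_pow le_rfl).const_mul (C * (1 + |τ|) ^ 2)).mono' ?_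
    (Filter.Eventually.of_forall fun x => H τ x)
  exact ((continuous_kap hχ.continuous hc).comp
    (by fun_prop : Continuous fun x : ℝ => (τ, x))).aestronglyMeasurable

lemma kap_inversion {χ : ℝ → ℂ} (hχ : ContDiff ℝ ∞ χ) (hc : HasCompactSupport χ) (τ ξ : ℝ) :
    ∫ y, kap χ τ y * ex (-(ξ * y)) = χ ξ * ex (ξ ^ 2 * τ) := by
  set f : ℝ → ℂ := fun η => χ η * ex (η ^ 2 * τ)
  have hf : Continuous f := hχ.continuous.mul (Continuous.ex_comp (by fun_prop))
  have hfi : Integrable f := hf.integrable_of_hasCompactSupport hc.mul_right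
  have hk : ∀ x, kap χ τ x = FourierTransformInv.fourierInv f x := by
    intro x
    rw [Real.fourierInv_eq', kap]
    congr 1; ext η
    simp only [f, ex_add, smul_eq_mul]
    have : ex (η * x) = Complex.exp (((2 * Real.pi * inner ℝ η x : ℝ) : ℂ) * Complex.I) := by
      simp [ex]; ring_nf
    rw [this]; ring
  have hF : Integrable (FourierTransform.fourier f) := by
    have h1 : FourierTransform.fourier f = fun x => kap χ τ (-x) := by
      ext x
      rw [hk, Real.fourierInv_eq_fourier_neg, neg_neg]
    rw [h1]; exact (integrable_kap hχ hc τ).comp_neg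
  have := congrFun (hf.fourier_fourierInv_eq hfi hF) ξ
  rw [Real.fourier_eq'] at this
  refine Eq.trans ?_ this
  congr 1; ext y
  rw [← hk, smul_eq_mul, mul_comm]
  congr 1
  simp [ex]; ring_nf

/-- The extension operator of the parabola over the whole line. -/
def extE (f : ℝ → ℂ) (x : ℝ × ℝ) : ℂ := ∫ ξ, f ξ * ex (ξ * x.1 + ξ ^ 2 * x.2)

lemma extOp_eq_extE (a b : ℝ) (g : ℝ → ℂ) :
    extOp a b g = extE ((Set.Icc a b).indicator g) := by
  ext x
  unfold extOp extE
  rw [← integral_indicator measurableSet_Icc]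
  congr 1; ext ξ
  by_cases h : ξ ∈ Set.Icc a b <;> simp [h, ex]

lemma MeasureTheory.Integrable.mul_ex {X : Type*} [MeasurableSpace X] {μ : Measure X} {f : X → ℂ}
    (hf : Integrable f μ) {θ : X → ℝ} (hθ : Measurable θ) :
    Integrable (fun x => f x * ex (θ x)) μ := by
  refine hf.mul_bdd (c := 1) ?_ (Filter.Eventually.of_forall fun x => (norm_ex _).le)
  exact (continuous_ex.measurable.comp hθ).aestronglyMeasurable

lemma extE_integrable {f : ℝ → ℂ} (hf : Integrable f) (x : ℝ × ℝ) :
    Integrable fun ξ => f ξ * ex (ξ * x.1 + ξ ^ 2 * x.2) :=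
  hf.mul_ex (by fun_prop)

lemma extE_norm_le (f : ℝ → ℂ) (x : ℝ × ℝ) : ‖extE f x‖ ≤ ∫ ξ, ‖f ξ‖ := by
  refine (norm_integral_le_integral_norm _).trans (le_of_eq ?_)
  simp [norm_ex]

lemma continuous_extE {f : ℝ → ℂ} (hf : Integrable f) : Continuous (extE f) := by
  unfold extE
  apply continuous_of_dominated (bound := fun η => ‖f η‖)
  · intro p
    exact (extE_integrable hf p).aestronglyMeasurable
  · intro p
    exact Filter.Eventually.of_forall fun η => by simp [norm_ex]
  · exact hf.norm
  · exact Filter.Eventually.of_forall fun η =>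
      continuous_const.mul (Continuous.ex_comp (by fun_prop))

lemma extE_sum {ι : Type*} (s : Finset ι) {f : ι → ℝ → ℂ} (hf : ∀ i ∈ s, Integrable (f i))
    (x : ℝ × ℝ) : extE (fun ξ => ∑ i ∈ s, f i ξ) x = ∑ i ∈ s, extE (f i) x := by
  unfold extE
  rw [← integral_finsetSum _ fun i hi => extE_integrable (hf i hi) x]
  congr 1; ext ξ; rw [Finset.sum_mul]

lemma extE_modulate (f : ℝ → ℂ) (c x : ℝ × ℝ) :
    extE (fun ξ => f ξ * ex (ξ * c.1 + ξ ^ 2 * c.2)) x = extE f (x + c) := by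
  unfold extE
  congr 1; ext ξ
  rw [mul_assoc, ← ex_add]
  congr 2
  simp only [Prod.fst_add, Prod.snd_add]; ring

lemma integrable_prod_ex {W f : ℝ → ℂ} (hW : Integrable W) (hf : Integrable f)
    {θ : ℝ × ℝ → ℝ} (hθ : Measurable θ) :
    Integrable (fun z : ℝ × ℝ => W z.1 * f z.2 * ex (θ z)) (volume.prod volume) :=
  (hW.mul_prod hf).mul_ex hθ

/-- Convolution with the kernel `kap X τ` acts as the Fourier multiplier `X(θ) e(θ²τ)`. -/
lemma kap_convolve {X : ℝ → ℂ} (hX : ContDiff ℝ ∞ X) (hc : HasCompactSupport X) {f : ℝ → ℂ}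
    (hf : Integrable f) {θ : ℝ → ℝ} (hθ : Measurable θ) (h1 : ∀ ξ, f ξ ≠ 0 → X (θ ξ) = 1)
    (τ u : ℝ) :
    ∫ y, kap X τ (u - y) * ∫ ξ, f ξ * ex (θ ξ * y) =
      ∫ ξ, f ξ * ex (θ ξ * u + θ ξ ^ 2 * τ) := by
  have hk := (integrable_kap hX hc τ).comp_sub_left u
  have hF := integrable_prod_ex hk hf (θ := fun z => θ z.2 * z.1) (by fun_prop)
  have := integral_integral_swap (f := fun y ξ => kap X τ (u - y) * f ξ * ex (θ ξ * y)) hF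
  calc _ = ∫ y, ∫ ξ, kap X τ (u - y) * f ξ * ex (θ ξ * y) := by
        congr 1; ext y; rw [← integral_const_mul]; congr 1; ext ξ; ring
    _ = _ := this
    _ = _ := by
        congr 1; ext ξ
        by_cases h0 : f ξ = 0
        · simp [h0]
        have e1 : ∫ y, kap X τ (u - y) * f ξ * ex (θ ξ * y) =
            ∫ y, kap X τ y * f ξ * ex (θ ξ * (u - y)) := by
          rw [← integral_sub_left_eq_self _ _ u]; simp
        rw [e1]
        have e2 : ∀ y, kap X τ y * f ξ * ex (θ ξ * (u - y)) =
            (f ξ * ex (θ ξ * u)) * (kap X τ y * ex (-(θ ξ * y))) := by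
          intro y
          rw [mul_sub, sub_eq_add_neg, ex_add]; ring
        simp_rw [e2]
        rw [integral_const_mul, kap_inversion hX hc, h1 ξ h0, ex_add]; ring

lemma extE_reproduce {X : ℝ → ℂ} (hX : ContDiff ℝ ∞ X) (hc : HasCompactSupport X) {f : ℝ → ℂ}
    (hf : Integrable f) (h1 : ∀ ξ, f ξ ≠ 0 → X ξ = 1) (u t s : ℝ) :
    extE f (u, t) = ∫ y, kap X (t - s) (u - y) * extE f (y, s) := by
  have := kap_convolve hX hc (f := fun ξ => f ξ * ex (ξ ^ 2 * s)) (hf.mul_ex (by fun_prop))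
    (θ := id) measurable_id (fun ξ h => h1 ξ (left_ne_zero_of_mul h)) (t - s) u
  simp only [id] at this
  unfold extE
  refine Eq.trans ?_ (this.symm.trans ?_)
  · congr 1; ext ξ; rw [mul_assoc, ← ex_add]; congr 2; ring
  · congr 1; ext y; congr 2; ext ξ; rw [mul_assoc, ← ex_add]; congr 2; ring

/-- Extending the frequency-localised Fourier transform of `W`, viewed as data at time `s`. -/
lemma extE_of_data {X W : ℝ → ℂ} (hX : Continuous X) (hc : HasCompactSupport X)
    (hW : Integrable W) (u t s : ℝ) :
    extE (fun ξ => X ξ * ex (-(ξ ^ 2 * s)) * ∫ y, W y * ex (-(ξ * y))) (u, t) =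
      ∫ y, kap X (t - s) (u - y) * W y := by
  have hXi := hX.integrable_of_hasCompactSupport hc (μ := volume)
  have hF := integrable_prod_ex hXi hW
    (θ := fun z => z.1 * (u - z.2) + z.1 ^ 2 * (t - s)) (by fun_prop)
  have := integral_integral_swap
    (f := fun ξ y => X ξ * W y * ex (ξ * (u - y) + ξ ^ 2 * (t - s))) hF
  unfold extE kap
  refine Eq.trans ?_ (this.trans ?_)
  · congr 1; ext ξ
    have : ∀ y, X ξ * W y * ex (ξ * (u - y) + ξ ^ 2 * (t - s)) =
        (X ξ * ex (-(ξ ^ 2 * s)) * ex (ξ * u + ξ ^ 2 * t)) * (W y * ex (-(ξ * y))) := by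
      intro y
      rw [show ξ * (u - y) + ξ ^ 2 * (t - s) =
        -(ξ ^ 2 * s) + (ξ * u + ξ ^ 2 * t) + -(ξ * y) by ring, ex_add, ex_add]; ring
    simp_rw [this]
    rw [integral_const_mul]; ring
  · congr 1; ext y
    rw [← integral_mul_const]; congr 1; ext ξ; ring

lemma kap_rescale (χ : ℝ → ℂ) {m : ℝ} (hm : 0 < m) (a τ x : ℝ) :
    kap (fun ξ => χ (m * (ξ - a))) τ x =
      (m⁻¹ : ℝ) * (ex (a * x + a ^ 2 * τ) * kap χ (τ / m ^ 2) ((x + 2 * a * τ) / m)) := by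
  unfold kap
  have h := Measure.integral_comp_mul_left
    (fun η => χ η * ex ((η / m + a) * x + (η / m + a) ^ 2 * τ)) m
  have h2 := integral_sub_right_eq_self (μ := volume)
    (fun ξ : ℝ => χ (m * ξ) * ex ((ξ + a) * x + (ξ + a) ^ 2 * τ)) a
  simp only [sub_add_cancel] at h2
  rw [h2]
  have h3 : ∀ ξ : ℝ, m * ξ / m = ξ := fun ξ => by field_simp
  simp only [h3] at h
  rw [h, abs_of_pos (inv_pos.2 hm), Complex.real_smul]
  congr 1
  rw [← integral_const_mul]
  congr 1; ext η
  rw [mul_left_comm, ← ex_add]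
  congr 2
  field_simp
  ring

lemma rescale_hasCompactSupport {χ : ℝ → ℂ} (hc : HasCompactSupport χ) {m : ℝ} (hm : 0 < m)
    (a : ℝ) : HasCompactSupport fun ξ => χ (m * (ξ - a)) := by
  have := hc.comp_homeomorph ((Homeomorph.addRight (-a)).trans (Homeomorph.mulLeft₀ m hm.ne'))
  simpa [Function.comp_def, sub_eq_add_neg] using this

lemma kap_rescale_decay (N : ℕ) {χ : ℝ → ℂ} (hχ : ContDiff ℝ ∞ χ) (hc : HasCompactSupport χ) :
    ∃ C : ℝ, 0 < C ∧ ∀ m a τ x : ℝ, 0 < m → ‖kap (fun ξ => χ (m * (ξ - a))) τ x‖ ≤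
      C / m * (1 + |τ| / m ^ 2) ^ N * ((1 + |x + 2 * a * τ| / m) ^ N)⁻¹ := by
  obtain ⟨C, hC, H⟩ := kap_decay N hχ hc
  refine ⟨C, hC, fun m a τ x hm => ?_⟩
  rw [kap_rescale χ hm]
  have := H (τ / m ^ 2) ((x + 2 * a * τ) / m)
  rw [abs_div, abs_div, abs_of_pos hm, abs_of_pos (pow_pos hm 2)] at this
  rw [norm_mul, norm_mul, norm_ex, Complex.norm_real, Real.norm_of_nonneg (inv_pos.2 hm).le,
    one_mul]
  calc _ ≤ m⁻¹ * (C * (1 + |τ| / m ^ 2) ^ N * ((1 + |x + 2 * a * τ| / m) ^ N)⁻¹) :=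
        mul_le_mul_of_nonneg_left this (inv_pos.2 hm).le
    _ = _ := by ring

end

noncomputable section

open scoped ENNReal NNReal

section Inequalities
variable {α : Type*} [MeasurableSpace α] {μ : Measure α}

lemma lintegral_mul_rpow_le {K W : α → ℝ≥0∞} (hK : AEMeasurable K μ) (hW : AEMeasurable W μ)
    {p : ℝ} (hp : 1 < p) :
    (∫⁻ y, K y * W y ∂μ) ^ p ≤ (∫⁻ y, K y ∂μ) ^ (p - 1) * ∫⁻ y, K y * W y ^ p ∂μ := by
  have hpq := (Real.HolderConjugate.conjExponent hp).symm
  set q := p.conjExponent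
  have hp0 : 0 < p := by linarith
  have hq0 : 0 < q := hpq.pos
  have h := ENNReal.lintegral_mul_le_Lp_mul_Lq μ hpq (f := fun y => K y ^ (1 / q))
    (g := fun y => K y ^ (1 / p) * W y) (hK.pow_const _) ((hK.pow_const _).mul hW)
  have hs : 1 / q + 1 / p = 1 := by
    have := hpq.inv_add_inv_eq_one; simpa [one_div] using this
  have e1 : ∀ y, ((fun y => K y ^ (1 / q)) * fun y => K y ^ (1 / p) * W y) y = K y * W y := by
    intro y
    simp only [Pi.mul_apply]
    rw [← mul_assoc, ← ENNReal.rpow_add_of_nonneg _ _ (by positivity) (by positivity), hs,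
      ENNReal.rpow_one]
  have e2 : ∀ y, (K y ^ (1 / q)) ^ q = K y := fun y => by
    rw [← ENNReal.rpow_mul, one_div_mul_cancel hq0.ne', ENNReal.rpow_one]
  have e3 : ∀ y, (K y ^ (1 / p) * W y) ^ p = K y * W y ^ p := fun y => by
    rw [ENNReal.mul_rpow_of_nonneg _ _ hp0.le, ← ENNReal.rpow_mul, one_div_mul_cancel hp0.ne',
      ENNReal.rpow_one]
  simp_rw [e1, e2, e3] at h
  calc _ ≤ ((∫⁻ y, K y ∂μ) ^ (1 / q) * (∫⁻ y, K y * W y ^ p ∂μ) ^ (1 / p)) ^ p := by gcongr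
    _ = _ := by
      rw [ENNReal.mul_rpow_of_nonneg _ _ hp0.le, ← ENNReal.rpow_mul, ← ENNReal.rpow_mul,
        one_div_mul_cancel hp0.ne', ENNReal.rpow_one]
      congr 2
      have : 1 / q = 1 - 1 / p := by linarith
      rw [this]; field_simp

lemma young_rpow {K W : ℝ → ℝ≥0∞} (hK : Measurable K) (hW : Measurable W) {p : ℝ} (hp : 1 < p) :
    ∫⁻ u, (∫⁻ y, K (u - y) * W y) ^ p ≤ (∫⁻ y, K y) ^ p * ∫⁻ y, W y ^ p := by
  have hKs : ∀ u : ℝ, ∫⁻ y, K (u - y) = ∫⁻ y, K y := fun u => lintegral_sub_left_eq_self K u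
  have hKt : ∀ y : ℝ, ∫⁻ u, K (u - y) = ∫⁻ y, K y := fun u => lintegral_sub_right_eq_self K u
  have hp0 : 0 < p := by linarith
  calc _ ≤ ∫⁻ u, (∫⁻ y, K y) ^ (p - 1) * ∫⁻ y, K (u - y) * W y ^ p := by
        refine lintegral_mono fun u => ?_
        have := lintegral_mul_rpow_le (μ := volume) (K := fun y => K (u - y)) (W := W)
          (by fun_prop) hW.aemeasurable hp
        rwa [hKs] at this
    _ = (∫⁻ y, K y) ^ (p - 1) * ∫⁻ u, ∫⁻ y, K (u - y) * W y ^ p := by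
        rw [lintegral_const_mul]
        refine Measurable.lintegral_prod_right' (f := fun z : ℝ × ℝ => K (z.1 - z.2) * W z.2 ^ p) ?_
        fun_prop
    _ = (∫⁻ y, K y) ^ (p - 1) * ∫⁻ y, (∫⁻ y, K y) * W y ^ p := by
        rw [lintegral_lintegral_swap (by fun_prop)]
        congr 2; ext y
        rw [lintegral_mul_const _ (by fun_prop), hKt]
    _ = _ := by
        rw [lintegral_const_mul _ (by fun_prop), ← mul_assoc]
        congr 1
        nth_rewrite 2 [← ENNReal.rpow_one (∫⁻ y, K y)]
        rw [← ENNReal.rpow_add_of_nonneg _ _ (by linarith) zero_le_one]; congr 1; ring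

lemma lintegral_Lp_sum_le {ι : Type*} (s : Finset ι) {f : ι → α → ℝ≥0∞}
    (hf : ∀ i ∈ s, AEMeasurable (f i) μ) {r : ℝ} (hr : 1 ≤ r) :
    (∫⁻ a, (∑ i ∈ s, f i a) ^ r ∂μ) ^ (1 / r) ≤ ∑ i ∈ s, (∫⁻ a, f i a ^ r ∂μ) ^ (1 / r) := by
  classical
  have hr0 : 0 < r := by linarith
  induction s using Finset.induction_on with
  | empty => simp [hr0]
  | insert i s hi ih =>
    simp_rw [Finset.sum_insert hi]
    have h := ENNReal.lintegral_Lp_add_le (μ := μ) (f := f i) (g := fun a => ∑ i ∈ s, f i a)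
      (hf i (Finset.mem_insert_self i s))
      (Finset.aemeasurable_fun_sum _ fun j hj => hf j (Finset.mem_insert_of_mem hj)) hr
    simp only [Pi.add_apply] at h
    refine h.trans ?_
    gcongr
    exact ih fun j hj => hf j (Finset.mem_insert_of_mem hj)

/-- Minkowski's inequality for the mixed norm `L^r(ℓ^1)`. -/
lemma lintegral_sum_rpow_le {ι : Type*} (s : Finset ι) {f : ι → α → ℝ≥0∞}
    (hf : ∀ i ∈ s, AEMeasurable (f i) μ) {r : ℝ} (hr : 1 ≤ r) :
    ∫⁻ a, (∑ i ∈ s, f i a ^ (1 / r)) ^ r ∂μ ≤ (∑ i ∈ s, (∫⁻ a, f i a ∂μ) ^ (1 / r)) ^ r := by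
  have hr0 : 0 < r := by linarith
  have h := lintegral_Lp_sum_le s (μ := μ) (f := fun i a => f i a ^ (1 / r))
    (fun i hi => (hf i hi).pow_const _) hr
  have e : ∀ x : ℝ≥0∞, (x ^ (1 / r)) ^ r = x := fun x => by
    rw [← ENNReal.rpow_mul, one_div_mul_cancel hr0.ne', ENNReal.rpow_one]
  simp_rw [e] at h
  calc _ = ((∫⁻ a, (∑ i ∈ s, f i a ^ (1 / r)) ^ r ∂μ) ^ (1 / r)) ^ r := (e _).symm
    _ ≤ _ := by gcongr

end Inequalities

lemma lintegral_enorm_rpow_mul {α : Type*} [MeasurableSpace α] {μ : Measure α} {F : α → ℂ}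
    {w : α → ℝ} {K p : ℝ} (hp : 0 ≤ p) (hF : AEStronglyMeasurable F μ) (hK : ∀ x, ‖F x‖ ≤ K)
    (hw : Integrable w μ) (h0 : ∀ x, 0 ≤ w x) :
    ∫⁻ x, ‖F x‖ₑ ^ p * ENNReal.ofReal (w x) ∂μ = ENNReal.ofReal (∫ x, ‖F x‖ ^ p * w x ∂μ) := by
  rw [ofReal_integral_eq_lintegral_ofReal]
  · congr 1; ext x
    rw [ENNReal.ofReal_mul (by positivity), ← ENNReal.ofReal_rpow_of_nonneg (norm_nonneg _) hp,
      ofReal_norm]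
  · refine hw.bdd_mul (c := K ^ p) ?_ ?_
    · exact (hF.norm.aemeasurable.pow_const p).aestronglyMeasurable
    · refine Filter.Eventually.of_forall fun x => ?_
      rw [Real.norm_of_nonneg (by positivity)]
      have := hK x
      gcongr
  · exact Filter.Eventually.of_forall fun x => mul_nonneg (by positivity) (h0 x)

/-- Polynomial decay at scale `R`. -/
def decay (N : ℕ) (R y : ℝ) : ℝ := ((1 + |y| / R) ^ N)⁻¹

lemma decay_nonneg (N : ℕ) {R : ℝ} (hR : 0 < R) (y : ℝ) : 0 ≤ decay N R y := by
  unfold decay; positivity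

lemma measurable_decay (N : ℕ) (R : ℝ) : Measurable (decay N R) := by
  unfold decay; fun_prop

lemma one_le_one_add_abs_div {R : ℝ} (hR : 0 < R) (y : ℝ) : 1 ≤ 1 + |y| / R := by
  have : 0 ≤ |y| / R := by positivity
  linarith

lemma decay_anti {M N : ℕ} (h : M ≤ N) {R : ℝ} (hR : 0 < R) (y : ℝ) :
    decay N R y ≤ decay M R y := by
  have := one_le_one_add_abs_div hR y
  unfold decay
  gcongr

lemma decay_le_one (N : ℕ) {R : ℝ} (hR : 0 < R) (y : ℝ) : decay N R y ≤ 1 := by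
  simpa [decay] using decay_anti (Nat.zero_le N) hR y

/-- The mass of the profile `(1 + |y|)⁻²`. -/
def decayMass : ℝ≥0 := (∫ y : ℝ, ((1 + |y|) ^ 2)⁻¹).toNNReal

lemma lintegral_decay_le {N : ℕ} (hN : 2 ≤ N) {R : ℝ} (hR : 0 < R) :
    ∫⁻ y, ENNReal.ofReal (decay N R y) ≤ ENNReal.ofReal R * decayMass := by
  have hi : Integrable fun y : ℝ => decay 2 R y := by
    have := (integrable_one_add_abs_pow le_rfl).comp_div hR.ne'
    simpa [decay, abs_div, abs_of_pos hR] using this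
  calc _ ≤ ∫⁻ y, ENNReal.ofReal (decay 2 R y) :=
        lintegral_mono fun y => ENNReal.ofReal_le_ofReal (decay_anti hN hR y)
    _ = ENNReal.ofReal (∫ y, decay 2 R y) := (ofReal_integral_eq_lintegral_ofReal hi
        (Filter.Eventually.of_forall fun y => decay_nonneg 2 hR y)).symm
    _ = ENNReal.ofReal (R * ∫ y : ℝ, ((1 + |y|) ^ 2)⁻¹) := by
        have := Measure.integral_comp_div (fun y : ℝ => ((1 + |y|) ^ 2)⁻¹) R
        rw [abs_of_pos hR, smul_eq_mul] at this
        rw [← this]; simp [decay, abs_div, abs_of_pos hR]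
    _ = _ := by rw [ENNReal.ofReal_mul hR.le]; rfl
    _ ≤ _ := le_rfl

lemma wB_eq (c : ℝ × ℝ) (R : ℝ) (x : ℝ × ℝ) :
    wB c R x = ((1 + √((x.1 - c.1) ^ 2 + (x.2 - c.2) ^ 2) / R) ^ 100)⁻¹ := by
  unfold wB; rw [zpow_neg]; norm_cast

lemma wtB_eq (c : ℝ × ℝ) (R : ℝ) (x : ℝ × ℝ) :
    wtB c R x = decay 100 R (x.1 - c.1) * decay 100 R (x.2 - c.2) := by
  unfold wtB decay; rw [zpow_neg, zpow_neg]; norm_cast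

lemma continuous_wB (c : ℝ × ℝ) {R : ℝ} (hR : 0 < R) : Continuous (wB c R) := by
  have : wB c R = fun x => ((1 + √((x.1 - c.1) ^ 2 + (x.2 - c.2) ^ 2) / R) ^ 100)⁻¹ :=
    funext (wB_eq c R)
  rw [this]
  refine Continuous.inv₀ (by fun_prop) fun x => ?_
  positivity

lemma wB_nonneg (c : ℝ × ℝ) {R : ℝ} (hR : 0 < R) (x : ℝ × ℝ) : 0 ≤ wB c R x := by
  rw [wB_eq]; positivity

lemma wB_le_decay_snd (c : ℝ × ℝ) {R : ℝ} (hR : 0 < R) (x : ℝ × ℝ) :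
    wB c R x ≤ decay 100 R (x.2 - c.2) := by
  rw [wB_eq, decay]
  have : |x.2 - c.2| ≤ √((x.1 - c.1) ^ 2 + (x.2 - c.2) ^ 2) := by
    apply Real.abs_le_sqrt; nlinarith [sq_nonneg (x.1 - c.1)]
  gcongr

lemma wB_le_decay_fst (c : ℝ × ℝ) {R : ℝ} (hR : 0 < R) (x : ℝ × ℝ) :
    wB c R x ≤ decay 100 R (x.1 - c.1) := by
  rw [wB_eq, decay]
  have : |x.1 - c.1| ≤ √((x.1 - c.1) ^ 2 + (x.2 - c.2) ^ 2) := by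
    apply Real.abs_le_sqrt; nlinarith [sq_nonneg (x.2 - c.2)]
  gcongr

lemma decay_sq (N : ℕ) (R y : ℝ) : decay N R y ^ 2 = decay (2 * N) R y := by
  unfold decay; rw [inv_pow, ← pow_mul, mul_comm]

lemma wB_le_mul (c : ℝ × ℝ) {R : ℝ} (hR : 0 < R) (x : ℝ × ℝ) :
    wB c R x ≤ decay 50 R (x.1 - c.1) * decay 50 R (x.2 - c.2) := by
  have h1 := wB_le_decay_fst c hR x
  have h2 := wB_le_decay_snd c hR x
  have e1 := decay_sq 50 R (x.1 - c.1)
  have e2 := decay_sq 50 R (x.2 - c.2)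
  norm_num at e1 e2
  rw [← e1] at h1; rw [← e2] at h2
  have := wB_nonneg c hR x
  refine le_of_sq_le_sq ?_ (mul_nonneg (decay_nonneg _ hR _) (decay_nonneg _ hR _))
  nlinarith [sq_nonneg (decay 50 R (x.1 - c.1)), mul_le_mul h1 h2 this (sq_nonneg _)]

lemma lintegral_prod_decay_le {M N : ℕ} (hM : 2 ≤ M) (hN : 2 ≤ N) (c : ℝ × ℝ) {R : ℝ}
    (hR : 0 < R) :
    ∫⁻ x : ℝ × ℝ, ENNReal.ofReal (decay M R (x.1 - c.1) * decay N R (x.2 - c.2)) ≤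
      ENNReal.ofReal R ^ 2 * decayMass ^ 2 := by
  have e : ∀ x : ℝ × ℝ, ENNReal.ofReal (decay M R (x.1 - c.1) * decay N R (x.2 - c.2)) =
      ENNReal.ofReal (decay M R (x.1 - c.1)) * ENNReal.ofReal (decay N R (x.2 - c.2)) :=
    fun x => ENNReal.ofReal_mul (decay_nonneg _ hR _)
  have m1 : ∀ N, Measurable fun y => ENNReal.ofReal (decay N R y) := fun N =>
    (measurable_decay N R).ennreal_ofReal
  simp_rw [e]
  rw [Measure.volume_eq_prod, lintegral_prod_mul
    (f := fun y => ENNReal.ofReal (decay M R (y - c.1)))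
    (g := fun y => ENNReal.ofReal (decay N R (y - c.2)))
    ((m1 M).comp (by fun_prop)).aemeasurable ((m1 N).comp (by fun_prop)).aemeasurable]
  rw [lintegral_sub_right_eq_self (fun y => ENNReal.ofReal (decay M R y)),
    lintegral_sub_right_eq_self (fun y => ENNReal.ofReal (decay N R y))]
  calc _ ≤ (ENNReal.ofReal R * decayMass) * (ENNReal.ofReal R * decayMass) :=
        mul_le_mul' (lintegral_decay_le hM hR) (lintegral_decay_le hN hR)
    _ = _ := by ring

lemma integrable_of_lintegral_ofReal {α : Type*} [MeasurableSpace α] {μ : Measure α} {w : α → ℝ}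
    (hm : Measurable w) (h0 : ∀ x, 0 ≤ w x) (h : ∫⁻ x, ENNReal.ofReal (w x) ∂μ < ∞) :
    Integrable w μ :=
  ⟨hm.aestronglyMeasurable, (hasFiniteIntegral_iff_ofReal
    (Filter.Eventually.of_forall h0)).2 h⟩

lemma lintegral_wB_le (c : ℝ × ℝ) {R : ℝ} (hR : 0 < R) :
    ∫⁻ x, ENNReal.ofReal (wB c R x) ≤ ENNReal.ofReal R ^ 2 * decayMass ^ 2 :=
  (lintegral_mono fun x => ENNReal.ofReal_le_ofReal (wB_le_mul c hR x)).trans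
    (lintegral_prod_decay_le (by norm_num) (by norm_num) c hR)

lemma integrable_wB (c : ℝ × ℝ) {R : ℝ} (hR : 0 < R) : Integrable (wB c R) := by
  refine integrable_of_lintegral_ofReal (continuous_wB c hR).measurable (wB_nonneg c hR)
    ((lintegral_wB_le c hR).trans_lt ?_)
  exact ENNReal.mul_lt_top (by simp) (by simp)

lemma wtB_nonneg (c : ℝ × ℝ) {R : ℝ} (hR : 0 < R) (x : ℝ × ℝ) : 0 ≤ wtB c R x := by
  rw [wtB_eq]; exact mul_nonneg (decay_nonneg _ hR _) (decay_nonneg _ hR _)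

lemma measurable_wtB (c : ℝ × ℝ) (R : ℝ) : Measurable (wtB c R) := by
  have : wtB c R = _ := funext (wtB_eq c R)
  rw [this]
  exact ((measurable_decay _ _).comp (by fun_prop)).mul
    ((measurable_decay _ _).comp (by fun_prop))

lemma lintegral_wtB_le (c : ℝ × ℝ) {R : ℝ} (hR : 0 < R) :
    ∫⁻ x, ENNReal.ofReal (wtB c R x) ≤ ENNReal.ofReal R ^ 2 * decayMass ^ 2 := by
  simp_rw [wtB_eq]
  exact lintegral_prod_decay_le (by norm_num) (by norm_num) c hR

lemma integrable_wtB (c : ℝ × ℝ) {R : ℝ} (hR : 0 < R) : Integrable (wtB c R) := by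
  refine integrable_of_lintegral_ofReal (measurable_wtB c R) (wtB_nonneg c hR)
    ((lintegral_wtB_le c hR).trans_lt ?_)
  exact ENNReal.mul_lt_top (by simp) (by simp)

/-- The `p`-th power of the weighted norm, as an extended nonnegative real. -/
def wInt (p : ℝ) (c : ℝ × ℝ) (R : ℝ) (F : ℝ × ℝ → ℂ) : ℝ≥0∞ :=
  ∫⁻ x, ‖F x‖ₑ ^ p * ENNReal.ofReal (wB c R x)

lemma extOp_props {a b : ℝ} {g : ℝ → ℂ} (hg : IntegrableOn g (Set.Icc a b)) :
    Continuous (extOp a b g) ∧ ∃ K, ∀ x, ‖extOp a b g x‖ ≤ K := by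
  rw [extOp_eq_extE]
  have h := hg.integrable_indicator measurableSet_Icc
  exact ⟨continuous_extE h, _, extE_norm_le _⟩

lemma wInt_eq {p : ℝ} (hp : 0 < p) (c : ℝ × ℝ) {R : ℝ} (hR : 0 < R) {F : ℝ × ℝ → ℂ}
    (hF : Continuous F) {K : ℝ} (hK : ∀ x, ‖F x‖ ≤ K) :
    wInt p c R F = ENNReal.ofReal (∫ x, ‖F x‖ ^ p * wB c R x) :=
  lintegral_enorm_rpow_mul hp.le hF.aestronglyMeasurable hK (integrable_wB c hR) (wB_nonneg c hR)

lemma ofReal_wLp_sq {p : ℝ} (hp : 0 < p) (c : ℝ × ℝ) {R : ℝ} (hR : 0 < R) {F : ℝ × ℝ → ℂ}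
    (hF : Continuous F) {K : ℝ} (hK : ∀ x, ‖F x‖ ≤ K) :
    ENNReal.ofReal (wLp p (wB c R) F ^ 2) = wInt p c R F ^ (2 / p) := by
  have h0 : 0 ≤ ∫ x, ‖F x‖ ^ p * wB c R x :=
    integral_nonneg fun x => mul_nonneg (by positivity) (wB_nonneg c hR x)
  rw [wInt_eq hp c hR hF hK, ENNReal.ofReal_rpow_of_nonneg h0 (by positivity), wLp,
    ← Real.rpow_natCast, ← Real.rpow_mul h0]
  congr 2; push_cast; ring

lemma measurableSet_sqr (c : ℝ × ℝ) (R : ℝ) : MeasurableSet (sqr c R) :=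
  measurableSet_Icc.prod measurableSet_Icc

lemma volume_sqr (c : ℝ × ℝ) (R : ℝ) : volume (sqr c R) = ENNReal.ofReal R ^ 2 := by
  rw [sqr, Measure.volume_eq_prod, Measure.prod_prod, Real.volume_Icc, Real.volume_Icc, sq]
  congr 2 <;> ring

lemma ofReal_integral_sqr {p : ℝ} (hp : 0 < p) (c : ℝ × ℝ) (R : ℝ) {F : ℝ × ℝ → ℂ}
    (hF : Continuous F) {K : ℝ} (hK : ∀ x, ‖F x‖ ≤ K) :
    ENNReal.ofReal (∫ x in sqr c R, ‖F x‖ ^ p) = ∫⁻ x in sqr c R, ‖F x‖ₑ ^ p := by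
  have hfin : IsFiniteMeasure (volume.restrict (sqr c R)) := by
    constructor; rw [Measure.restrict_apply_univ, volume_sqr]
    exact ENNReal.pow_lt_top ENNReal.ofReal_lt_top
  have := lintegral_enorm_rpow_mul (μ := volume.restrict (sqr c R)) hp.le
    hF.aestronglyMeasurable hK (integrable_const (1 : ℝ)) (fun _ => zero_le_one)
  simpa using this.symm

lemma decIneq_iff {p : ℝ} (hp : 0 < p) {n : ℕ} (hn : 0 < n) {D : ℝ} (hD : 0 ≤ D) :
    DecIneq p n D ↔ ∀ g : ℝ → ℂ, IntegrableOn g (Set.Icc 0 1) → ∀ c : ℝ × ℝ,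
      ∫⁻ x in sqr c ((n : ℝ) ^ 2), ‖extOp 0 1 g x‖ₑ ^ p ≤
        ENNReal.ofReal D ^ p * (∑ q ∈ Finset.range n, wInt p c ((n : ℝ) ^ 2)
          (extOp ((q : ℝ) / n) (((q : ℝ) + 1) / n) g) ^ (2 / p)) ^ (p / 2) := by
  unfold DecIneq
  refine forall_congr' fun g => forall_congr' fun hg => forall_congr' fun c => ?_
  have hn' : (0 : ℝ) < n := by exact_mod_cast hn
  have hR : (0 : ℝ) < (n : ℝ) ^ 2 := by positivity
  obtain ⟨hc, K, hK⟩ := extOp_props hg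
  have hsub : ∀ q ∈ Finset.range n, Set.Icc ((q : ℝ) / n) (((q : ℝ) + 1) / n) ⊆ Set.Icc 0 1 := by
    intro q hq
    refine Set.Icc_subset_Icc (by positivity) ?_
    rw [div_le_one hn']; exact_mod_cast Finset.mem_range.1 hq
  rw [← ofReal_integral_sqr hp c _ hc hK]
  have e : ∑ q ∈ Finset.range n, wInt p c ((n : ℝ) ^ 2)
      (extOp ((q : ℝ) / n) (((q : ℝ) + 1) / n) g) ^ (2 / p) =
      ENNReal.ofReal (∑ q ∈ Finset.range n, wLp p (wB c ((n : ℝ) ^ 2))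
        (extOp ((q : ℝ) / n) (((q : ℝ) + 1) / n) g) ^ 2) := by
    rw [ENNReal.ofReal_sum_of_nonneg fun _ _ => sq_nonneg _]
    refine Finset.sum_congr rfl fun q hq => ?_
    obtain ⟨hc, K, hK⟩ := extOp_props (hg.mono_set (hsub q hq))
    exact (ofReal_wLp_sq hp c hR hc hK).symm
  rw [e]
  set S := ∑ q ∈ Finset.range n, wLp p (wB c ((n : ℝ) ^ 2))
        (extOp ((q : ℝ) / n) (((q : ℝ) + 1) / n) g) ^ 2
  have hS : 0 ≤ S := Finset.sum_nonneg fun _ _ => sq_nonneg _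
  rw [ENNReal.ofReal_rpow_of_nonneg hD hp.le, ENNReal.ofReal_rpow_of_nonneg hS (by positivity),
    ← ENNReal.ofReal_mul (by positivity), ENNReal.ofReal_le_ofReal_iff (by positivity), sqLp]
  set X := ∫ x in sqr c ((n : ℝ) ^ 2), ‖extOp 0 1 g x‖ ^ p
  have hX : 0 ≤ X := integral_nonneg fun _ => by positivity
  have e2 : D ^ p * S ^ (p / 2) = (D * S ^ (1 / 2 : ℝ)) ^ p := by
    rw [Real.mul_rpow hD (by positivity), ← Real.rpow_mul hS]; congr 2; ring
  rw [e2, one_div, Real.rpow_inv_le_iff_of_pos hX (by positivity) hp]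

lemma norm_ex_sub_one_le (θ : ℝ) : ‖ex θ - 1‖ ≤ 2 * Real.pi * |θ| := by
  have := Real.norm_exp_I_mul_ofReal_sub_one_le (x := 2 * Real.pi * θ)
  have e : ex θ = Complex.exp (Complex.I * ((2 * Real.pi * θ : ℝ) : ℂ)) := by
    unfold ex; congr 1; push_cast; ring
  rw [e]
  refine this.trans (le_of_eq ?_)
  rw [Real.norm_eq_abs, abs_mul, abs_of_pos Real.two_pi_pos]

lemma extE_const_indicator_bounds {h R : ℝ} (hh : 0 < h) (h1 : h ≤ 1) (hR : h * R ≤ 1 / 16)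
    {x : ℝ × ℝ} (hx : x ∈ sqr 0 R) :
    1 / 2 ≤ ‖extE ((Set.Icc 0 h).indicator fun _ => ((h⁻¹ : ℝ) : ℂ)) x‖ := by
  set c : ℂ := ((h⁻¹ : ℝ) : ℂ)
  have hc : ‖c‖ = h⁻¹ := by rw [Complex.norm_real, Real.norm_of_nonneg (by positivity)]
  have hR0 : 0 ≤ R := by
    have := hx.1.1.trans hx.1.2; linarith
  have e : extE ((Set.Icc 0 h).indicator fun _ => c) x =
      ∫ ξ in Set.Icc 0 h, c * ex (ξ * x.1 + ξ ^ 2 * x.2) := by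
    rw [extE, ← integral_indicator measurableSet_Icc]
    congr 1; ext ξ
    by_cases hξ : ξ ∈ Set.Icc 0 h <;> simp [hξ]
  have hone : ∫ ξ in Set.Icc 0 h, c = 1 := by
    rw [setIntegral_const, measureReal_def, Real.volume_Icc]
    simp only [sub_zero, ENNReal.toReal_ofReal hh.le, Complex.real_smul, c]
    rw [← Complex.ofReal_mul, mul_inv_cancel₀ hh.ne', Complex.ofReal_one]
  have hfin : IsFiniteMeasure (volume.restrict (Set.Icc 0 h)) := by
    constructor; rw [Measure.restrict_apply_univ, Real.volume_Icc]; exact ENNReal.ofReal_lt_top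
  have hd : extE ((Set.Icc 0 h).indicator fun _ => c) x - 1 =
      ∫ ξ in Set.Icc 0 h, c * (ex (ξ * x.1 + ξ ^ 2 * x.2) - 1) := by
    rw [e]; nth_rewrite 1 [← hone]
    rw [← integral_sub]
    · congr 1; ext ξ; ring
    · exact (integrable_const c).mul_ex (by fun_prop)
    · exact integrable_const c
  have hb : ‖extE ((Set.Icc 0 h).indicator fun _ => c) x - 1‖ ≤
      (h⁻¹ * (2 * Real.pi * (h * R))) * volume.real (Set.Icc 0 h) := by
    rw [hd]
    refine norm_setIntegral_le_of_norm_le_const ?_ fun ξ hξ => ?_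
    · rw [Real.volume_Icc]; exact ENNReal.ofReal_lt_top
    rw [norm_mul, hc]
    have hx1 : |x.1| ≤ R / 2 := abs_le.2 (by have := hx.1; simpa using this)
    have hx2 : |x.2| ≤ R / 2 := abs_le.2 (by have := hx.2; simpa using this)
    have : |ξ * x.1 + ξ ^ 2 * x.2| ≤ h * R := by
      calc _ ≤ |ξ * x.1| + |ξ ^ 2 * x.2| := abs_add_le _ _
        _ = ξ * |x.1| + ξ ^ 2 * |x.2| := by
          rw [abs_mul, abs_mul, abs_of_nonneg hξ.1, abs_of_nonneg (sq_nonneg ξ)]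
        _ ≤ h * (R / 2) + h * (R / 2) := by
          have := hξ.1; have := hξ.2
          have h2 : ξ ^ 2 ≤ h := by nlinarith
          gcongr
        _ = _ := by ring
    have h2 := norm_ex_sub_one_le (ξ * x.1 + ξ ^ 2 * x.2)
    have h3 := Real.pi_pos
    gcongr
    exact h2.trans (by gcongr)
  rw [measureReal_def, Real.volume_Icc, sub_zero, ENNReal.toReal_ofReal hh.le] at hb
  have hb2 : ‖extE ((Set.Icc 0 h).indicator fun _ => c) x - 1‖ ≤ 1 / 2 := by
    refine hb.trans ?_
    have e : h⁻¹ * (2 * Real.pi * (h * R)) * h = 2 * Real.pi * (h * R) := by field_simp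
    rw [e]
    have := Real.pi_lt_four
    have := Real.pi_pos
    nlinarith [mul_nonneg hh.le hR0]
  have := norm_sub_norm_le (1 : ℂ) (1 - extE ((Set.Icc 0 h).indicator fun _ => c) x)
  rw [norm_sub_rev 1] at this
  simp only [norm_one, sub_sub_cancel] at this
  linarith

/-- Decoupling constants are bounded below. -/
lemma exists_decIneq_lower : ∃ K : ℝ≥0, ∀ p : ℝ, 4 < p → p < 6 → ∀ m : ℕ, 0 < m → ∀ D : ℝ, 0 ≤ D →
    DecIneq p m D → 1 ≤ K * ENNReal.ofReal D ^ p := by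
  refine ⟨64 * decayMass ^ 2, fun p hp4 hp6 m hm D hD hdec => ?_⟩
  have hm' : (0 : ℝ) < m := by exact_mod_cast hm
  have hm1 : (1 : ℝ) ≤ m := by exact_mod_cast hm
  have hp0 : 0 < p := by linarith
  set R : ℝ := (m : ℝ) ^ 2 with hRdef
  have hR : 0 < R := by positivity
  have hmR : (m : ℝ) ≤ R := by nlinarith
  set h : ℝ := 1 / (16 * R)
  have hh : 0 < h := by positivity
  have hhm : h < 1 / m := by
    apply one_div_lt_one_div_of_lt hm'; linarith
  have hh1 : h ≤ 1 := by
    rw [div_le_one (by positivity)]; linarith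
  have hhR : h * R ≤ 1 / 16 := by
    apply le_of_eq; simp only [h]; field_simp
  set g : ℝ → ℂ := (Set.Icc 0 h).indicator fun _ => ((h⁻¹ : ℝ) : ℂ) with hg
  have hgi : Integrable g := by
    rw [hg, integrable_indicator_iff measurableSet_Icc]
    exact integrableOn_const (by rw [Real.volume_Icc]; exact ENNReal.ofReal_ne_top)
  have hgn : ∫ ξ, ‖g ξ‖ = 1 := by
    have : ∀ ξ, ‖g ξ‖ = (Set.Icc 0 h).indicator (fun _ => h⁻¹) ξ := fun ξ => by
      by_cases hξ : ξ ∈ Set.Icc 0 h <;> simp [hg, hξ, abs_of_pos hh]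
    simp_rw [this]
    rw [integral_indicator measurableSet_Icc, setIntegral_const, measureReal_def, Real.volume_Icc]
    simp only [sub_zero, ENNReal.toReal_ofReal hh.le, smul_eq_mul]
    exact mul_inv_cancel₀ hh.ne'
  have hE : ∀ b, h ≤ b → extOp 0 b g = extE g := fun b hb => by
    rw [extOp_eq_extE, hg, Set.indicator_indicator,
      Set.inter_eq_self_of_subset_right (Set.Icc_subset_Icc le_rfl hb)]
  have hz : ∀ q ∈ Finset.range m, q ≠ 0 →
      wInt p 0 R (extOp ((q : ℝ) / m) (((q : ℝ) + 1) / m) g) ^ (2 / p) = 0 := by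
    intro q _ hq
    have : extOp ((q : ℝ) / m) (((q : ℝ) + 1) / m) g = 0 := by
      rw [extOp_eq_extE]
      have : (Set.Icc ((q : ℝ) / m) (((q : ℝ) + 1) / m)).indicator g = 0 := by
        ext ξ
        simp only [Set.indicator_apply, Pi.zero_apply, ite_eq_right_iff, hg]
        intro h1 h2
        exfalso
        have : (1 : ℝ) ≤ q := by exact_mod_cast Nat.one_le_iff_ne_zero.2 hq
        have : 1 / (m : ℝ) ≤ q / m := by gcongr
        linarith [h1.1, h2.2]
      rw [this]; ext x; simp [extE]
    rw [this, wInt]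
    simp [hp0]
  have key := (decIneq_iff hp0 hm hD).1 hdec g hgi.integrableOn 0
  rw [hE 1 hh1, Finset.sum_eq_single_of_mem 0 (Finset.mem_range.2 hm) hz] at key
  simp only [CharP.cast_eq_zero, zero_div, zero_add] at key
  rw [hE _ hhm.le, ← ENNReal.rpow_mul, div_mul_div_cancel₀ hp0.ne', div_self two_ne_zero,
    ENNReal.rpow_one] at key
  have lower : (64 : ℝ≥0∞)⁻¹ * ENNReal.ofReal R ^ 2 ≤ ∫⁻ x in sqr 0 R, ‖extE g x‖ₑ ^ p := by
    rw [← volume_sqr 0 R, ← setLIntegral_const]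
    refine setLIntegral_mono' (measurableSet_sqr _ _) fun x hx => ?_
    have h1 := extE_const_indicator_bounds hh hh1 hhR hx
    calc (64 : ℝ≥0∞)⁻¹ = (2⁻¹ : ℝ≥0∞) ^ (6 : ℝ) := by
          rw [show (6 : ℝ) = ((6 : ℕ) : ℝ) by norm_num, ENNReal.rpow_natCast, ← ENNReal.inv_pow]
          norm_num
      _ ≤ (2⁻¹ : ℝ≥0∞) ^ p := ENNReal.rpow_le_rpow_of_exponent_ge (by simp) hp6.le
      _ ≤ _ := by
        gcongr
        rw [← ofReal_norm, show (2⁻¹ : ℝ≥0∞) = ENNReal.ofReal (1 / 2) by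
          rw [one_div, ENNReal.ofReal_inv_of_pos two_pos]; norm_num]
        exact ENNReal.ofReal_le_ofReal h1
  have upper : wInt p 0 R (extE g) ≤ ENNReal.ofReal R ^ 2 * decayMass ^ 2 := by
    refine le_trans (lintegral_mono fun x => ?_) (lintegral_wB_le 0 hR)
    have : ‖extE g x‖ₑ ≤ 1 := by
      rw [← ofReal_norm]
      exact (ENNReal.ofReal_le_ofReal ((extE_norm_le g x).trans hgn.le)).trans (by simp)
    calc _ ≤ (1 : ℝ≥0∞) ^ p * ENNReal.ofReal (wB 0 R x) := by gcongr
      _ = _ := by simp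
  have hfin := lower.trans (key.trans (mul_le_mul_right upper _))
  have hR2 : ENNReal.ofReal R ^ 2 ≠ 0 := by simp [hR]
  have hR3 : ENNReal.ofReal R ^ 2 ≠ ∞ := by simp
  have h5 : (64 : ℝ≥0∞)⁻¹ * ENNReal.ofReal R ^ 2 ≤
      (ENNReal.ofReal D ^ p * decayMass ^ 2) * ENNReal.ofReal R ^ 2 := by
    refine hfin.trans (le_of_eq ?_); ring
  rw [ENNReal.mul_le_mul_iff_left hR2 hR3] at h5
  calc (1 : ℝ≥0∞) = 64 * 64⁻¹ := (ENNReal.mul_inv_cancel (by norm_num) (by norm_num)).symm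
    _ ≤ 64 * (ENNReal.ofReal D ^ p * decayMass ^ 2) := by gcongr
    _ = _ := by push_cast; ring

end

noncomputable section

open scoped ENNReal NNReal ContDiff

lemma exists_bump (r s : ℝ) (hr : 0 < r) (hs : r < s) : ∃ χ : ℝ → ℂ, ContDiff ℝ ∞ χ ∧
    HasCompactSupport χ ∧ (∀ x, |x| ≤ r → χ x = 1) ∧ ∀ x, s ≤ |x| → χ x = 0 := by
  let b : ContDiffBump (0 : ℝ) := ⟨r, s, hr, hs⟩
  refine ⟨fun x => ((b x : ℝ) : ℂ), ?_, ?_, fun x hx => ?_, fun x hx => ?_⟩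
  · exact Complex.ofRealCLM.contDiff.comp b.contDiff
  · exact b.hasCompactSupport.comp_left (g := fun x : ℝ => (x : ℂ)) (by simp)
  · simp [b.one_of_mem_closedBall (x := x) (by simpa using hx)]
  · simp [b.zero_of_le_dist (x := x) (by simpa using hx)]

lemma integral_decay_two_sub {R : ℝ} (hR : 0 < R) (y : ℝ) :
    Integrable (fun x => decay 2 R (y - x)) ∧ ∫ x, decay 2 R (y - x) = R * decayMass := by
  have h := (integrable_one_add_abs_pow le_rfl).comp_div hR.ne'
  have e : (fun x => ((1 + |x / R|) ^ 2)⁻¹) = decay 2 R := by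
    ext x; simp [decay, abs_div, abs_of_pos hR]
  rw [e] at h
  refine ⟨h.comp_sub_left y, ?_⟩
  rw [integral_sub_left_eq_self (decay 2 R) volume y, ← e,
    Measure.integral_comp_div (fun y : ℝ => ((1 + |y|) ^ 2)⁻¹) R, abs_of_pos hR, smul_eq_mul,
    decayMass, Real.coe_toNNReal _ (integral_nonneg fun y => by positivity)]

lemma setIntegral_norm_le_of_decay {k : ℝ → ℂ} (hk : Continuous k) {K R : ℝ} (hK : 0 ≤ K)
    (hR : 0 < R) {A : ℕ} (hd : ∀ x, ‖k x‖ ≤ K / R * decay (A + 2) R x) {S : Set ℝ}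
    (hS : MeasurableSet S) {y d : ℝ} (hd0 : 0 ≤ d) (hy : ∀ x ∈ S, d ≤ |y - x|) :
    ∫ x in S, ‖k (y - x)‖ ≤ K * decayMass * ((1 + d / R) ^ A)⁻¹ := by
  obtain ⟨hi, he⟩ := integral_decay_two_sub hR y
  have hb : ∀ x ∈ S, ‖k (y - x)‖ ≤ K / R * ((1 + d / R) ^ A)⁻¹ * decay 2 R (y - x) := by
    intro x hx
    refine (hd _).trans ?_
    rw [mul_assoc]
    gcongr
    unfold decay
    rw [pow_add, mul_inv]
    have := hy x hx
    gcongr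
  have hi2 := hi.const_mul (K / R * ((1 + d / R) ^ A)⁻¹)
  have hi1 : IntegrableOn (fun x => ‖k (y - x)‖) S := by
    refine Integrable.mono' hi2.integrableOn ?_ ?_
    · exact (Continuous.aestronglyMeasurable (by fun_prop))
    · filter_upwards [ae_restrict_mem hS] with x hx
      rw [norm_norm]; exact hb x hx
  calc _ ≤ ∫ x in S, K / R * ((1 + d / R) ^ A)⁻¹ * decay 2 R (y - x) :=
        setIntegral_mono_on hi1 hi2.integrableOn hS hb
    _ ≤ ∫ x, K / R * ((1 + d / R) ^ A)⁻¹ * decay 2 R (y - x) := by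
        refine setIntegral_le_integral hi2 (Filter.Eventually.of_forall fun x => ?_)
        exact mul_nonneg (by positivity) (decay_nonneg _ hR _)
    _ = _ := by rw [integral_const_mul, he]; field_simp

lemma inv_pow_le_mul_inv_pow {a z w : ℝ} (ha : 0 < a) (hz : 0 < z) (h : z / a ≤ w) (N : ℕ) :
    (w ^ N)⁻¹ ≤ a ^ N * (z ^ N)⁻¹ := by
  have : a ^ N * (z ^ N)⁻¹ = ((z / a) ^ N)⁻¹ := by
    rw [div_pow, inv_div, div_eq_mul_inv]
  rw [this]
  gcongr

lemma exists_cutoff (A : ℕ) : ∃ C : ℝ, 1 ≤ C ∧ ∀ m : ℝ, 1 ≤ m → ∃ φ : ℝ → ℂ, Measurable φ ∧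
    (∀ y, ‖φ y‖ ≤ C * decay A (m ^ 2) y) ∧
    (∀ y, |y| ≤ 3 * m ^ 2 → ‖1 - φ y‖ ≤ C * (m ^ A)⁻¹) ∧
    ∀ ζ, 1 / (4 * m) ≤ |ζ| → ∫ y, φ y * ex (-(ζ * y)) = 0 := by
  obtain ⟨β, hβ, hβc, hβ1, hβ0⟩ := exists_bump (1 / 2) 1 (by norm_num) (by norm_num)
  obtain ⟨K, hK, hdec⟩ := kap_rescale_decay (A + 2) hβ hβc
  refine ⟨max 1 (K * decayMass * 20 ^ A), le_max_left _ _, fun m hm => ?_⟩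
  set C := max 1 (K * decayMass * 20 ^ A)
  have hm0 : 0 < m := by linarith
  have h4m : 0 < 4 * m := by positivity
  set R := m ^ 2 with hR
  have hR0 : 0 < R := by positivity
  have hmR : m ≤ R := by nlinarith
  set B : ℝ → ℂ := fun ξ => β (4 * m * (ξ - 0)) with hB
  have hBs : ContDiff ℝ ∞ B := hβ.comp (by fun_prop)
  have hBc : HasCompactSupport B := rescale_hasCompactSupport hβc h4m 0
  set k := kap B 0 with hk
  have hkc : Continuous k :=
    (continuous_kap hBs.continuous hBc).comp (Continuous.prodMk_right (0 : ℝ))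
  have hki : Integrable k := integrable_kap hBs hBc 0
  have hkd : ∀ x, ‖k x‖ ≤ K / (4 * m) * decay (A + 2) (4 * m) x := fun x => by
    have := hdec (4 * m) 0 0 x h4m
    simpa [decay, hk, hB] using this
  have hinv : ∀ ζ, ∫ y, k y * ex (-(ζ * y)) = B ζ := fun ζ => by
    have := kap_inversion hBs hBc 0 ζ
    simpa [ex_zero] using this
  set S := Set.Icc (-(4 * R)) (4 * R)
  have hS : MeasurableSet S := measurableSet_Icc
  have hint : ∫ x, k x = 1 := by
    have := hinv 0
    simpa [ex_zero, hB, hβ1 0 (by norm_num)] using this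
  have hconv := (Integrable.convolution_integrand (μ := volume) (ν := volume)
    (ContinuousLinearMap.mul ℝ ℂ) (f := S.indicator 1) (g := k)
    ((integrable_indicator_iff hS).2 (integrableOn_const (by
      rw [Real.volume_Icc]; exact ENNReal.ofReal_ne_top))) hki)
  have hφe : ∀ y, ∫ x in S, k (y - x) = ∫ x, S.indicator 1 x * k (y - x) := fun y => by
    rw [← integral_indicator hS]; congr 1; ext x
    by_cases hx : x ∈ S <;> simp [hx]
  refine ⟨fun y => ∫ x in S, k (y - x), ?_, fun y => ?_, fun y hy => ?_, fun ζ hζ => ?_⟩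
  · refine StronglyMeasurable.measurable (StronglyMeasurable.integral_prod_right
      (f := fun y x => k (y - x)) ?_)
    refine Continuous.stronglyMeasurable ?_
    simp only [Function.uncurry_def]; fun_prop
  · have h1 := setIntegral_norm_le_of_decay hkc hK.le h4m hkd hS (y := y)
      (d := max 0 (|y| - 4 * R)) (le_max_left _ _) (fun x hx => by
        have : |x| ≤ 4 * R := abs_le.2 hx
        have := abs_sub_abs_le_abs_sub y x
        exact max_le (abs_nonneg _) (by linarith))
    refine (norm_integral_le_integral_norm _).trans (h1.trans ?_)
    have h2 : (1 + |y| / R) / 20 ≤ 1 + max 0 (|y| - 4 * R) / (4 * m) := by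
      rcases le_total |y| (5 * R) with h | h
      · have e1 : |y| / R ≤ 5 := by rw [div_le_iff₀ hR0]; linarith
        have : 0 ≤ max 0 (|y| - 4 * R) / (4 * m) := by positivity
        linarith
      · have e1 : |y| / R ≤ |y| / m := by gcongr
        have e2 : |y| / m / 20 ≤ max 0 (|y| - 4 * R) / (4 * m) := by
          rw [div_div, div_le_div_iff₀ (by positivity) (by positivity)]
          have := le_max_right 0 (|y| - 4 * R)
          nlinarith
        linarith
    have h3 : ((1 + max 0 (|y| - 4 * R) / (4 * m)) ^ A)⁻¹ ≤ 20 ^ A * decay A R y := by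
      exact inv_pow_le_mul_inv_pow (by norm_num) (by positivity) h2 A
    calc _ ≤ K * decayMass * (20 ^ A * decay A R y) := by gcongr
      _ = K * decayMass * 20 ^ A * decay A R y := by ring
      _ ≤ _ := mul_le_mul_of_nonneg_right (le_max_right _ _) (decay_nonneg _ hR0 _)
  · have h1 := setIntegral_norm_le_of_decay hkc hK.le h4m hkd hS.compl (y := y)
      (d := R) hR0.le (fun x hx => by
        have : 4 * R < |x| := by
          by_contra! h; exact hx (abs_le.1 h)
        have := abs_sub_abs_le_abs_sub x y
        rw [abs_sub_comm]; linarith)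
    have hki' : Integrable fun x => k (y - x) := hki.comp_sub_left y
    have e : (1 : ℂ) - ∫ x in S, k (y - x) = ∫ x in Sᶜ, k (y - x) := by
      rw [← hint, ← integral_sub_left_eq_self k volume y, ← integral_add_compl hS hki']
      ring
    rw [e]
    refine (norm_integral_le_integral_norm _).trans (h1.trans ?_)
    have h2 : m / 20 ≤ 1 + R / (4 * m) := by
      have : R / (4 * m) = m / 4 := by rw [hR]; field_simp
      rw [this]; linarith
    have h3 : ((1 + R / (4 * m)) ^ A)⁻¹ ≤ 20 ^ A * (m ^ A)⁻¹ := by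
      exact inv_pow_le_mul_inv_pow (by norm_num) (by positivity) h2 A
    calc _ ≤ K * decayMass * (20 ^ A * (m ^ A)⁻¹) := by gcongr
      _ = K * decayMass * 20 ^ A * (m ^ A)⁻¹ := by ring
      _ ≤ _ := mul_le_mul_of_nonneg_right (le_max_right _ _) (by positivity)
  · have hBz : B ζ = 0 := by
      refine hβ0 _ ?_
      rw [sub_zero, abs_mul, abs_of_pos h4m]
      rwa [div_le_iff₀' h4m] at hζ
    have hI : Integrable (fun z : ℝ × ℝ => (S.indicator 1 z.2 * k (z.1 - z.2)) *
        ex (-(ζ * z.1))) (volume.prod volume) := by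
      refine Integrable.mul_ex ?_ (by fun_prop)
      simpa using hconv
    have hsw := integral_integral_swap
      (f := fun y x => (S.indicator 1 x * k (y - x)) * ex (-(ζ * y))) hI
    calc _ = ∫ y, ∫ x, (S.indicator 1 x * k (y - x)) * ex (-(ζ * y)) := by
          congr 1; ext y; simp only [hφe]; rw [integral_mul_const]
      _ = _ := hsw
      _ = ∫ x, (0 : ℂ) := by
          congr 1; ext x
          have e1 : ∫ y, S.indicator 1 x * k (y - x) * ex (-(ζ * y)) =
              ∫ y, S.indicator 1 x * k y * ex (-(ζ * (y + x))) := by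
            rw [← integral_add_right_eq_self _ x]; simp
          have e2 : ∀ y, S.indicator 1 x * k y * ex (-(ζ * (y + x))) =
              (S.indicator 1 x * ex (-(ζ * x))) * (k y * ex (-(ζ * y))) := fun y => by
            rw [mul_add, neg_add, ex_add]; ring
          rw [e1]; simp_rw [e2]
          rw [integral_const_mul, hinv, hBz, mul_zero]
      _ = 0 := by simp

lemma lintegral_kap_rescale_le {χ : ℝ → ℂ} (hχ : ContDiff ℝ ∞ χ) (hc : HasCompactSupport χ) :
    ∃ C : ℝ≥0, 1 ≤ C ∧ ∀ m a τ : ℝ, 0 < m →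
      ∫⁻ x, ‖kap (fun ξ => χ (m * (ξ - a))) τ x‖ₑ ≤
        C * ENNReal.ofReal ((1 + |τ| / m ^ 2) ^ 2) := by
  obtain ⟨K, hK, hdec⟩ := kap_rescale_decay 2 hχ hc
  refine ⟨max 1 (K.toNNReal * decayMass), le_max_left _ _, fun m a τ hm => ?_⟩
  calc _ ≤ ∫⁻ x, ENNReal.ofReal (K / m * (1 + |τ| / m ^ 2) ^ 2) *
        ENNReal.ofReal (decay 2 m (x + 2 * a * τ)) := by
        refine lintegral_mono fun x => ?_
        rw [← ofReal_norm, ← ENNReal.ofReal_mul (by positivity)]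
        exact ENNReal.ofReal_le_ofReal (hdec m a τ x hm)
    _ = ENNReal.ofReal (K / m * (1 + |τ| / m ^ 2) ^ 2) *
        ∫⁻ x, ENNReal.ofReal (decay 2 m x) := by
        rw [lintegral_const_mul, lintegral_add_right_eq_self
          (fun x => ENNReal.ofReal (decay 2 m x))]
        exact ((measurable_decay 2 m).comp (by fun_prop)).ennreal_ofReal
    _ ≤ ENNReal.ofReal (K / m * (1 + |τ| / m ^ 2) ^ 2) * (ENNReal.ofReal m * decayMass) := by
        gcongr; exact lintegral_decay_le le_rfl hm
    _ = ((K.toNNReal * decayMass : ℝ≥0) : ℝ≥0∞) * ENNReal.ofReal ((1 + |τ| / m ^ 2) ^ 2) := by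
        rw [← mul_assoc, ← ENNReal.ofReal_mul (by positivity),
          show K / m * (1 + |τ| / m ^ 2) ^ 2 * m = K * (1 + |τ| / m ^ 2) ^ 2 by field_simp,
          ENNReal.ofReal_mul hK.le, ENNReal.coe_mul]
        simp only [ENNReal.ofReal]; ring
    _ ≤ _ := by gcongr; exact le_max_right _ _

lemma exists_wInt_kap_le {χ : ℝ → ℂ} (hχ : ContDiff ℝ ∞ χ) (hc : HasCompactSupport χ) :
    ∃ C : ℝ≥0, ∀ p : ℝ, 4 < p → p < 6 → ∀ m a s : ℝ, 0 < m → |s| ≤ m ^ 2 / 2 →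
      ∀ (W : ℝ → ℂ) (F : ℝ × ℝ → ℂ), Measurable W → Continuous F →
      (∀ u t, F (u, t) = ∫ y, kap (fun ξ => χ (m * (ξ - a))) (t - s) (u - y) * W y) →
      wInt p 0 (m ^ 2) F ≤ C * ENNReal.ofReal (m ^ 2) * ∫⁻ y, ‖W y‖ₑ ^ p := by
  obtain ⟨K, hK1, hK⟩ := lintegral_kap_rescale_le hχ hc
  refine ⟨(4 * K) ^ 6 * decayMass, fun p hp4 hp6 m a s hm hs W F hW hF hFW => ?_⟩
  set R := m ^ 2 with hRd
  have hR : 0 < R := by positivity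
  have hp1 : 1 < p := by linarith
  have hp0 : 0 < p := by linarith
  have hXs : ContDiff ℝ ∞ fun ξ => χ (m * (ξ - a)) := hχ.comp (by fun_prop)
  have hXc := rescale_hasCompactSupport hc hm a
  have hkm : ∀ τ, Measurable fun x => ‖kap (fun ξ => χ (m * (ξ - a))) τ x‖ₑ := fun τ =>
    ((continuous_kap hXs.continuous hXc).comp (Continuous.prodMk_right τ)).measurable.enorm
  have slice : ∀ t, ∫⁻ u, ‖F (u, t)‖ₑ ^ p ≤
      ((4 * K) ^ 6 * ENNReal.ofReal ((1 + |t| / R) ^ 12)) * ∫⁻ y, ‖W y‖ₑ ^ p := by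
    intro t
    have h1 : (1 + |t - s| / R) ^ 2 ≤ 4 * (1 + |t| / R) ^ 2 := by
      have : 1 + |t - s| / R ≤ 2 * (1 + |t| / R) := by
        have e1 : |t - s| / R ≤ (|t| + R / 2) / R := by
          gcongr; exact (abs_sub _ _).trans (by linarith)
        have e2 : (|t| + R / 2) / R = |t| / R + 1 / 2 := by field_simp
        have : 0 ≤ |t| / R := by positivity
        linarith
      calc _ ≤ (2 * (1 + |t| / R)) ^ 2 := by gcongr
        _ = _ := by ring
    have hbase : (1 : ℝ≥0∞) ≤ 4 * K * ENNReal.ofReal ((1 + |t| / R) ^ 2) := by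
      have e1 : (1 : ℝ≥0∞) ≤ ENNReal.ofReal ((1 + |t| / R) ^ 2) := by
        rw [← ENNReal.ofReal_one]
        exact ENNReal.ofReal_le_ofReal (one_le_pow₀ (one_le_one_add_abs_div hR t))
      have e2 : (1 : ℝ≥0∞) ≤ K := by exact_mod_cast hK1
      calc (1 : ℝ≥0∞) = 1 * 1 * 1 := by simp
        _ ≤ _ := by gcongr; norm_num
    calc _ ≤ ∫⁻ u, (∫⁻ y, ‖kap (fun ξ => χ (m * (ξ - a))) (t - s) (u - y)‖ₑ * ‖W y‖ₑ) ^ p := by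
          refine lintegral_mono fun u => ?_
          rw [hFW]
          gcongr
          refine (enorm_integral_le_lintegral_enorm _).trans (le_of_eq ?_)
          simp_rw [enorm_mul]
      _ ≤ (∫⁻ y, ‖kap (fun ξ => χ (m * (ξ - a))) (t - s) y‖ₑ) ^ p * ∫⁻ y, ‖W y‖ₑ ^ p :=
          young_rpow (hkm _) hW.enorm hp1
      _ ≤ (4 * K * ENNReal.ofReal ((1 + |t| / R) ^ 2)) ^ p * ∫⁻ y, ‖W y‖ₑ ^ p := by
          gcongr
          refine (hK m a (t - s) hm).trans ?_
          rw [mul_comm (4 : ℝ≥0∞), mul_assoc]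
          gcongr
          refine (ENNReal.ofReal_le_ofReal h1).trans (le_of_eq ?_)
          rw [ENNReal.ofReal_mul (by norm_num)]; norm_num
      _ ≤ (4 * K * ENNReal.ofReal ((1 + |t| / R) ^ 2)) ^ (6 : ℝ) * ∫⁻ y, ‖W y‖ₑ ^ p := by
          gcongr
      _ = _ := by
          rw [show (6 : ℝ) = ((6 : ℕ) : ℝ) by norm_num, ENNReal.rpow_natCast, mul_pow,
            ← ENNReal.ofReal_pow (by positivity), ← pow_mul]
  calc wInt p 0 R F ≤ ∫⁻ x : ℝ × ℝ, ‖F x‖ₑ ^ p * ENNReal.ofReal (decay 100 R x.2) := by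
        refine lintegral_mono fun x => ?_
        gcongr
        simpa using wB_le_decay_snd 0 hR x
    _ = ∫⁻ t, ∫⁻ u, ‖F (u, t)‖ₑ ^ p * ENNReal.ofReal (decay 100 R t) := by
        rw [Measure.volume_eq_prod, lintegral_prod_symm']
        have := (measurable_decay 100 R)
        have := hF.measurable
        fun_prop
    _ ≤ ∫⁻ t, ((4 * K) ^ 6 * ∫⁻ y, ‖W y‖ₑ ^ p) * ENNReal.ofReal (decay 88 R t) := by
        refine lintegral_mono fun t => ?_
        rw [lintegral_mul_const]
        swap
        · have := hF.measurable; fun_prop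
        refine (mul_le_mul_left (slice t) _).trans (le_of_eq ?_)
        have e : ENNReal.ofReal ((1 + |t| / R) ^ 12) * ENNReal.ofReal (decay 100 R t) =
            ENNReal.ofReal (decay 88 R t) := by
          rw [← ENNReal.ofReal_mul (by positivity)]
          have := one_le_one_add_abs_div hR t
          congr 1; unfold decay; field_simp
        rw [← e]; ring
    _ ≤ ((4 * K) ^ 6 * ∫⁻ y, ‖W y‖ₑ ^ p) * (ENNReal.ofReal R * decayMass) := by
        rw [lintegral_const_mul _ (measurable_decay 88 R).ennreal_ofReal]
        gcongr; exact lintegral_decay_le (by norm_num) hR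
    _ = _ := by push_cast; ring

lemma abs_div_six_le {R u y a τ : ℝ} (ha : |a| ≤ 1) (hτ : |τ| ≤ R) (hu : |u| ≤ R / 2)
    (h : 3 * R ≤ |y|) : |y| / 6 ≤ |u - y + 2 * a * τ| := by
  have h2 : |a * τ| ≤ R := by
    rw [abs_mul]
    calc _ ≤ 1 * |τ| := by gcongr
      _ ≤ R := by linarith
  have h3 := abs_add_le (u - y + 2 * a * τ) (-(u + 2 * (a * τ)))
  have h4 := abs_add_le u (2 * (a * τ))
  rw [abs_mul 2, abs_two] at h4
  rw [abs_neg, show u - y + 2 * a * τ + -(u + 2 * (a * τ)) = -y by ring, abs_neg] at h3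
  linarith

lemma mul_one_add_div_eight_le {m y : ℝ} (hm : 0 < m) (h : 3 * m ^ 2 ≤ |y|) :
    m * (1 + |y| / m ^ 2) / 8 ≤ |y| / 6 / m := by
  have : m * (1 + |y| / m ^ 2) = (m ^ 2 + |y|) / m := by field_simp
  rw [this, div_div, div_div, div_le_div_iff₀ (by positivity) (by positivity)]
  nlinarith

lemma inv_pow_le_of_one_le {m z : ℝ} {A : ℕ} (hA : 112 ≤ A) (hm : 1 ≤ m) (hz : 1 ≤ z) :
    ((m * z) ^ A)⁻¹ ≤ (m ^ 6)⁻¹ * (((m ^ 2) ^ 2)⁻¹ * (z ^ 102)⁻¹) := by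
  have hm0 : 0 < m := by linarith
  have e : m ^ 6 * ((m ^ 2) ^ 2 * z ^ 102) = m ^ 10 * z ^ 102 := by ring
  have i1 : m ^ 10 ≤ m ^ A := pow_le_pow_right₀ hm (by omega)
  have i2 : z ^ 102 ≤ z ^ A := pow_le_pow_right₀ hz (by omega)
  have : 0 < z ^ 102 := by positivity
  rw [← mul_inv, ← mul_inv, e, mul_pow]
  gcongr

lemma far_kernel_decay {m L K τ : ℝ} {A : ℕ} (hA : 112 ≤ A) (hm : 1 ≤ m) (hL : 0 ≤ L) (hK : 1 ≤ K)
    {a u y κ ψ : ℝ} (ha : |a| ≤ 1) (hτ : |τ| ≤ m ^ 2) (hu : |u| ≤ m ^ 2 / 2) (hψ0 : 0 ≤ ψ)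
    (hκ : κ ≤ L / m * (1 + |τ| / m ^ 2) ^ A * decay A m (u - y + 2 * a * τ))
    (hψ : ψ ≤ 2 * K) (hψ' : |y| ≤ 3 * m ^ 2 → ψ ≤ K * (m ^ A)⁻¹) :
    κ * ψ ≤ (L * 2 ^ A * (2 * K) * 8 ^ A) * ((m ^ 6)⁻¹ * (((m ^ 2) ^ 2)⁻¹ * decay 102 (m ^ 2) y)) := by
  have hm0 : 0 < m := by linarith
  have hR : 0 < m ^ 2 := by positivity
  have h1z := one_le_one_add_abs_div hR y
  have hτ' : 1 + |τ| / m ^ 2 ≤ 2 := by linarith [(div_le_one hR).2 hτ]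
  have hd := decay_nonneg A hm0 (u - y + 2 * a * τ)
  have hb1 : κ ≤ L * 2 ^ A * decay A m (u - y + 2 * a * τ) := by
    refine hκ.trans ?_
    have e1 : L / m ≤ L := div_le_self hL hm
    gcongr
  have final : ((m * (1 + |y| / m ^ 2)) ^ A)⁻¹ ≤
      (m ^ 6)⁻¹ * (((m ^ 2) ^ 2)⁻¹ * decay 102 (m ^ 2) y) := inv_pow_le_of_one_le hA hm h1z
  have main : κ * ψ ≤ L * 2 ^ A * (2 * K) * (8 ^ A * ((m * (1 + |y| / m ^ 2)) ^ A)⁻¹) := by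
    rcases le_total |y| (3 * m ^ 2) with h | h
    · have e0 : κ ≤ L * 2 ^ A :=
        hb1.trans (mul_le_of_le_one_right (by positivity) (decay_le_one A hm0 _))
      have e1 : |y| / m ^ 2 ≤ 3 := by rwa [div_le_iff₀ hR]
      have e2 : (m ^ A)⁻¹ ≤ 8 ^ A * ((m * (1 + |y| / m ^ 2)) ^ A)⁻¹ := by
        refine inv_pow_le_mul_inv_pow (by norm_num) (by positivity) ?_ A
        rw [div_le_iff₀ (by norm_num)]
        gcongr
        linarith
      have e3 : 0 ≤ 8 ^ A * ((m * (1 + |y| / m ^ 2)) ^ A)⁻¹ := by positivity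
      calc κ * ψ ≤ (L * 2 ^ A) * ψ := by gcongr
        _ ≤ (L * 2 ^ A) * (K * (m ^ A)⁻¹) := by gcongr; exact hψ' h
        _ ≤ (L * 2 ^ A) * ((2 * K) * (8 ^ A * ((m * (1 + |y| / m ^ 2)) ^ A)⁻¹)) := by
          gcongr; linarith
        _ = _ := by ring
    · have e2 : decay A m (u - y + 2 * a * τ) ≤ 8 ^ A * ((m * (1 + |y| / m ^ 2)) ^ A)⁻¹ := by
        refine inv_pow_le_mul_inv_pow (by norm_num) (by positivity) ?_ A
        have e3 : |y| / 6 / m ≤ |u - y + 2 * a * τ| / m := by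
          gcongr; exact abs_div_six_le ha hτ hu h
        have e4 := mul_one_add_div_eight_le hm0 h
        linarith
      calc κ * ψ ≤ (L * 2 ^ A * (8 ^ A * ((m * (1 + |y| / m ^ 2)) ^ A)⁻¹)) * ψ := by
            gcongr; exact hb1.trans (by gcongr)
        _ ≤ (L * 2 ^ A * (8 ^ A * ((m * (1 + |y| / m ^ 2)) ^ A)⁻¹)) * (2 * K) := by gcongr
        _ = _ := by ring
  calc κ * ψ ≤ _ := main
    _ ≤ L * 2 ^ A * (2 * K) * (8 ^ A * ((m ^ 6)⁻¹ * (((m ^ 2) ^ 2)⁻¹ * decay 102 (m ^ 2) y))) := by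
        gcongr
    _ = _ := by ring

lemma exists_far_kernel_le {χ : ℝ → ℂ} (hχ : ContDiff ℝ ∞ χ) (hc : HasCompactSupport χ) (K : ℝ)
    (hK : 1 ≤ K) {A : ℕ} (hA : 112 ≤ A) :
    ∃ C : ℝ, 1 ≤ C ∧ ∀ (m : ℝ) (φ : ℝ → ℂ), 1 ≤ m → (∀ y, ‖φ y‖ ≤ K * decay A (m ^ 2) y) →
      (∀ y, |y| ≤ 3 * m ^ 2 → ‖1 - φ y‖ ≤ K * (m ^ A)⁻¹) → ∀ a τ u y : ℝ, |a| ≤ 1 →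
      |τ| ≤ m ^ 2 → |u| ≤ m ^ 2 / 2 →
      ‖kap (fun ξ => χ (m * (ξ - a))) τ (u - y)‖ * ‖1 - φ y‖ ≤
        C * ((m ^ 6)⁻¹ * (((m ^ 2) ^ 2)⁻¹ * decay 102 (m ^ 2) y)) := by
  obtain ⟨L, hL, hdec⟩ := kap_rescale_decay A hχ hc
  refine ⟨max 1 (L * 2 ^ A * (2 * K) * 8 ^ A), le_max_left _ _,
    fun m φ hm h1 h2 a τ u y ha hτ hu => ?_⟩
  have hm0 : 0 < m := by linarith
  have hR : 0 < m ^ 2 := by positivity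
  have hφ1 : ‖1 - φ y‖ ≤ 2 * K := by
    have e0 := norm_sub_le (1 : ℂ) (φ y)
    have e1 := h1 y
    have e2 := decay_le_one A hR y
    have e3 : K * decay A (m ^ 2) y ≤ K := mul_le_of_le_one_right (by linarith) e2
    rw [norm_one] at e0
    linarith
  refine (far_kernel_decay hA hm hL.le hK ha hτ hu (norm_nonneg _) (hdec m a τ (u - y) hm0) hφ1
    (h2 y)).trans ?_
  have := decay_nonneg 102 hR y
  gcongr
  exact le_max_right _ _

/-- Multiplying by a cutoff with small Fourier support enlarges the Fourier support slightly. -/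
lemma fourier_cutoff_extE_eq_zero {φ f : ℝ → ℂ} (hφ : Integrable φ) (hf : Integrable f) {r ξ : ℝ}
    (h0 : ∀ ζ, r ≤ |ζ| → ∫ y, φ y * ex (-(ζ * y)) = 0)
    (hξ : ∀ η, f η ≠ 0 → r ≤ |ξ - η|) (s : ℝ) :
    ∫ y, φ y * extE f (y, s) * ex (-(ξ * y)) = 0 := by
  have hF := integrable_prod_ex hφ hf
    (θ := fun z => z.2 * z.1 + z.2 ^ 2 * s - ξ * z.1) (by fun_prop)
  have := integral_integral_swap
    (f := fun y η => φ y * f η * ex (η * y + η ^ 2 * s - ξ * y)) hF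
  calc _ = ∫ y, ∫ η, φ y * f η * ex (η * y + η ^ 2 * s - ξ * y) := by
        congr 1; ext y
        rw [extE, ← integral_const_mul, ← integral_mul_const]
        congr 1; ext η
        have : ex (η * y + η ^ 2 * s - ξ * y) = ex (η * y + η ^ 2 * s) * ex (-(ξ * y)) := by
          rw [← ex_add]; congr 1
        rw [this]; ring
    _ = _ := this
    _ = ∫ η : ℝ, (0 : ℂ) := by
        congr 1; ext η
        by_cases h : f η = 0
        · simp [h]
        have e : ∀ y, φ y * f η * ex (η * y + η ^ 2 * s - ξ * y) =
            (f η * ex (η ^ 2 * s)) * (φ y * ex (-((ξ - η) * y))) := fun y => by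
          rw [show η * y + η ^ 2 * s - ξ * y = η ^ 2 * s + -((ξ - η) * y) by ring, ex_add]; ring
        simp_rw [e]
        rw [integral_const_mul, h0 _ (hξ η h), mul_zero]
    _ = 0 := by simp

lemma ENNReal.rpow_le_pow_six {x : ℝ≥0∞} (h : 1 ≤ x) {r : ℝ} (hr : r ≤ 6) : x ^ r ≤ x ^ 6 := by
  calc x ^ r ≤ x ^ (6 : ℝ) := ENNReal.rpow_le_rpow_of_exponent_le h hr
    _ = x ^ 6 := by rw [show (6 : ℝ) = ((6 : ℕ) : ℝ) by norm_num, ENNReal.rpow_natCast]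

/-- The `p`-th power of the weighted norm of `extE f` on the line at height `s`. -/
def lineInt (p R s : ℝ) (f : ℝ → ℂ) : ℝ≥0∞ :=
  ∫⁻ y, ‖extE f (y, s)‖ₑ ^ p * ENNReal.ofReal (decay 102 R y)

lemma lintegral_cutoff_rpow_le {A : ℕ} (hA : 102 ≤ A) {R K p : ℝ} (hR : 0 < R) (hK : 1 ≤ K)
    (hp1 : 1 ≤ p) (hp6 : p ≤ 6) {φ G : ℝ → ℂ} (hφ : ∀ y, ‖φ y‖ ≤ K * decay A R y) :
    ∫⁻ y, ‖φ y * G y‖ₑ ^ p ≤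
      ENNReal.ofReal K ^ 6 * ∫⁻ y, ‖G y‖ₑ ^ p * ENNReal.ofReal (decay 102 R y) := by
  have hp0 : 0 ≤ p := by linarith
  rw [← lintegral_const_mul' _ _ (by finiteness)]
  refine lintegral_mono fun y => ?_
  have hd := decay_nonneg A hR y
  have h1 : ‖φ y‖ₑ ^ p ≤ ENNReal.ofReal K ^ 6 * ENNReal.ofReal (decay 102 R y) := by
    calc ‖φ y‖ₑ ^ p ≤ (ENNReal.ofReal K * ENNReal.ofReal (decay A R y)) ^ p := by
          gcongr
          rw [← ofReal_norm, ← ENNReal.ofReal_mul (by linarith)]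
          exact ENNReal.ofReal_le_ofReal (hφ y)
      _ = ENNReal.ofReal K ^ p * ENNReal.ofReal (decay A R y) ^ p :=
          ENNReal.mul_rpow_of_nonneg _ _ hp0
      _ ≤ ENNReal.ofReal K ^ 6 * ENNReal.ofReal (decay A R y) ^ (1 : ℝ) := by
          refine mul_le_mul' (ENNReal.rpow_le_pow_six (by simpa using hK) hp6) ?_
          exact ENNReal.rpow_le_rpow_of_exponent_ge
            (by simpa using ENNReal.ofReal_le_ofReal (decay_le_one A hR y)) hp1
      _ ≤ _ := by
          rw [ENNReal.rpow_one]
          gcongr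
          exact decay_anti hA hR y
  rw [enorm_mul, ENNReal.mul_rpow_of_nonneg _ _ hp0]
  calc _ ≤ (ENNReal.ofReal K ^ 6 * ENNReal.ofReal (decay 102 R y)) * ‖G y‖ₑ ^ p := by gcongr
    _ = _ := by ring

lemma integrable_cutoff {A : ℕ} (hA : 2 ≤ A) {R K : ℝ} (hR : 0 < R) {φ : ℝ → ℂ}
    (hm : Measurable φ) (hφ : ∀ y, ‖φ y‖ ≤ K * decay A R y) : Integrable φ := by
  refine Integrable.mono' (g := fun y => K * decay A R y) ?_ hm.aestronglyMeasurable
    (Filter.Eventually.of_forall hφ)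
  refine Integrable.const_mul ?_ K
  refine integrable_of_lintegral_ofReal (measurable_decay A R) (decay_nonneg A hR) ?_
  exact ((lintegral_decay_le hA hR).trans_lt (by finiteness))

/-- A function frequency supported in the middle half of an interval is, on the square of side
`m ^ 2`, close to one generated by its values on a horizontal segment, with frequency support in
the full interval. -/
lemma exists_localized_piece : ∃ C : ℝ≥0, ∀ p : ℝ, 4 < p → p < 6 → ∀ m q : ℕ, q < m → ∀ s : ℝ,
    |s| ≤ (m : ℝ) ^ 2 / 2 → ∀ f : ℝ → ℂ, Integrable f →
    (∀ ξ, f ξ ≠ 0 → (q : ℝ) / m + 1 / (4 * m) ≤ ξ ∧ ξ ≤ q / m + 3 / (4 * m)) →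
    ∃ g : ℝ → ℂ, Integrable g ∧ (∀ ξ, g ξ ≠ 0 → (q : ℝ) / m < ξ ∧ ξ < (q + 1) / m) ∧
      wInt p 0 ((m : ℝ) ^ 2) (extE g) ≤
        C * ENNReal.ofReal ((m : ℝ) ^ 2) * lineInt p ((m : ℝ) ^ 2) s f ∧
      ∀ x ∈ sqr 0 ((m : ℝ) ^ 2), ‖extE f x - extE g x‖ₑ ^ p ≤
        C * (ENNReal.ofReal ((m : ℝ) ^ 6)⁻¹ ^ p *
          (ENNReal.ofReal (((m : ℝ) ^ 2) ^ 2)⁻¹ * lineInt p ((m : ℝ) ^ 2) s f)) := by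
  obtain ⟨χ, hχ, hχc, hχ1, -⟩ := exists_bump 4 5 (by norm_num) (by norm_num)
  obtain ⟨K, hK, hcut⟩ := exists_cutoff 112
  obtain ⟨C₁, hnear⟩ := exists_wInt_kap_le hχ hχc
  obtain ⟨C₂, hC₂, hfar⟩ := exists_far_kernel_le hχ hχc K hK le_rfl
  refine ⟨max (C₁ * K.toNNReal ^ 6) (C₂.toNNReal ^ 6 * max 1 decayMass ^ 6),
    fun p hp4 hp6 m q hqm s hs f hf hsupp => ?_⟩
  have hp0 : 0 < p := by linarith
  have hm1 : (1 : ℝ) ≤ m := by exact_mod_cast (by omega : 1 ≤ m)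
  have hm0 : (0 : ℝ) < m := by linarith
  have hR : 0 < (m : ℝ) ^ 2 := by positivity
  obtain ⟨φ, hφm, hφ1, hφ2, hφ0⟩ := hcut m hm1
  set a : ℝ := q / m with had
  have ha1 : |a| ≤ 1 := by
    rw [abs_of_nonneg (by positivity), had, div_le_one hm0]
    exact_mod_cast hqm.le
  set X : ℝ → ℂ := fun ξ => χ (m * (ξ - a)) with hXd
  have hXs : ContDiff ℝ ∞ X := hχ.comp (by fun_prop)
  have hXc : HasCompactSupport X := rescale_hasCompactSupport hχc hm0 a
  have hX1 : ∀ ξ, f ξ ≠ 0 → X ξ = 1 := fun ξ h => by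
    obtain ⟨h1, h2⟩ := hsupp ξ h
    have e1 : 0 ≤ ξ - a := by have : 0 < 1 / (4 * (m : ℝ)) := by positivity
                              linarith
    have e2 : m * (ξ - a) ≤ m * (3 / (4 * m)) := by gcongr; linarith
    have e3 : (m : ℝ) * (3 / (4 * m)) = 3 / 4 := by field_simp
    apply hχ1
    rw [abs_of_nonneg (by positivity)]
    linarith
  have hGc : Continuous fun y : ℝ => extE f (y, s) :=
    (continuous_extE hf).comp (by fun_prop)
  have hφi : Integrable φ := integrable_cutoff (by norm_num) hR hφm hφ1
  set W : ℝ → ℂ := fun y => φ y * extE f (y, s) with hWd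
  have hWi : Integrable W :=
    hφi.mul_bdd (c := ∫ ξ, ‖f ξ‖) hGc.aestronglyMeasurable
      (Filter.Eventually.of_forall fun y => extE_norm_le _ _)
  have hWm : Measurable W := hφm.mul hGc.measurable
  have hWhat : Continuous fun ξ : ℝ => ∫ y, W y * ex (-(ξ * y)) := by
    have := (continuous_extE hWi).comp (by fun_prop : Continuous fun ξ : ℝ => (-ξ, (0 : ℝ)))
    convert this using 2 with ξ
    simp only [Function.comp, extE]
    congr 1; ext y; congr 2; ring
  set g : ℝ → ℂ := fun ξ => X ξ * ex (-(ξ ^ 2 * s)) * ∫ y, W y * ex (-(ξ * y)) with hgd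
  have hgi : Integrable g := by
    apply Continuous.integrable_of_hasCompactSupport
    · exact (hXs.continuous.mul (by fun_prop : Continuous fun ξ : ℝ => -(ξ ^ 2 * s)).ex_comp).mul
        hWhat
    · exact (hXc.mul_right).mul_right
  have hgE : ∀ u t, extE g (u, t) = ∫ y, kap X (t - s) (u - y) * W y :=
    fun u t => extE_of_data hXs.continuous hXc hWi u t s
  have hline : ENNReal.ofReal K ^ 6 * lineInt p ((m : ℝ) ^ 2) s f ≥ ∫⁻ y, ‖W y‖ₑ ^ p :=
    lintegral_cutoff_rpow_le (by norm_num) hR hK (by linarith) hp6.le hφ1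
  refine ⟨g, hgi, fun ξ hξ => ?_, ?_, fun x hx => ?_⟩
  · by_contra hcon
    refine hξ ?_
    have : ∫ y, W y * ex (-(ξ * y)) = 0 := by
      refine fourier_cutoff_extE_eq_zero hφi hf hφ0 (fun η hη => ?_) s
      obtain ⟨h1, h2⟩ := hsupp η hη
      have e : ((q : ℝ) + 1) / m = a + 4 * (1 / (4 * m)) := by rw [had]; field_simp
      have e3 : 3 / (4 * (m : ℝ)) = 3 * (1 / (4 * m)) := by ring
      rcases not_and_or.1 hcon with h | h
      · rw [abs_sub_comm]
        exact le_trans (by linarith) (le_abs_self _)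
      · exact le_trans (by linarith) (le_abs_self _)
    simp [hgd, this]
  · calc _ ≤ C₁ * ENNReal.ofReal ((m : ℝ) ^ 2) * ∫⁻ y, ‖W y‖ₑ ^ p :=
          hnear p hp4 hp6 m a s hm0 hs W _ hWm (continuous_extE hgi) hgE
      _ ≤ C₁ * ENNReal.ofReal ((m : ℝ) ^ 2) *
          (ENNReal.ofReal K ^ 6 * lineInt p ((m : ℝ) ^ 2) s f) := by gcongr
      _ = ((C₁ * K.toNNReal ^ 6 : ℝ≥0) : ℝ≥0∞) * ENNReal.ofReal ((m : ℝ) ^ 2) *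
          lineInt p ((m : ℝ) ^ 2) s f := by
          push_cast; simp only [ENNReal.ofReal]; ring
      _ ≤ _ := by gcongr; exact le_max_left _ _
  · obtain ⟨u, t⟩ := x
    have hu : |u| ≤ (m : ℝ) ^ 2 / 2 := by
      have := hx.1; simp only [Prod.fst_zero, Set.mem_Icc] at this
      rw [abs_le]; constructor <;> linarith
    have ht : |t| ≤ (m : ℝ) ^ 2 / 2 := by
      have := hx.2; simp only [Prod.snd_zero, Set.mem_Icc] at this
      rw [abs_le]; constructor <;> linarith
    have hts : |t - s| ≤ (m : ℝ) ^ 2 := (abs_sub _ _).trans (by linarith)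
    have hkb : ∀ y, kap X (t - s) (u - y) * extE f (y, s) - kap X (t - s) (u - y) * W y =
        kap X (t - s) (u - y) * (1 - φ y) * extE f (y, s) := fun y => by rw [hWd]; ring
    have hki : Integrable fun y => kap X (t - s) (u - y) :=
      (integrable_kap hXs hXc (t - s)).comp_sub_left u
    have hdiff : extE f (u, t) - extE g (u, t) =
        ∫ y, kap X (t - s) (u - y) * (1 - φ y) * extE f (y, s) := by
      rw [extE_reproduce hXs hXc hf hX1 u t s, hgE, ← integral_sub]
      · simp_rw [hkb]
      · exact hki.mul_bdd hGc.aestronglyMeasurable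
          (Filter.Eventually.of_forall fun y => extE_norm_le _ _)
      · exact hWi.bdd_mul hki.aestronglyMeasurable
          (Filter.Eventually.of_forall fun y => kap_norm_le _ _)
    set k : ℝ → ℝ≥0∞ := fun y =>
      ENNReal.ofReal (((m : ℝ) ^ 2) ^ 2)⁻¹ * ENNReal.ofReal (decay 102 ((m : ℝ) ^ 2) y) with hkd
    have hkm : Measurable k := (measurable_decay _ _).ennreal_ofReal.const_mul _
    have hkmass : ∫⁻ y, k y ≤ (max 1 decayMass : ℝ≥0) := by
      rw [hkd, lintegral_const_mul _ (measurable_decay _ _).ennreal_ofReal]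
      calc _ ≤ ENNReal.ofReal (((m : ℝ) ^ 2) ^ 2)⁻¹ * (ENNReal.ofReal ((m : ℝ) ^ 2) * decayMass) := by
            gcongr; exact lintegral_decay_le (by norm_num) hR
        _ = ENNReal.ofReal ((((m : ℝ) ^ 2) ^ 2)⁻¹ * (m : ℝ) ^ 2) * decayMass := by
            rw [← mul_assoc, ENNReal.ofReal_mul (by positivity)]
        _ ≤ 1 * (max 1 decayMass : ℝ≥0) := by
            gcongr
            · rw [ENNReal.ofReal_le_one]
              have : (1 : ℝ) ≤ (m : ℝ) ^ 2 := one_le_pow₀ hm1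
              rw [show (((m : ℝ) ^ 2) ^ 2)⁻¹ * (m : ℝ) ^ 2 = ((m : ℝ) ^ 2)⁻¹ by field_simp]
              exact inv_le_one_of_one_le₀ this
            · exact le_max_right _ _
        _ = _ := one_mul _
    have hb : ‖extE f (u, t) - extE g (u, t)‖ₑ ≤ ENNReal.ofReal C₂ *
        (ENNReal.ofReal ((m : ℝ) ^ 6)⁻¹ * ∫⁻ y, k y * ‖extE f (y, s)‖ₑ) := by
      rw [hdiff, ← lintegral_const_mul' _ _ ENNReal.ofReal_ne_top,
        ← lintegral_const_mul' _ _ ENNReal.ofReal_ne_top]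
      refine (enorm_integral_le_lintegral_enorm _).trans (lintegral_mono fun y => ?_)
      have h := hfar m φ hm1 hφ1 hφ2 a (t - s) u y ha1 hts hu
      have h' : ‖kap X (t - s) (u - y) * (1 - φ y)‖ₑ ≤ ENNReal.ofReal C₂ *
          (ENNReal.ofReal ((m : ℝ) ^ 6)⁻¹ * k y) := by
        rw [← ofReal_norm, norm_mul, show k y = ENNReal.ofReal (((m : ℝ) ^ 2) ^ 2)⁻¹ *
          ENNReal.ofReal (decay 102 ((m : ℝ) ^ 2) y) from rfl, ← ENNReal.ofReal_mul (by positivity),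
          ← ENNReal.ofReal_mul (by positivity), ← ENNReal.ofReal_mul (by linarith)]
        exact ENNReal.ofReal_le_ofReal h
      rw [enorm_mul]
      calc _ ≤ _ := mul_le_mul_left h' _
        _ = _ := by ring
    have hcs := lintegral_mul_rpow_le (μ := volume) hkm.aemeasurable
      hGc.measurable.enorm.aemeasurable (show 1 < p by linarith)
    have hmass : (∫⁻ y, k y) ^ (p - 1) ≤ ((max 1 decayMass : ℝ≥0) : ℝ≥0∞) ^ 6 :=
      (ENNReal.rpow_le_rpow hkmass (by linarith)).trans
        (ENNReal.rpow_le_pow_six (by exact_mod_cast le_max_left 1 decayMass) (by linarith))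
    have hT : ∫⁻ y, k y * ‖extE f (y, s)‖ₑ ^ p =
        ENNReal.ofReal (((m : ℝ) ^ 2) ^ 2)⁻¹ * lineInt p ((m : ℝ) ^ 2) s f := by
      rw [lineInt, ← lintegral_const_mul' _ _ ENNReal.ofReal_ne_top]
      congr 1; ext y; rw [hkd]; ring
    rw [hT] at hcs
    calc _ ≤ (ENNReal.ofReal C₂ * (ENNReal.ofReal ((m : ℝ) ^ 6)⁻¹ *
            ∫⁻ y, k y * ‖extE f (y, s)‖ₑ)) ^ p := by gcongr
      _ = ENNReal.ofReal C₂ ^ p * (ENNReal.ofReal ((m : ℝ) ^ 6)⁻¹ ^ p *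
            (∫⁻ y, k y * ‖extE f (y, s)‖ₑ) ^ p) := by
          rw [ENNReal.mul_rpow_of_nonneg _ _ hp0.le, ENNReal.mul_rpow_of_nonneg _ _ hp0.le]
      _ ≤ ENNReal.ofReal C₂ ^ 6 * (ENNReal.ofReal ((m : ℝ) ^ 6)⁻¹ ^ p *
            (((max 1 decayMass : ℝ≥0) : ℝ≥0∞) ^ 6 *
            (ENNReal.ofReal (((m : ℝ) ^ 2) ^ 2)⁻¹ * lineInt p ((m : ℝ) ^ 2) s f))) := by
          gcongr
          · exact ENNReal.rpow_le_pow_six (by simpa using hC₂) hp6.le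
          · exact hcs.trans (mul_le_mul_left hmass _)
      _ = ((C₂.toNNReal ^ 6 * max 1 decayMass ^ 6 : ℝ≥0) : ℝ≥0∞) *
          (ENNReal.ofReal ((m : ℝ) ^ 6)⁻¹ ^ p *
            (ENNReal.ofReal (((m : ℝ) ^ 2) ^ 2)⁻¹ * lineInt p ((m : ℝ) ^ 2) s f)) := by
          push_cast; simp only [ENNReal.ofReal]; ring
      _ ≤ _ := by gcongr; exact le_max_right _ _

lemma ENNReal.le_sum_rpow_rpow {ι : Type*} {s : Finset ι} (T : ι → ℝ≥0∞) {i : ι} (hi : i ∈ s)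
    {p : ℝ} (hp : 0 < p) : T i ≤ (∑ j ∈ s, T j ^ (2 / p)) ^ (p / 2) := by
  calc T i = (T i ^ (2 / p)) ^ (p / 2) := by
        rw [← ENNReal.rpow_mul, div_mul_div_cancel₀ hp.ne', div_self two_ne_zero, ENNReal.rpow_one]
    _ ≤ _ := by
        gcongr
        exact Finset.single_le_sum (f := fun j => T j ^ (2 / p)) (fun _ _ => zero_le) hi

lemma ENNReal.sum_mul_rpow_rpow {ι : Type*} (s : Finset ι) (a : ℝ≥0∞) (T : ι → ℝ≥0∞) {p : ℝ}
    (hp : 0 < p) : (∑ j ∈ s, (a * T j) ^ (2 / p)) ^ (p / 2) =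
      a * (∑ j ∈ s, T j ^ (2 / p)) ^ (p / 2) := by
  simp_rw [ENNReal.mul_rpow_of_nonneg _ _ (by positivity : 0 ≤ 2 / p)]
  rw [← Finset.mul_sum, ENNReal.mul_rpow_of_nonneg _ _ (by positivity), ← ENNReal.rpow_mul,
    div_mul_div_cancel₀ hp.ne', div_self two_ne_zero, ENNReal.rpow_one]

lemma enorm_sum_rpow_le {ι : Type*} (s : Finset ι) (F : ι → ℂ) {p : ℝ} (hp : 1 ≤ p) :
    ‖∑ i ∈ s, F i‖ₑ ^ p ≤ (s.card : ℝ≥0∞) ^ (p - 1) * ∑ i ∈ s, ‖F i‖ₑ ^ p :=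
  (ENNReal.rpow_le_rpow (enorm_sum_le _ _) (by linarith)).trans
    (ENNReal.rpow_sum_le_const_mul_sum_rpow s _ hp)

lemma eq_of_mem_Ioo_div {m q q' : ℕ} {ξ : ℝ} (hm : 0 < m) (h1 : (q : ℝ) / m ≤ ξ)
    (h2 : ξ ≤ ((q : ℝ) + 1) / m) (h3 : (q' : ℝ) / m < ξ) (h4 : ξ < ((q' : ℝ) + 1) / m) :
    q' = q := by
  have hm' : (0 : ℝ) < m := by exact_mod_cast hm
  rw [div_le_iff₀ hm'] at h1
  rw [le_div_iff₀ hm'] at h2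
  rw [div_lt_iff₀ hm'] at h3
  rw [lt_div_iff₀ hm'] at h4
  have a1 : (q : ℝ) < q' + 1 := by linarith
  have a2 : (q' : ℝ) < q + 1 := by linarith
  norm_cast at a1 a2
  omega

lemma lintegral_sum_extE_le_of_decIneq {p : ℝ} (hp : 0 < p) {m : ℕ} (hm : 0 < m) {D : ℝ}
    (hD : 0 ≤ D) (hdec : DecIneq p m D) {g : ℕ → ℝ → ℂ} (hgi : ∀ q < m, Integrable (g q))
    (hg : ∀ q < m, ∀ ξ, g q ξ ≠ 0 → (q : ℝ) / m < ξ ∧ ξ < (q + 1) / m) (c : ℝ × ℝ) :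
    ∫⁻ x in sqr c ((m : ℝ) ^ 2), ‖∑ q ∈ Finset.range m, extE (g q) x‖ₑ ^ p ≤
      ENNReal.ofReal D ^ p * (∑ q ∈ Finset.range m,
        wInt p c ((m : ℝ) ^ 2) (extE (g q)) ^ (2 / p)) ^ (p / 2) := by
  have hm' : (0 : ℝ) < m := by exact_mod_cast hm
  set G : ℝ → ℂ := fun ξ => ∑ q ∈ Finset.range m, g q ξ with hG
  have hGi : Integrable G := integrable_finsetSum _ fun q hq => hgi q (Finset.mem_range.1 hq)
  have h := (decIneq_iff hp hm hD).1 hdec G hGi.integrableOn c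
  have e1 : (Set.Icc (0 : ℝ) 1).indicator G = G := by
    rw [Set.indicator_eq_self]
    intro ξ hξ
    obtain ⟨q, hq, hne⟩ := Finset.exists_ne_zero_of_sum_ne_zero hξ
    have hq' := Finset.mem_range.1 hq
    obtain ⟨h1, h2⟩ := hg q hq' ξ hne
    refine ⟨le_trans (by positivity) h1.le, h2.le.trans ?_⟩
    rw [div_le_one hm']
    exact_mod_cast hq'
  have e2 : ∀ q < m, (Set.Icc ((q : ℝ) / m) ((q + 1) / m)).indicator G = g q := fun q hq => by
    ext ξ
    by_cases hξ : ξ ∈ Set.Icc ((q : ℝ) / m) ((q + 1) / m)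
    · rw [Set.indicator_of_mem hξ, hG]
      refine Finset.sum_eq_single q (fun q' hq' hne => ?_) (fun h => (h (by simpa using hq)).elim)
      by_contra h0
      obtain ⟨h1, h2⟩ := hg q' (Finset.mem_range.1 hq') ξ h0
      exact hne (eq_of_mem_Ioo_div hm hξ.1 hξ.2 h1 h2)
    · rw [Set.indicator_of_notMem hξ]
      by_contra h0
      obtain ⟨h1, h2⟩ := hg q hq ξ (Ne.symm h0)
      exact hξ ⟨h1.le, h2.le⟩
  rw [extOp_eq_extE, e1] at h
  have e3 : ∀ x, extE G x = ∑ q ∈ Finset.range m, extE (g q) x :=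
    extE_sum _ fun q hq => hgi q (Finset.mem_range.1 hq)
  simp_rw [e3] at h
  refine h.trans (le_of_eq ?_)
  congr 2
  refine Finset.sum_congr rfl fun q hq => ?_
  rw [extOp_eq_extE, e2 q (Finset.mem_range.1 hq)]

/-- Decoupling on a square of side `m ^ 2` for functions with separated frequency supports, in
terms of the values on a single horizontal line. -/
lemma exists_local_decoupling : ∃ C : ℝ≥0, ∀ p : ℝ, 4 < p → p < 6 → ∀ m : ℕ, 0 < m →
    ∀ D : ℝ, 0 ≤ D → DecIneq p m D → ∀ s : ℝ, |s| ≤ (m : ℝ) ^ 2 / 2 → ∀ f : ℕ → ℝ → ℂ,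
    (∀ q < m, Integrable (f q)) →
    (∀ q < m, ∀ ξ, f q ξ ≠ 0 → (q : ℝ) / m + 1 / (4 * m) ≤ ξ ∧ ξ ≤ q / m + 3 / (4 * m)) →
    ∫⁻ x in sqr 0 ((m : ℝ) ^ 2), ‖∑ q ∈ Finset.range m, extE (f q) x‖ₑ ^ p ≤
      C * (ENNReal.ofReal ((m : ℝ) ^ 2) * (ENNReal.ofReal D ^ p *
        (∑ q ∈ Finset.range m, lineInt p ((m : ℝ) ^ 2) s (f q) ^ (2 / p)) ^ (p / 2))) := by
  obtain ⟨C, hpiece⟩ := exists_localized_piece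
  obtain ⟨K, hlow⟩ := exists_decIneq_lower
  refine ⟨32 * (C + C * K), fun p hp4 hp6 m hm D hD hdec s hs f hfi hf => ?_⟩
  have hp0 : 0 < p := by linarith
  have hm1 : (1 : ℝ) ≤ m := by exact_mod_cast hm
  have hR1 : (1 : ℝ) ≤ (m : ℝ) ^ 2 := one_le_pow₀ hm1
  have hex : ∀ q, ∃ g : ℝ → ℂ, q < m → (Integrable g ∧
      (∀ ξ, g ξ ≠ 0 → (q : ℝ) / m < ξ ∧ ξ < (q + 1) / m) ∧
      wInt p 0 ((m : ℝ) ^ 2) (extE g) ≤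
        C * ENNReal.ofReal ((m : ℝ) ^ 2) * lineInt p ((m : ℝ) ^ 2) s (f q) ∧
      ∀ x ∈ sqr 0 ((m : ℝ) ^ 2), ‖extE (f q) x - extE g x‖ₑ ^ p ≤
        C * (ENNReal.ofReal ((m : ℝ) ^ 6)⁻¹ ^ p *
          (ENNReal.ofReal (((m : ℝ) ^ 2) ^ 2)⁻¹ * lineInt p ((m : ℝ) ^ 2) s (f q)))) := by
    intro q
    by_cases hq : q < m
    · obtain ⟨g, hg⟩ := hpiece p hp4 hp6 m q hq s hs (f q) (hfi q hq) (hf q hq)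
      exact ⟨g, fun _ => hg⟩
    · exact ⟨0, fun h => (hq h).elim⟩
  choose g hg using hex
  set T : ℕ → ℝ≥0∞ := fun q => lineInt p ((m : ℝ) ^ 2) s (f q) with hT
  set S := (∑ q ∈ Finset.range m, T q ^ (2 / p)) ^ (p / 2) with hS
  have near := lintegral_sum_extE_le_of_decIneq hp0 hm hD hdec (fun q hq => (hg q hq).1)
    (fun q hq => (hg q hq).2.1) 0
  have near' : ∫⁻ x in sqr 0 ((m : ℝ) ^ 2), ‖∑ q ∈ Finset.range m, extE (g q) x‖ₑ ^ p ≤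
      C * (ENNReal.ofReal ((m : ℝ) ^ 2) * (ENNReal.ofReal D ^ p * S)) := by
    refine near.trans ?_
    calc _ ≤ ENNReal.ofReal D ^ p * (∑ q ∈ Finset.range m,
          (C * ENNReal.ofReal ((m : ℝ) ^ 2) * T q) ^ (2 / p)) ^ (p / 2) := by
          gcongr with q hq
          exact (hg q (Finset.mem_range.1 hq)).2.2.1
      _ = _ := by rw [ENNReal.sum_mul_rpow_rpow _ _ _ hp0]; ring
  have hmE : (1 : ℝ≥0∞) ≤ (m : ℝ≥0∞) := by exact_mod_cast hm
  have hpow : (m : ℝ≥0∞) ^ (p - 1) * m * ENNReal.ofReal ((m : ℝ) ^ 6)⁻¹ ^ p ≤ 1 := by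
    have e1 : (m : ℝ≥0∞) ^ (p - 1) * m = (m : ℝ≥0∞) ^ p := by
      conv_lhs => rw [← ENNReal.rpow_one (m : ℝ≥0∞), ← ENNReal.rpow_mul]
      rw [← ENNReal.rpow_add _ _ (by positivity) (by finiteness)]
      congr 1; ring
    rw [e1, ← ENNReal.mul_rpow_of_nonneg _ _ hp0.le]
    refine ENNReal.rpow_le_one ?_ hp0.le
    rw [← ENNReal.ofReal_natCast m, ← ENNReal.ofReal_mul (by positivity), ENNReal.ofReal_le_one]
    have : (m : ℝ) ≤ (m : ℝ) ^ 6 := le_self_pow₀ hm1 (by norm_num)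
    rw [← div_eq_mul_inv]
    exact div_le_one_of_le₀ this (by positivity)
  have far : ∫⁻ x in sqr 0 ((m : ℝ) ^ 2),
      ‖∑ q ∈ Finset.range m, (extE (f q) x - extE (g q) x)‖ₑ ^ p ≤
        C * K * (ENNReal.ofReal ((m : ℝ) ^ 2) * (ENNReal.ofReal D ^ p * S)) := by
    have hpt : ∀ x ∈ sqr 0 ((m : ℝ) ^ 2),
        ‖∑ q ∈ Finset.range m, (extE (f q) x - extE (g q) x)‖ₑ ^ p ≤
          C * (ENNReal.ofReal (((m : ℝ) ^ 2) ^ 2)⁻¹ * S) := fun x hx => by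
      calc _ ≤ (m : ℝ≥0∞) ^ (p - 1) * ∑ q ∈ Finset.range m,
            ‖extE (f q) x - extE (g q) x‖ₑ ^ p := by
            simpa using enorm_sum_rpow_le (Finset.range m) (fun q => extE (f q) x - extE (g q) x)
              (p := p) (by linarith)
        _ ≤ (m : ℝ≥0∞) ^ (p - 1) * ∑ q ∈ Finset.range m,
            C * (ENNReal.ofReal ((m : ℝ) ^ 6)⁻¹ ^ p *
              (ENNReal.ofReal (((m : ℝ) ^ 2) ^ 2)⁻¹ * S)) := by
            gcongr with q hq
            refine ((hg q (Finset.mem_range.1 hq)).2.2.2 x hx).trans ?_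
            gcongr
            exact ENNReal.le_sum_rpow_rpow T hq hp0
        _ = ((m : ℝ≥0∞) ^ (p - 1) * m * ENNReal.ofReal ((m : ℝ) ^ 6)⁻¹ ^ p) *
            (C * (ENNReal.ofReal (((m : ℝ) ^ 2) ^ 2)⁻¹ * S)) := by
            rw [Finset.sum_const, Finset.card_range, nsmul_eq_mul]; ring
        _ ≤ 1 * (C * (ENNReal.ofReal (((m : ℝ) ^ 2) ^ 2)⁻¹ * S)) := by gcongr
        _ = _ := one_mul _
    calc _ ≤ ∫⁻ x in sqr 0 ((m : ℝ) ^ 2), C * (ENNReal.ofReal (((m : ℝ) ^ 2) ^ 2)⁻¹ * S) :=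
          setLIntegral_mono measurable_const hpt
      _ = C * S * (ENNReal.ofReal (((m : ℝ) ^ 2) ^ 2)⁻¹ * ENNReal.ofReal ((m : ℝ) ^ 2) ^ 2) := by
          rw [setLIntegral_const, volume_sqr]; ring
      _ = C * S * 1 := by
          rw [← ENNReal.ofReal_pow (by positivity), ← ENNReal.ofReal_mul (by positivity),
            inv_mul_cancel₀ (by positivity), ENNReal.ofReal_one]
      _ ≤ C * S * (ENNReal.ofReal ((m : ℝ) ^ 2) * (K * ENNReal.ofReal D ^ p)) := by
          gcongr
          exact one_le_mul (by rw [ENNReal.one_le_ofReal]; exact hR1) (hlow p hp4 hp6 m hm D hD hdec)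
      _ = _ := by ring
  have hfc : ∀ q ∈ Finset.range m, Measurable (extE (f q)) := fun q hq =>
    (continuous_extE (hfi q (Finset.mem_range.1 hq))).measurable
  have hgc : ∀ q ∈ Finset.range m, Measurable (extE (g q)) := fun q hq =>
    (continuous_extE (hg q (Finset.mem_range.1 hq)).1).measurable
  calc _ ≤ ∫⁻ x in sqr 0 ((m : ℝ) ^ 2), 32 * (‖∑ q ∈ Finset.range m, extE (g q) x‖ₑ ^ p +
          ‖∑ q ∈ Finset.range m, (extE (f q) x - extE (g q) x)‖ₑ ^ p) := by
        refine lintegral_mono fun x => ?_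
        have e : ∑ q ∈ Finset.range m, extE (f q) x = ∑ q ∈ Finset.range m, extE (g q) x +
            ∑ q ∈ Finset.range m, (extE (f q) x - extE (g q) x) := by
          rw [← Finset.sum_add_distrib]; simp
        simp only [e]
        refine (ENNReal.rpow_le_rpow (enorm_add_le _ _) hp0.le).trans ?_
        refine (ENNReal.rpow_add_le_mul_rpow_add_rpow _ _ (by linarith)).trans ?_
        gcongr
        calc (2 : ℝ≥0∞) ^ (p - 1) ≤ 2 ^ (5 : ℝ) :=
              ENNReal.rpow_le_rpow_of_exponent_le (by norm_num) (by linarith)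
          _ = 32 := by
              rw [show (5 : ℝ) = ((5 : ℕ) : ℝ) by norm_num, ENNReal.rpow_natCast]; norm_num
    _ = 32 * ((∫⁻ x in sqr 0 ((m : ℝ) ^ 2), ‖∑ q ∈ Finset.range m, extE (g q) x‖ₑ ^ p) +
          ∫⁻ x in sqr 0 ((m : ℝ) ^ 2),
            ‖∑ q ∈ Finset.range m, (extE (f q) x - extE (g q) x)‖ₑ ^ p) := by
        rw [lintegral_const_mul' _ _ (by finiteness), lintegral_add_left]
        exact (Finset.measurable_sum _ hgc).enorm.pow_const _
    _ ≤ 32 * (C * (ENNReal.ofReal ((m : ℝ) ^ 2) * (ENNReal.ofReal D ^ p * S)) +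
          C * K * (ENNReal.ofReal ((m : ℝ) ^ 2) * (ENNReal.ofReal D ^ p * S))) := by gcongr
    _ = _ := by push_cast; ring

/-- The weight concentrated on the square of center `z` and side `R`, with a polynomial tail in the
first variable. -/
def tileWeight (R : ℝ) (z x : ℝ × ℝ) : ℝ≥0∞ :=
  ENNReal.ofReal (decay 102 R (x.1 - z.1)) * (Set.Icc (-(R / 2)) (R / 2)).indicator 1 (x.2 - z.2)

/-- The weight on the horizontal strip of height `8 * R` about `c`, decaying at scale `L`. -/
def stripWeight (L R : ℝ) (c x : ℝ × ℝ) : ℝ≥0∞ :=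
  ENNReal.ofReal (decay 100 L (x.1 - c.1)) * (Set.Icc (-(4 * R)) (4 * R)).indicator 1 (x.2 - c.2)

lemma measurable_tileWeight (R : ℝ) :
    Measurable fun w : (ℝ × ℝ) × (ℝ × ℝ) => tileWeight R w.1 w.2 := by
  unfold tileWeight
  have h1 := (measurable_decay 102 R).ennreal_ofReal
  have h2 : Measurable ((Set.Icc (-(R / 2)) (R / 2)).indicator (1 : ℝ → ℝ≥0∞)) :=
    measurable_one.indicator measurableSet_Icc
  exact (h1.comp (by fun_prop : Measurable fun w : (ℝ × ℝ) × (ℝ × ℝ) => w.2.1 - w.1.1)).mul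
    (h2.comp (by fun_prop : Measurable fun w : (ℝ × ℝ) × (ℝ × ℝ) => w.2.2 - w.1.2))

lemma measurable_tileWeight_right (R : ℝ) (z : ℝ × ℝ) : Measurable (tileWeight R z) := by
  unfold tileWeight
  have h1 := (measurable_decay 102 R).ennreal_ofReal
  have h2 : Measurable ((Set.Icc (-(R / 2)) (R / 2)).indicator (1 : ℝ → ℝ≥0∞)) :=
    measurable_one.indicator measurableSet_Icc
  exact (h1.comp (by fun_prop : Measurable fun x : ℝ × ℝ => x.1 - z.1)).mul
    (h2.comp (by fun_prop : Measurable fun x : ℝ × ℝ => x.2 - z.2))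

lemma measurable_tileWeight_left (R : ℝ) (x : ℝ × ℝ) : Measurable fun z => tileWeight R z x := by
  unfold tileWeight
  have h1 := (measurable_decay 102 R).ennreal_ofReal
  have h2 : Measurable ((Set.Icc (-(R / 2)) (R / 2)).indicator (1 : ℝ → ℝ≥0∞)) :=
    measurable_one.indicator measurableSet_Icc
  exact (h1.comp (by fun_prop : Measurable fun z : ℝ × ℝ => x.1 - z.1)).mul
    (h2.comp (by fun_prop : Measurable fun z : ℝ × ℝ => x.2 - z.2))

lemma measurable_stripWeight (L R : ℝ) (c : ℝ × ℝ) : Measurable (stripWeight L R c) := by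
  unfold stripWeight
  have h1 := (measurable_decay 100 L).ennreal_ofReal
  have h2 : Measurable ((Set.Icc (-(4 * R)) (4 * R)).indicator (1 : ℝ → ℝ≥0∞)) :=
    measurable_one.indicator measurableSet_Icc
  exact (h1.comp (by fun_prop : Measurable fun x : ℝ × ℝ => x.1 - c.1)).mul
    (h2.comp (by fun_prop : Measurable fun x : ℝ × ℝ => x.2 - c.2))

lemma mem_sqr_iff {c x : ℝ × ℝ} {R : ℝ} :
    x ∈ sqr c R ↔ |x.1 - c.1| ≤ R / 2 ∧ |x.2 - c.2| ≤ R / 2 := by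
  simp only [sqr, Set.mem_prod, Set.mem_Icc, abs_le]
  constructor <;> rintro ⟨⟨_, _⟩, _, _⟩ <;> refine ⟨⟨?_, ?_⟩, ?_, ?_⟩ <;> linarith

lemma mem_sqr_comm {x z : ℝ × ℝ} {R : ℝ} : x ∈ sqr z R ↔ z ∈ sqr x R := by
  simp only [mem_sqr_iff, abs_sub_comm]

lemma measurableSet_mem_sqr (R : ℝ) :
    MeasurableSet {w : (ℝ × ℝ) × (ℝ × ℝ) | w.2 ∈ sqr w.1 R} := by
  have h1 : MeasurableSet {w : (ℝ × ℝ) × (ℝ × ℝ) | |w.2.1 - w.1.1| ≤ R / 2} :=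
    measurableSet_le (by fun_prop) (by fun_prop)
  have h2 : MeasurableSet {w : (ℝ × ℝ) × (ℝ × ℝ) | |w.2.2 - w.1.2| ≤ R / 2} :=
    measurableSet_le (by fun_prop) (by fun_prop)
  convert h1.inter h2 using 1
  ext w
  exact mem_sqr_iff

lemma lintegral_sqr_translate (z : ℝ × ℝ) (R : ℝ) (Φ : ℝ × ℝ → ℝ≥0∞) :
    ∫⁻ x in sqr z R, Φ x = ∫⁻ x in sqr 0 R, Φ (x + z) := by
  rw [← lintegral_indicator (measurableSet_sqr _ _), ← lintegral_indicator (measurableSet_sqr _ _),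
    ← lintegral_add_right_eq_self _ z]
  congr 1; ext x
  have : x + z ∈ sqr z R ↔ x ∈ sqr 0 R := by simp [mem_sqr_iff]
  by_cases h : x ∈ sqr 0 R
  · rw [Set.indicator_of_mem h, Set.indicator_of_mem (this.2 h)]
  · rw [Set.indicator_of_notMem h, Set.indicator_of_notMem (mt this.1 h)]

lemma lintegral_lineInt_modulate {p R : ℝ} {f : ℝ → ℂ} (hf : Integrable f) (z : ℝ × ℝ) :
    ∫⁻ s in Set.Icc (-(R / 2)) (R / 2),
        lineInt p R s (fun ξ => f ξ * ex (ξ * z.1 + ξ ^ 2 * z.2)) =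
      ∫⁻ x, ‖extE f x‖ₑ ^ p * tileWeight R z x := by
  have hE := (continuous_extE hf).measurable
  have hw : Measurable fun x => ‖extE f x‖ₑ ^ p * tileWeight R z x :=
    (hE.enorm.pow_const _).mul (measurable_tileWeight_right R z)
  have hline : ∀ s, lineInt p R s (fun ξ => f ξ * ex (ξ * z.1 + ξ ^ 2 * z.2)) =
      ∫⁻ y, ‖extE f (y, s + z.2)‖ₑ ^ p * ENNReal.ofReal (decay 102 R (y - z.1)) := fun s => by
    rw [lineInt, ← lintegral_add_right_eq_self
      (fun y => ‖extE f (y, s + z.2)‖ₑ ^ p * ENNReal.ofReal (decay 102 R (y - z.1))) z.1]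
    refine lintegral_congr fun y => ?_
    rw [extE_modulate, add_sub_cancel_right]
    rfl
  rw [Measure.volume_eq_prod, lintegral_prod_symm' _ hw, ← lintegral_add_right_eq_self
    (fun s => ∫⁻ y, ‖extE f (y, s)‖ₑ ^ p * tileWeight R z (y, s)) z.2,
    ← lintegral_indicator measurableSet_Icc]
  refine lintegral_congr fun s => ?_
  by_cases hs : s ∈ Set.Icc (-(R / 2)) (R / 2)
  · rw [Set.indicator_of_mem hs, hline]
    simp only [tileWeight, add_sub_cancel_right, Set.indicator_of_mem hs, Pi.one_apply, mul_one]
  · simp only [tileWeight, add_sub_cancel_right, Set.indicator_of_notMem hs, mul_zero,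
      lintegral_zero]

/-- Frequency supports in the middle halves of the intervals of length `1 / m`. -/
def MiddleSupported (m : ℕ) (f : ℕ → ℝ → ℂ) : Prop :=
  ∀ q < m, Integrable (f q) ∧
    ∀ ξ, f q ξ ≠ 0 → (q : ℝ) / m + 1 / (4 * m) ≤ ξ ∧ ξ ≤ q / m + 3 / (4 * m)

lemma exists_tile_decoupling : ∃ C : ℝ≥0, ∀ p : ℝ, 4 < p → p < 6 → ∀ m : ℕ, 0 < m →
    ∀ D : ℝ, 0 ≤ D → DecIneq p m D → ∀ f : ℕ → ℝ → ℂ, MiddleSupported m f → ∀ z : ℝ × ℝ,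
    ∫⁻ x in sqr z ((m : ℝ) ^ 2), ‖∑ q ∈ Finset.range m, extE (f q) x‖ₑ ^ p ≤
      C * (ENNReal.ofReal D ^ p * (∑ q ∈ Finset.range m,
        (∫⁻ x, ‖extE (f q) x‖ₑ ^ p * tileWeight ((m : ℝ) ^ 2) z x) ^ (2 / p)) ^ (p / 2)) := by
  obtain ⟨C, hC⟩ := exists_local_decoupling
  refine ⟨C, fun p hp4 hp6 m hm D hD hdec f hf z => ?_⟩
  have hp0 : 0 < p := by linarith
  have hm' : (0 : ℝ) < m := by exact_mod_cast hm
  set R := (m : ℝ) ^ 2 with hRd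
  have hR : 0 < R := by positivity
  set fz : ℕ → ℝ → ℂ := fun q ξ => f q ξ * ex (ξ * z.1 + ξ ^ 2 * z.2) with hfz
  have hfzi : ∀ q < m, Integrable (fz q) := fun q hq => (hf q hq).1.mul_ex (by fun_prop)
  have hloc : ∀ s, |s| ≤ R / 2 →
      ∫⁻ x in sqr z R, ‖∑ q ∈ Finset.range m, extE (f q) x‖ₑ ^ p ≤
        C * (ENNReal.ofReal R * (ENNReal.ofReal D ^ p *
          (∑ q ∈ Finset.range m, lineInt p R s (fz q) ^ (2 / p)) ^ (p / 2))) := fun s hs => by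
    rw [lintegral_sqr_translate]
    have := hC p hp4 hp6 m hm D hD hdec s hs fz hfzi
      (fun q hq ξ hξ => (hf q hq).2 ξ (left_ne_zero_of_mul hξ))
    simpa only [hfz, extE_modulate] using this
  set I := Set.Icc (-(R / 2)) (R / 2) with hI
  have hvol : volume I = ENNReal.ofReal R := by rw [hI, Real.volume_Icc]; congr 1; ring
  have hR0 : ENNReal.ofReal R ≠ 0 := by simpa using hR
  have hmeas : ∀ q ∈ Finset.range m, AEMeasurable (fun s => lineInt p R s (fz q))
      (volume.restrict I) := fun q hq => by
    have hE := (continuous_extE (hfzi q (Finset.mem_range.1 hq))).measurable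
    have hd := measurable_decay 102 R
    have : Measurable (Function.uncurry fun s y : ℝ =>
        ‖extE (fz q) (y, s)‖ₑ ^ p * ENNReal.ofReal (decay 102 R y)) := by
      unfold Function.uncurry; fun_prop
    exact (this.lintegral_prod_right').aemeasurable
  have h2 : (2 / p) = 1 / (p / 2) := by field_simp
  have key : ENNReal.ofReal R *
      ∫⁻ x in sqr z R, ‖∑ q ∈ Finset.range m, extE (f q) x‖ₑ ^ p ≤
      ENNReal.ofReal R * (C * (ENNReal.ofReal D ^ p * (∑ q ∈ Finset.range m,
        (∫⁻ x, ‖extE (f q) x‖ₑ ^ p * tileWeight R z x) ^ (2 / p)) ^ (p / 2))) := by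
    calc _ = ∫⁻ s in I, ∫⁻ x in sqr z R, ‖∑ q ∈ Finset.range m, extE (f q) x‖ₑ ^ p := by
          rw [setLIntegral_const, hvol, mul_comm]
      _ ≤ ∫⁻ s in I, C * (ENNReal.ofReal R * (ENNReal.ofReal D ^ p *
          (∑ q ∈ Finset.range m, lineInt p R s (fz q) ^ (2 / p)) ^ (p / 2))) :=
          setLIntegral_mono' measurableSet_Icc fun s hs => hloc s (abs_le.2 hs)
      _ = C * (ENNReal.ofReal R * (ENNReal.ofReal D ^ p * ∫⁻ s in I,
          (∑ q ∈ Finset.range m, lineInt p R s (fz q) ^ (2 / p)) ^ (p / 2))) := by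
          rw [lintegral_const_mul' _ _ (by finiteness), lintegral_const_mul' _ _ (by finiteness),
            lintegral_const_mul' _ _ (by finiteness)]
      _ ≤ C * (ENNReal.ofReal R * (ENNReal.ofReal D ^ p * (∑ q ∈ Finset.range m,
          (∫⁻ s in I, lineInt p R s (fz q)) ^ (2 / p)) ^ (p / 2))) := by
          gcongr
          rw [h2]
          exact lintegral_sum_rpow_le _ hmeas (by linarith)
      _ = C * (ENNReal.ofReal R * (ENNReal.ofReal D ^ p * (∑ q ∈ Finset.range m,
          (∫⁻ x, ‖extE (f q) x‖ₑ ^ p * tileWeight R z x) ^ (2 / p)) ^ (p / 2))) := by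
          congr 4
          refine Finset.sum_congr rfl fun q hq => ?_
          rw [lintegral_lineInt_modulate (hf q (Finset.mem_range.1 hq)).1]
      _ = _ := by ring
  exact (ENNReal.mul_le_mul_iff_right hR0 ENNReal.ofReal_ne_top).1 key

/-- The rectangle of center `c` with half sides `a` and `b`. -/
def rect (c : ℝ × ℝ) (a b : ℝ) : Set (ℝ × ℝ) :=
  Set.Icc (c.1 - a) (c.1 + a) ×ˢ Set.Icc (c.2 - b) (c.2 + b)

lemma mem_rect_iff {c x : ℝ × ℝ} {a b : ℝ} :
    x ∈ rect c a b ↔ |x.1 - c.1| ≤ a ∧ |x.2 - c.2| ≤ b := by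
  simp only [rect, Set.mem_prod, Set.mem_Icc, abs_le]
  constructor <;> rintro ⟨⟨_, _⟩, _, _⟩ <;> refine ⟨⟨?_, ?_⟩, ?_, ?_⟩ <;> linarith

lemma measurableSet_rect (c : ℝ × ℝ) (a b : ℝ) : MeasurableSet (rect c a b) :=
  measurableSet_Icc.prod measurableSet_Icc

lemma decay_le_mul_decay {R L : ℝ} (hR : 0 < R) (hL : R ≤ L) {y z : ℝ} (hz : |z| ≤ 6 * L) :
    decay 102 R (y - z) ≤ 7 ^ 100 * (decay 100 L y * decay 2 R (y - z)) := by
  have hL0 : 0 < L := hR.trans_le hL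
  have e : decay 102 R (y - z) = decay 100 R (y - z) * decay 2 R (y - z) := by
    unfold decay; rw [← mul_inv, ← pow_add]
  have h1 : decay 100 R (y - z) ≤ 7 ^ 100 * decay 100 L y := by
    refine inv_pow_le_mul_inv_pow (by norm_num) (by positivity) ?_ 100
    rw [div_le_iff₀ (by norm_num)]
    have e1 : |y| / L ≤ (|y - z| + 6 * L) / L := by
      gcongr
      have := abs_add_le (y - z) z
      rw [sub_add_cancel] at this
      linarith
    have e2 : (|y - z| + 6 * L) / L = |y - z| / L + 6 := by field_simp
    have e3 : |y - z| / L ≤ |y - z| / R := by gcongr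
    have e4 : 0 ≤ |y - z| / R := by positivity
    linarith
  rw [e, ← mul_assoc]
  exact mul_le_mul_of_nonneg_right h1 (decay_nonneg 2 hR _)

lemma lintegral_tileWeight_le {R L : ℝ} (hR : 0 < R) (hL : R ≤ L) (c x : ℝ × ℝ) :
    ∫⁻ z in rect c (6 * L) (3 * R), tileWeight R z x ≤
      ENNReal.ofReal R ^ 2 * ((7 ^ 100 * decayMass : ℝ≥0) * stripWeight L R c x) := by
  have h1m := (measurable_decay 102 R).ennreal_ofReal
  have h2m : Measurable ((Set.Icc (-(R / 2)) (R / 2)).indicator (1 : ℝ → ℝ≥0∞)) :=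
    measurable_one.indicator measurableSet_Icc
  have hfst : ∫⁻ y in Set.Icc (c.1 - 6 * L) (c.1 + 6 * L),
      ENNReal.ofReal (decay 102 R (x.1 - y)) ≤
        7 ^ 100 * ENNReal.ofReal (decay 100 L (x.1 - c.1)) * (ENNReal.ofReal R * decayMass) := by
    calc _ ≤ ∫⁻ y in Set.Icc (c.1 - 6 * L) (c.1 + 6 * L),
          7 ^ 100 * ENNReal.ofReal (decay 100 L (x.1 - c.1)) *
            ENNReal.ofReal (decay 2 R (x.1 - y)) := by
          refine setLIntegral_mono' measurableSet_Icc fun y hy => ?_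
          have hz : |y - c.1| ≤ 6 * L := by rw [abs_le]; constructor <;> linarith [hy.1, hy.2]
          have := decay_le_mul_decay hR hL (y := x.1 - c.1) hz
          rw [show x.1 - c.1 - (y - c.1) = x.1 - y by ring] at this
          refine (ENNReal.ofReal_le_ofReal this).trans (le_of_eq ?_)
          rw [ENNReal.ofReal_mul (by positivity),
            ENNReal.ofReal_mul (decay_nonneg _ (hR.trans_le hL) _), ENNReal.ofReal_pow (by norm_num),
            mul_assoc]
          norm_num
      _ ≤ ∫⁻ y, 7 ^ 100 * ENNReal.ofReal (decay 100 L (x.1 - c.1)) *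
            ENNReal.ofReal (decay 2 R (x.1 - y)) := setLIntegral_le_lintegral _ _
      _ = 7 ^ 100 * ENNReal.ofReal (decay 100 L (x.1 - c.1)) *
            ∫⁻ y, ENNReal.ofReal (decay 2 R y) := by
          rw [lintegral_const_mul' _ _ (by finiteness),
            lintegral_sub_left_eq_self (fun y => ENNReal.ofReal (decay 2 R y))]
      _ ≤ _ := by gcongr; exact lintegral_decay_le le_rfl hR
  have hsnd : ∫⁻ y in Set.Icc (c.2 - 3 * R) (c.2 + 3 * R),
      (Set.Icc (-(R / 2)) (R / 2)).indicator (1 : ℝ → ℝ≥0∞) (x.2 - y) ≤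
        ENNReal.ofReal R * (Set.Icc (-(4 * R)) (4 * R)).indicator (1 : ℝ → ℝ≥0∞) (x.2 - c.2) := by
    by_cases hx : x.2 - c.2 ∈ Set.Icc (-(4 * R)) (4 * R)
    · rw [Set.indicator_of_mem hx]
      calc _ ≤ ∫⁻ y, (Set.Icc (-(R / 2)) (R / 2)).indicator (1 : ℝ → ℝ≥0∞) (x.2 - y) :=
            setLIntegral_le_lintegral _ _
        _ = ∫⁻ y, (Set.Icc (-(R / 2)) (R / 2)).indicator (1 : ℝ → ℝ≥0∞) y :=
            lintegral_sub_left_eq_self _ _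
        _ = ENNReal.ofReal R := by
            rw [lintegral_indicator_one measurableSet_Icc, Real.volume_Icc]; congr 1; ring
        _ ≤ _ := by simp
    · refine le_of_eq_of_le ?_ (zero_le)
      rw [setLIntegral_eq_zero measurableSet_Icc]
      intro y hy
      refine Set.indicator_of_notMem (fun h => hx ?_) _
      constructor <;> linarith [hy.1, hy.2, h.1, h.2]
  calc ∫⁻ z in rect c (6 * L) (3 * R), tileWeight R z x
      = (∫⁻ y in Set.Icc (c.1 - 6 * L) (c.1 + 6 * L), ENNReal.ofReal (decay 102 R (x.1 - y))) *
        ∫⁻ y in Set.Icc (c.2 - 3 * R) (c.2 + 3 * R),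
          (Set.Icc (-(R / 2)) (R / 2)).indicator (1 : ℝ → ℝ≥0∞) (x.2 - y) := by
        rw [rect, Measure.volume_eq_prod, ← Measure.prod_restrict]
        exact lintegral_prod_mul (h1m.comp (by fun_prop)).aemeasurable
          (h2m.comp (by fun_prop)).aemeasurable
    _ ≤ _ := mul_le_mul' hfst hsnd
    _ = _ := by unfold stripWeight; push_cast; ring

/-- Averaging a function over the squares of side `R` with centers in a slightly larger
rectangle. -/
lemma lintegral_rect_le {R L : ℝ} (hR : 0 < R) (hL : R ≤ L) (c : ℝ × ℝ) {Φ : ℝ × ℝ → ℝ≥0∞}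
    (hΦ : Measurable Φ) :
    ENNReal.ofReal R ^ 2 * ∫⁻ x in rect c (4 * L) (2 * R), Φ x ≤
      ∫⁻ z in rect c (6 * L) (3 * R), ∫⁻ x in sqr z R, Φ x := by
  have hm : Measurable fun w : (ℝ × ℝ) × (ℝ × ℝ) =>
      {w : (ℝ × ℝ) × (ℝ × ℝ) | w.2 ∈ sqr w.1 R}.indicator (fun w => Φ w.2) w :=
    (hΦ.comp measurable_snd).indicator (measurableSet_mem_sqr R)
  calc _ = ∫⁻ x in rect c (4 * L) (2 * R), ∫⁻ z in rect c (6 * L) (3 * R),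
        {w : (ℝ × ℝ) × (ℝ × ℝ) | w.2 ∈ sqr w.1 R}.indicator (fun w => Φ w.2) (z, x) := by
        rw [← lintegral_const_mul' _ _ (by finiteness)]
        refine setLIntegral_congr_fun (measurableSet_rect _ _ _) fun x hx => ?_
        have hsub : sqr x R ⊆ rect c (6 * L) (3 * R) := fun z hz => by
          obtain ⟨h1, h2⟩ := mem_sqr_iff.1 hz
          obtain ⟨h3, h4⟩ := mem_rect_iff.1 hx
          have e1 := abs_sub_le z.1 x.1 c.1
          have e2 := abs_sub_le z.2 x.2 c.2
          exact mem_rect_iff.2 ⟨by linarith, by linarith⟩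
        have : ∀ z, {w : (ℝ × ℝ) × (ℝ × ℝ) | w.2 ∈ sqr w.1 R}.indicator (fun w => Φ w.2) (z, x) =
            (sqr x R).indicator (fun _ => Φ x) z := fun z => by
          by_cases hz : z ∈ sqr x R
          · rw [Set.indicator_of_mem hz, Set.indicator_of_mem]
            exact mem_sqr_comm.2 hz
          · rw [Set.indicator_of_notMem hz, Set.indicator_of_notMem]
            exact mt mem_sqr_comm.1 hz
        simp_rw [this]
        rw [setLIntegral_indicator (measurableSet_sqr _ _), Set.inter_eq_self_of_subset_left hsub,
          setLIntegral_const, volume_sqr, mul_comm]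
    _ = ∫⁻ z in rect c (6 * L) (3 * R), ∫⁻ x in rect c (4 * L) (2 * R),
        {w : (ℝ × ℝ) × (ℝ × ℝ) | w.2 ∈ sqr w.1 R}.indicator (fun w => Φ w.2) (z, x) :=
        lintegral_lintegral_swap (hm.comp measurable_swap).aemeasurable
    _ ≤ ∫⁻ z in rect c (6 * L) (3 * R), ∫⁻ x in sqr z R, Φ x := by
        refine lintegral_mono fun z => (setLIntegral_le_lintegral _ _).trans (le_of_eq ?_)
        rw [← lintegral_indicator (measurableSet_sqr _ _)]
        rfl

lemma exists_rect_decoupling : ∃ C : ℝ≥0, ∀ p : ℝ, 4 < p → p < 6 → ∀ m : ℕ, 0 < m →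
    ∀ D : ℝ, 0 ≤ D → DecIneq p m D → ∀ f : ℕ → ℝ → ℂ, MiddleSupported m f → ∀ c : ℝ × ℝ,
    ∀ L : ℝ, (m : ℝ) ^ 2 ≤ L →
    ∫⁻ x in rect c (4 * L) (2 * (m : ℝ) ^ 2), ‖∑ q ∈ Finset.range m, extE (f q) x‖ₑ ^ p ≤
      C * (ENNReal.ofReal D ^ p * (∑ q ∈ Finset.range m,
        (∫⁻ x, ‖extE (f q) x‖ₑ ^ p * stripWeight L ((m : ℝ) ^ 2) c x) ^ (2 / p)) ^ (p / 2)) := by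
  obtain ⟨C, hC⟩ := exists_tile_decoupling
  refine ⟨C * (7 ^ 100 * decayMass), fun p hp4 hp6 m hm D hD hdec f hf c L hL => ?_⟩
  have hp0 : 0 < p := by linarith
  have hm' : (0 : ℝ) < m := by exact_mod_cast hm
  set R := (m : ℝ) ^ 2 with hRd
  have hR : 0 < R := by positivity
  have hR0 : ENNReal.ofReal R ^ 2 ≠ 0 := by simpa using hR
  have hE : ∀ q ∈ Finset.range m, Measurable (extE (f q)) := fun q hq =>
    (continuous_extE (hf q (Finset.mem_range.1 hq)).1).measurable
  have hU : ∀ q ∈ Finset.range m, Measurable fun w : (ℝ × ℝ) × (ℝ × ℝ) =>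
      ‖extE (f q) w.2‖ₑ ^ p * tileWeight R w.1 w.2 := fun q hq =>
    (((hE q hq).comp measurable_snd).enorm.pow_const _).mul (measurable_tileWeight R)
  have h2 : (2 / p) = 1 / (p / 2) := by field_simp
  set Z := rect c (6 * L) (3 * R)
  have key : ENNReal.ofReal R ^ 2 *
      ∫⁻ x in rect c (4 * L) (2 * R), ‖∑ q ∈ Finset.range m, extE (f q) x‖ₑ ^ p ≤
      ENNReal.ofReal R ^ 2 * ((C * (7 ^ 100 * decayMass) : ℝ≥0) *
        (ENNReal.ofReal D ^ p * (∑ q ∈ Finset.range m,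
        (∫⁻ x, ‖extE (f q) x‖ₑ ^ p * stripWeight L R c x) ^ (2 / p)) ^ (p / 2))) := by
    calc _ ≤ ∫⁻ z in Z, ∫⁻ x in sqr z R, ‖∑ q ∈ Finset.range m, extE (f q) x‖ₑ ^ p :=
          lintegral_rect_le hR hL c ((Finset.measurable_fun_sum _ hE).enorm.pow_const _)
      _ ≤ ∫⁻ z in Z, C * (ENNReal.ofReal D ^ p * (∑ q ∈ Finset.range m,
          (∫⁻ x, ‖extE (f q) x‖ₑ ^ p * tileWeight R z x) ^ (2 / p)) ^ (p / 2)) :=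
          lintegral_mono fun z => hC p hp4 hp6 m hm D hD hdec f hf z
      _ = C * (ENNReal.ofReal D ^ p * ∫⁻ z in Z, (∑ q ∈ Finset.range m,
          (∫⁻ x, ‖extE (f q) x‖ₑ ^ p * tileWeight R z x) ^ (2 / p)) ^ (p / 2)) := by
          rw [lintegral_const_mul' _ _ (by finiteness), lintegral_const_mul' _ _ (by finiteness)]
      _ ≤ C * (ENNReal.ofReal D ^ p * (∑ q ∈ Finset.range m,
          (∫⁻ z in Z, ∫⁻ x, ‖extE (f q) x‖ₑ ^ p * tileWeight R z x) ^ (2 / p)) ^ (p / 2)) := by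
          gcongr
          rw [h2]
          exact lintegral_sum_rpow_le _ (fun q hq =>
            ((hU q hq).lintegral_prod_right').aemeasurable) (by linarith)
      _ ≤ C * (ENNReal.ofReal D ^ p * (∑ q ∈ Finset.range m,
          ((ENNReal.ofReal R ^ 2 * (7 ^ 100 * decayMass : ℝ≥0)) *
            ∫⁻ x, ‖extE (f q) x‖ₑ ^ p * stripWeight L R c x) ^ (2 / p)) ^ (p / 2)) := by
          gcongr with q hq
          have hc : ENNReal.ofReal R ^ 2 * ((7 ^ 100 * decayMass : ℝ≥0) : ℝ≥0∞) ≠ ⊤ :=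
            ENNReal.mul_ne_top (by finiteness) ENNReal.coe_ne_top
          rw [lintegral_lintegral_swap (hU q hq).aemeasurable, ← lintegral_const_mul' _ _ hc]
          refine lintegral_mono fun x => ?_
          rw [lintegral_const_mul _ (measurable_tileWeight_left R x)]
          calc _ ≤ ‖extE (f q) x‖ₑ ^ p * (ENNReal.ofReal R ^ 2 *
                ((7 ^ 100 * decayMass : ℝ≥0) * stripWeight L R c x)) := by
                gcongr; exact lintegral_tileWeight_le hR hL c x
            _ = _ := by ring
      _ = _ := by rw [ENNReal.sum_mul_rpow_rpow _ _ _ hp0]; push_cast; ring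
  exact (ENNReal.mul_le_mul_iff_right hR0 (by finiteness)).1 key

/-- The linear map of the plane that matches the reparametrization `ξ = α + σ η` of the parabola. -/
def parabolicMap (α σ : ℝ) : ℝ × ℝ →ₗ[ℝ] ℝ × ℝ where
  toFun x := (σ * (x.1 + 2 * α * x.2), σ ^ 2 * x.2)
  map_add' x y := by ext <;> simp <;> ring
  map_smul' r x := by ext <;> simp <;> ring

lemma parabolicMap_apply (α σ : ℝ) (x : ℝ × ℝ) :
    parabolicMap α σ x = (σ * (x.1 + 2 * α * x.2), σ ^ 2 * x.2) := rfl

lemma exists_lintegral_comp_parabolicMap (α : ℝ) {σ : ℝ} (hσ : 0 < σ) :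
    ∃ κ : ℝ≥0∞, κ ≠ 0 ∧ κ ≠ ⊤ ∧ ∀ Ψ : ℝ × ℝ → ℝ≥0∞, Measurable Ψ →
      ∫⁻ x, Ψ (parabolicMap α σ x) = κ * ∫⁻ x, Ψ x := by
  have hdet : LinearMap.det (parabolicMap α σ) ≠ 0 := by
    intro h
    have hb := LinearMap.bot_lt_ker_of_det_eq_zero h
    refine hb.ne' (LinearMap.ker_eq_bot'.2 fun x hx => ?_)
    rw [parabolicMap_apply, Prod.mk_eq_zero] at hx
    obtain ⟨h1, h2⟩ := hx
    have e2 : x.2 = 0 := by simpa [hσ.ne'] using h2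
    have e1 : x.1 = 0 := by simpa [hσ.ne', e2] using h1
    ext <;> simp [e1, e2]
  have hm := Measure.map_linearMap_addHaar_eq_smul_addHaar (volume : Measure (ℝ × ℝ)) hdet
  refine ⟨ENNReal.ofReal |(LinearMap.det (parabolicMap α σ))⁻¹|, ?_, ENNReal.ofReal_ne_top,
    fun Ψ hΨ => ?_⟩
  · simpa using hdet
  · have hT : Measurable (parabolicMap α σ) :=
      (LinearMap.continuous_of_finiteDimensional _).measurable
    rw [← lintegral_map hΨ hT, hm, lintegral_smul_measure, smul_eq_mul]

lemma enorm_extE_comp_affine (h : ℝ → ℂ) (α : ℝ) {σ : ℝ} (hσ : 0 < σ) (x : ℝ × ℝ) :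
    ‖extE (fun η => σ * h (α + σ * η)) (parabolicMap α σ x)‖ₑ = ‖extE h x‖ₑ := by
  have e : extE (fun η => σ * h (α + σ * η)) (parabolicMap α σ x) =
      ex (-(α * x.1 + α ^ 2 * x.2)) * extE h x := by
    unfold extE
    have h1 := Measure.integral_comp_mul_left
      (fun t => h (α + t) * ex ((α + t) * x.1 + (α + t) ^ 2 * x.2)) σ
    have h2 := integral_add_left_eq_self (μ := volume)
      (fun t => h t * ex (t * x.1 + t ^ 2 * x.2)) α
    rw [h2, abs_of_pos (inv_pos.2 hσ)] at h1
    have h3 : ∫ ξ, h ξ * ex (ξ * x.1 + ξ ^ 2 * x.2) =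
        σ * ∫ t, h (α + σ * t) * ex ((α + σ * t) * x.1 + (α + σ * t) ^ 2 * x.2) := by
      rw [h1, Complex.real_smul, ← mul_assoc, Complex.ofReal_inv, mul_inv_cancel₀, one_mul]
      exact_mod_cast hσ.ne'
    rw [h3, ← integral_const_mul, ← integral_const_mul]
    congr 1; ext η
    rw [parabolicMap_apply]
    have : ex (η * (σ * (x.1 + 2 * α * x.2)) + η ^ 2 * (σ ^ 2 * x.2)) =
        ex (-(α * x.1 + α ^ 2 * x.2)) *
          ex ((α + σ * η) * x.1 + (α + σ * η) ^ 2 * x.2) := by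
      rw [← ex_add]; congr 1; ring
    rw [this]; ring
  rw [e, enorm_mul]
  have : ‖ex (-(α * x.1 + α ^ 2 * x.2))‖ₑ = 1 := by
    rw [← ofReal_norm, norm_ex, ENNReal.ofReal_one]
  rw [this, one_mul]

lemma stripWeight_parabolicMap_le {α k R : ℝ} (hα : |α| ≤ 1) (hk : 0 < k) (hR : 0 < R)
    (c x : ℝ × ℝ) :
    stripWeight (k * R) R (parabolicMap α (2 / k) c) (parabolicMap α (2 / k) x) ≤
      4 ^ 100 * ENNReal.ofReal (wB c (k ^ 2 * R) x) := by
  unfold stripWeight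
  simp only [parabolicMap_apply]
  set u := 2 / k * (x.1 + 2 * α * x.2) - 2 / k * (c.1 + 2 * α * c.2) with hu
  by_cases hx : (2 / k) ^ 2 * x.2 - (2 / k) ^ 2 * c.2 ∈ Set.Icc (-(4 * R)) (4 * R)
  · rw [Set.indicator_of_mem hx, Pi.one_apply, mul_one, ← ENNReal.ofReal_ofNat 4,
      ← ENNReal.ofReal_pow (by norm_num), ← ENNReal.ofReal_mul (by positivity)]
    refine ENNReal.ofReal_le_ofReal ?_
    rw [wB_eq]
    refine inv_pow_le_mul_inv_pow (by norm_num) (by positivity) ?_ 100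
    have hd2 : |x.2 - c.2| ≤ k ^ 2 * R := by
      rw [← mul_sub, Set.mem_Icc, ← abs_le, abs_mul, abs_of_pos (by positivity), div_pow, div_mul_eq_mul_div,
        div_le_iff₀ (by positivity)] at hx
      linarith
    have hd1 : |x.1 - c.1| ≤ k / 2 * |u| + 2 * (k ^ 2 * R) := by
      have e : x.1 - c.1 = k / 2 * u - 2 * α * (x.2 - c.2) := by rw [hu]; field_simp; ring
      rw [e]
      refine (abs_sub _ _).trans ?_
      rw [abs_mul, abs_of_pos (by positivity : 0 < k / 2), abs_mul, abs_mul, abs_two]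
      have : |α| * |x.2 - c.2| ≤ 1 * (k ^ 2 * R) := by gcongr
      linarith
    have hs : √((x.1 - c.1) ^ 2 + (x.2 - c.2) ^ 2) ≤ |x.1 - c.1| + |x.2 - c.2| := by
      rw [Real.sqrt_le_left (by positivity), ← sq_abs (x.1 - c.1), ← sq_abs (x.2 - c.2)]
      nlinarith [mul_nonneg (abs_nonneg (x.1 - c.1)) (abs_nonneg (x.2 - c.2))]
    have hq : √((x.1 - c.1) ^ 2 + (x.2 - c.2) ^ 2) / (k ^ 2 * R) ≤ |u| / (2 * (k * R)) + 3 := by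
      rw [div_le_iff₀ (by positivity)]
      have : (|u| / (2 * (k * R)) + 3) * (k ^ 2 * R) = k / 2 * |u| + 3 * (k ^ 2 * R) := by
        field_simp
      linarith
    have : |u| / (2 * (k * R)) = |u| / (k * R) / 2 := by rw [mul_comm, div_div]
    have h0 : 0 ≤ |u| / (k * R) := by positivity
    rw [div_le_iff₀ (by norm_num)]
    linarith
  · rw [Set.indicator_of_notMem hx, mul_zero]; exact zero_le

lemma parabolicMap_mem_rect {α k R : ℝ} (hα : |α| ≤ 1) (hk : 0 < k) (hR : 0 < R)
    {c x : ℝ × ℝ} (hx : x ∈ sqr c (k ^ 2 * R)) :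
    parabolicMap α (2 / k) x ∈ rect (parabolicMap α (2 / k) c) (4 * (k * R)) (2 * R) := by
  obtain ⟨h1, h2⟩ := mem_sqr_iff.1 hx
  rw [mem_rect_iff]
  simp only [parabolicMap_apply]
  constructor
  · have e : 2 / k * (x.1 + 2 * α * x.2) - 2 / k * (c.1 + 2 * α * c.2) =
        2 / k * ((x.1 - c.1) + 2 * α * (x.2 - c.2)) := by ring
    rw [e, abs_mul, abs_of_pos (by positivity : 0 < 2 / k), div_mul_eq_mul_div,
      div_le_iff₀ hk]
    have h3 := abs_add_le (x.1 - c.1) (2 * α * (x.2 - c.2))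
    rw [abs_mul, abs_mul, abs_two] at h3
    have : |α| * |x.2 - c.2| ≤ 1 * (k ^ 2 * R / 2) := by gcongr
    have h0 : 0 < k ^ 2 * R := by positivity
    nlinarith
  · rw [← mul_sub, abs_mul, abs_of_pos (by positivity), div_pow, div_mul_eq_mul_div,
        div_le_iff₀ (by positivity)]
    linarith

lemma exists_affine_decoupling : ∃ C : ℝ≥0, ∀ p : ℝ, 4 < p → p < 6 → ∀ m : ℕ, 0 < m →
    ∀ D : ℝ, 0 ≤ D → DecIneq p m D → ∀ k α : ℝ, 1 ≤ k → |α| ≤ 1 → ∀ h : ℕ → ℝ → ℂ,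
    (∀ q < m, Integrable (h q) ∧ ∀ ξ, h q ξ ≠ 0 → α + 2 / k * (q / m + 1 / (4 * m)) ≤ ξ ∧
      ξ ≤ α + 2 / k * (q / m + 3 / (4 * m))) → ∀ c : ℝ × ℝ,
    ∫⁻ x in sqr c (k ^ 2 * (m : ℝ) ^ 2), ‖∑ q ∈ Finset.range m, extE (h q) x‖ₑ ^ p ≤
      C * (ENNReal.ofReal D ^ p * (∑ q ∈ Finset.range m,
        wInt p c (k ^ 2 * (m : ℝ) ^ 2) (extE (h q)) ^ (2 / p)) ^ (p / 2)) := by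
  obtain ⟨C, hC⟩ := exists_rect_decoupling
  refine ⟨C * 4 ^ 100, fun p hp4 hp6 m hm D hD hdec k α hk hα h hh c => ?_⟩
  have hp0 : 0 < p := by linarith
  have hk0 : 0 < k := by linarith
  have hm' : (0 : ℝ) < m := by exact_mod_cast hm
  have hσ : 0 < 2 / k := by positivity
  set R := (m : ℝ) ^ 2 with hRd
  have hR : 0 < R := by positivity
  set T := parabolicMap α (2 / k) with hT
  obtain ⟨κ, hκ0, hκ, hκT⟩ := exists_lintegral_comp_parabolicMap α hσ
  set f : ℕ → ℝ → ℂ := fun q η => (2 / k : ℝ) * h q (α + 2 / k * η) with hf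
  have hfm : MiddleSupported m f := fun q hq => by
    refine ⟨?_, fun η hη => ?_⟩
    · have := ((hh q hq).1.comp_add_left α).comp_mul_left' hσ.ne'
      exact this.const_mul _
    · have := (hh q hq).2 _ (right_ne_zero_of_mul hη)
      rw [add_le_add_iff_left, add_le_add_iff_left, mul_le_mul_iff_right₀ hσ,
        mul_le_mul_iff_right₀ hσ] at this
      exact this
  have hfE : ∀ q < m, Measurable (extE (f q)) := fun q hq =>
    (continuous_extE (hfm q hq).1).measurable
  have hsum : ∀ x, ‖∑ q ∈ Finset.range m, extE (f q) (T x)‖ₑ =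
      ‖∑ q ∈ Finset.range m, extE (h q) x‖ₑ := fun x => by
    rw [← extE_sum _ (fun q hq => (hfm q (Finset.mem_range.1 hq)).1),
      ← extE_sum _ (fun q hq => (hh q (Finset.mem_range.1 hq)).1),
      ← enorm_extE_comp_affine _ α hσ x]
    simp only [hf, Finset.mul_sum]
    rfl
  set Z := rect (T c) (4 * (k * R)) (2 * R)
  have hmZ : MeasurableSet Z := measurableSet_rect _ _ _
  have hΨ : Measurable fun y => ‖∑ q ∈ Finset.range m, extE (f q) y‖ₑ ^ p :=
    (Finset.measurable_fun_sum _ fun q hq => hfE q (Finset.mem_range.1 hq)).enorm.pow_const _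
  calc ∫⁻ x in sqr c (k ^ 2 * R), ‖∑ q ∈ Finset.range m, extE (h q) x‖ₑ ^ p
      ≤ ∫⁻ x, Z.indicator (fun y => ‖∑ q ∈ Finset.range m, extE (f q) y‖ₑ ^ p) (T x) := by
        rw [← lintegral_indicator (measurableSet_sqr _ _)]
        refine lintegral_mono fun x => ?_
        by_cases hx : x ∈ sqr c (k ^ 2 * R)
        · rw [Set.indicator_of_mem hx, Set.indicator_of_mem (parabolicMap_mem_rect hα hk0 hR hx),
            hsum]
        · rw [Set.indicator_of_notMem hx]; exact zero_le
    _ = κ * ∫⁻ y in Z, ‖∑ q ∈ Finset.range m, extE (f q) y‖ₑ ^ p := by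
        rw [hκT _ (hΨ.indicator hmZ), lintegral_indicator hmZ]
    _ ≤ κ * (C * (ENNReal.ofReal D ^ p * (∑ q ∈ Finset.range m,
        (∫⁻ y, ‖extE (f q) y‖ₑ ^ p * stripWeight (k * R) R (T c) y) ^ (2 / p)) ^ (p / 2))) := by
        gcongr
        exact hC p hp4 hp6 m hm D hD hdec f hfm (T c) (k * R) (by nlinarith)
    _ = C * (ENNReal.ofReal D ^ p * (∑ q ∈ Finset.range m,
        (κ * ∫⁻ y, ‖extE (f q) y‖ₑ ^ p * stripWeight (k * R) R (T c) y) ^ (2 / p)) ^ (p / 2)) := by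
        rw [ENNReal.sum_mul_rpow_rpow _ _ _ hp0]; ring
    _ ≤ C * (ENNReal.ofReal D ^ p * (∑ q ∈ Finset.range m,
        (4 ^ 100 * wInt p c (k ^ 2 * R) (extE (h q))) ^ (2 / p)) ^ (p / 2)) := by
        gcongr (C : ℝ≥0∞) * (_ * (∑ q ∈ _, (?_) ^ (2 / p)) ^ (p / 2)) with q hq
        have hq' := Finset.mem_range.1 hq
        have hm2 : Measurable fun y =>
            ‖extE (f q) y‖ₑ ^ p * stripWeight (k * R) R (T c) y :=
          ((hfE q hq').enorm.pow_const _).mul (measurable_stripWeight _ _ _)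
        rw [← hκT _ hm2, wInt,
          ← lintegral_const_mul' _ _ (by finiteness)]
        refine lintegral_mono fun x => ?_
        rw [hf, hT, enorm_extE_comp_affine (h q) α hσ x]
        calc _ ≤ ‖extE (h q) x‖ₑ ^ p * (4 ^ 100 * ENNReal.ofReal (wB c (k ^ 2 * R) x)) := by
              gcongr; exact stripWeight_parabolicMap_le hα hk0 hR c x
          _ = _ := by ring
    _ = _ := by rw [ENNReal.sum_mul_rpow_rpow _ _ _ hp0]; push_cast; ring

lemma Finset.sum_range_eq_even_add_odd {M : Type*} [AddCommMonoid M] (f : ℕ → M) (N : ℕ) :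
    ∑ j ∈ Finset.range N, f j = ∑ q ∈ Finset.range N, (if 2 * q < N then f (2 * q) else 0) +
      ∑ q ∈ Finset.range N, (if 2 * q + 1 < N then f (2 * q + 1) else 0) := by
  have h1 : ∀ (g : ℕ → M) (K : ℕ), ∑ j ∈ Finset.range (2 * K), g j =
      ∑ q ∈ Finset.range K, g (2 * q) + ∑ q ∈ Finset.range K, g (2 * q + 1) := fun g K => by
    induction K with
    | zero => simp
    | succ K ih =>
      rw [show 2 * (K + 1) = 2 * K + 1 + 1 by ring, Finset.sum_range_succ, Finset.sum_range_succ,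
        ih, Finset.sum_range_succ, Finset.sum_range_succ]
      abel
  rw [← h1 (fun j => if j < N then f j else 0), ← Finset.sum_filter]
  congr 1; ext j; simp; omega

lemma extOp_eq_sum {s : ℕ → ℝ} (hs : Monotone s) (m : ℕ) {g : ℝ → ℂ}
    (hg : IntegrableOn g (Set.Icc (s 0) (s m))) (x : ℝ × ℝ) :
    extOp (s 0) (s m) g x = ∑ j ∈ Finset.range m, extOp (s j) (s (j + 1)) g x := by
  have h : ∀ a b, a ≤ b → extOp a b g x = ∫ ξ in a..b, g ξ * ex (ξ * x.1 + ξ ^ 2 * x.2) :=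
    fun a b hab => by
      rw [intervalIntegral.integral_of_le hab, ← integral_Icc_eq_integral_Ioc]; rfl
  rw [h _ _ (hs (Nat.zero_le m)), ← intervalIntegral.sum_integral_adjacent_intervals]
  · exact Finset.sum_congr rfl fun j _ => (h _ _ (hs (Nat.le_succ j))).symm
  · intro j hj
    rw [intervalIntegrable_iff_integrableOn_Icc_of_le (hs (Nat.le_succ j))]
    have : IntegrableOn (fun ξ => g ξ * ex (ξ * x.1 + ξ ^ 2 * x.2)) (Set.Icc (s 0) (s m)) :=
      hg.mul_ex (by fun_prop)
    exact this.mono_set (Set.Icc_subset_Icc (hs (Nat.zero_le j)) (hs hj))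

lemma enorm_add_rpow_le {p : ℝ} (hp4 : 4 < p) (hp6 : p < 6) (a b : ℂ) :
    ‖a + b‖ₑ ^ p ≤ 32 * (‖a‖ₑ ^ p + ‖b‖ₑ ^ p) := by
  refine (ENNReal.rpow_le_rpow (enorm_add_le _ _) (by linarith)).trans ?_
  refine (ENNReal.rpow_add_le_mul_rpow_add_rpow _ _ (by linarith)).trans ?_
  gcongr
  calc (2 : ℝ≥0∞) ^ (p - 1) ≤ 2 ^ (5 : ℝ) :=
        ENNReal.rpow_le_rpow_of_exponent_le (by norm_num) (by linarith)
    _ = 32 := by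
        rw [show (5 : ℝ) = ((5 : ℕ) : ℝ) by norm_num, ENNReal.rpow_natCast]; norm_num

lemma wInt_extE_zero {p : ℝ} (hp : 0 < p) (c : ℝ × ℝ) (R : ℝ) :
    wInt p c R (extE fun _ => 0) = 0 := by
  have : ∀ x, extE (fun _ => 0) x = 0 := fun x => by simp [extE]
  simp [wInt, this, hp]

/-- Decoupling of an interval of length `1 / k` into intervals of length `1 / (k * m)`. -/
lemma exists_subinterval_decoupling : ∃ C : ℝ≥0, ∀ p : ℝ, 4 < p → p < 6 → ∀ m : ℕ, 0 < m →
    ∀ D : ℝ, 0 ≤ D → DecIneq p m D → ∀ k n i : ℕ, n = k * m → i < k → ∀ g : ℝ → ℂ,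
    IntegrableOn g (Set.Icc 0 1) → ∀ c : ℝ × ℝ,
    ∫⁻ x in sqr c ((n : ℝ) ^ 2), ‖extOp ((i : ℝ) / k) (((i : ℝ) + 1) / k) g x‖ₑ ^ p ≤
      C * (ENNReal.ofReal D ^ p * (∑ j ∈ Finset.range m, wInt p c ((n : ℝ) ^ 2)
        (extOp ((i : ℝ) / k + (j : ℝ) / n) ((i : ℝ) / k + ((j : ℝ) + 1) / n) g) ^ (2 / p)) ^
          (p / 2)) := by
  obtain ⟨C, hC⟩ := exists_affine_decoupling
  refine ⟨64 * C, fun p hp4 hp6 m hm D hD hdec k n i hn hi g hg c => ?_⟩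
  have hp0 : 0 < p := by linarith
  have hm' : (0 : ℝ) < m := by exact_mod_cast hm
  have hk : 0 < k := by omega
  have hk' : (0 : ℝ) < k := by exact_mod_cast hk
  have hk1 : (1 : ℝ) ≤ k := by exact_mod_cast hk
  have hn' : (n : ℝ) = k * m := by rw [hn]; push_cast; ring
  have hn0 : (0 : ℝ) < n := by rw [hn']; positivity
  have hn1 : (1 : ℝ) ≤ n := by
    have : 0 < n := by rw [hn]; positivity
    exact_mod_cast this
  have hkn : (1 : ℝ) / n ≤ 1 / k := by
    rw [hn']; gcongr
    exact le_mul_of_one_le_right hk'.le (by exact_mod_cast hm)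
  have hik : (i : ℝ) / k + 1 / k ≤ 1 := by
    rw [← add_div, div_le_one hk']; exact_mod_cast hi
  have hi0 : 0 ≤ (i : ℝ) / k := by positivity
  set s : ℕ → ℝ := fun j => (i : ℝ) / k + (j : ℝ) / n with hs
  have hsmono : Monotone s := fun a b hab => by
    have : (a : ℝ) ≤ b := by exact_mod_cast hab
    simp only [hs]; gcongr
  have hs0 : s 0 = (i : ℝ) / k := by simp [hs]
  have hsm : s m = ((i : ℝ) + 1) / k := by simp only [hs, hn']; field_simp
  have hsub : ∀ j < m, Set.Icc (s j) (s (j + 1)) ⊆ Set.Icc 0 1 := fun j hj => by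
    have h1 := hsmono (Nat.zero_le j)
    have h2 := hsmono (show j + 1 ≤ m from hj)
    rw [hs0] at h1; rw [hsm, add_div] at h2
    exact Set.Icc_subset_Icc (by linarith) (by linarith)
  set h : ℕ → ℝ → ℂ := fun j => (Set.Icc (s j) (s (j + 1))).indicator g with hh
  have hhi : ∀ j < m, Integrable (h j) := fun j hj =>
    (hg.mono_set (hsub j hj)).integrable_indicator measurableSet_Icc
  have hext : ∀ j : ℕ,
      extOp ((i : ℝ) / k + (j : ℝ) / n) ((i : ℝ) / k + ((j : ℝ) + 1) / n) g = extE (h j) :=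
    fun j => by rw [extOp_eq_extE]; simp only [hh, hs]; push_cast; rfl
  set B : ℕ → ℝ≥0∞ := fun j => wInt p c ((n : ℝ) ^ 2) (extE (h j)) ^ (2 / p) with hB
  set S := ∑ j ∈ Finset.range m, B j with hS
  have hpar : ∀ r ≤ 1,
      ∫⁻ x in sqr c ((n : ℝ) ^ 2),
        ‖∑ q ∈ Finset.range m, (if 2 * q + r < m then extE (h (2 * q + r)) x else 0)‖ₑ ^ p ≤
      C * (ENNReal.ofReal D ^ p * S ^ (p / 2)) := fun r hr => by
    have hr0 : (0 : ℝ) ≤ r := by positivity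
    have hr1 : (r : ℝ) ≤ 1 := by exact_mod_cast hr
    set hrq : ℕ → ℝ → ℂ := fun q => if 2 * q + r < m then h (2 * q + r) else fun _ => 0 with hhr
    have e0 : ∀ q x, extE (hrq q) x = if 2 * q + r < m then extE (h (2 * q + r)) x else 0 :=
      fun q x => by
        by_cases hq : 2 * q + r < m
        · simp [hhr, hq]
        · simp [hhr, hq, extE]
    have := hC p hp4 hp6 m hm D hD hdec k ((i : ℝ) / k + (r / n - 1 / (2 * n))) hk1 ?_ hrq ?_ c
    · simp only [e0] at this
      rw [← mul_pow, ← hn'] at this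
      refine this.trans ?_
      gcongr
      calc ∑ q ∈ Finset.range m, wInt p c ((n : ℝ) ^ 2) (extE (hrq q)) ^ (2 / p)
          = ∑ q ∈ Finset.range m, (if 2 * q + r < m then B (2 * q + r) else 0) := by
            refine Finset.sum_congr rfl fun q _ => ?_
            by_cases hq : 2 * q + r < m
            · simp [hhr, hq, hB]
            · simp only [hhr, hq, if_false, wInt_extE_zero hp0]
              exact ENNReal.zero_rpow_of_pos (by positivity)
        _ ≤ S := by
            rw [hS, Finset.sum_range_eq_even_add_odd B]
            interval_cases r
            · exact le_self_add
            · exact le_add_self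
    · have e1 : (r : ℝ) / n ≤ 1 / n := by gcongr
      have e2 : (1 : ℝ) / (2 * n) ≤ 1 := by rw [div_le_one (by positivity)]; linarith
      have e3 : 0 ≤ (r : ℝ) / n := by positivity
      have e4 : 0 ≤ (1 : ℝ) / (2 * n) := by positivity
      rw [abs_le]; constructor <;> linarith
    · intro q _
      by_cases hq : 2 * q + r < m
      · simp only [hhr, hq, if_true]
        refine ⟨hhi _ hq, fun ξ hξ => ?_⟩
        have := Set.mem_of_indicator_ne_zero hξ
        simp only [hs, Set.mem_Icc] at this
        push_cast at this
        have e1 : (i : ℝ) / k + (r / n - 1 / (2 * n)) + 2 / k * (q / m + 1 / (4 * m)) =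
            i / k + (2 * q + r) / n := by rw [hn']; field_simp; ring
        have e2 : (i : ℝ) / k + (r / n - 1 / (2 * n)) + 2 / k * (q / m + 3 / (4 * m)) =
            i / k + (2 * q + r + 1) / n := by rw [hn']; field_simp; ring
        rwa [e1, e2]
      · simp only [hhr, hq, if_false]
        exact ⟨integrable_zero _ _ _, fun ξ hξ => absurd rfl hξ⟩
  have hmeas : ∀ r, Measurable fun x =>
      ‖∑ q ∈ Finset.range m, (if 2 * q + r < m then extE (h (2 * q + r)) x else 0)‖ₑ ^ p := by
    intro r
    refine (Finset.measurable_fun_sum _ fun q _ => ?_).enorm.pow_const _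
    split_ifs with hq
    · exact (continuous_extE (hhi _ hq)).measurable
    · exact measurable_const
  simp only [hext]
  calc _ = ∫⁻ x in sqr c ((n : ℝ) ^ 2),
        ‖∑ q ∈ Finset.range m, (if 2 * q + 0 < m then extE (h (2 * q + 0)) x else 0) +
        ∑ q ∈ Finset.range m, (if 2 * q + 1 < m then extE (h (2 * q + 1)) x else 0)‖ₑ ^ p := by
        refine lintegral_congr fun x => ?_
        have := extOp_eq_sum hsmono m (g := g) (hg.mono_set ?_) x
        · rw [hs0, hsm] at this
          rw [this]
          have e : ∀ j, extOp (s j) (s (j + 1)) g x = extE (h j) x := fun j => by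
            rw [extOp_eq_extE]
          simp only [e]
          rw [Finset.sum_range_eq_even_add_odd]; rfl
        · rw [hs0, hsm, add_div]; exact Set.Icc_subset_Icc hi0 hik
    _ ≤ ∫⁻ x in sqr c ((n : ℝ) ^ 2),
        32 * (‖∑ q ∈ Finset.range m, (if 2 * q + 0 < m then extE (h (2 * q + 0)) x else 0)‖ₑ ^ p +
        ‖∑ q ∈ Finset.range m, (if 2 * q + 1 < m then extE (h (2 * q + 1)) x else 0)‖ₑ ^ p) :=
        lintegral_mono fun x => enorm_add_rpow_le hp4 hp6 _ _
    _ ≤ 32 * (C * (ENNReal.ofReal D ^ p * S ^ (p / 2)) +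
          C * (ENNReal.ofReal D ^ p * S ^ (p / 2))) := by
        rw [lintegral_const_mul' _ _ (by finiteness), lintegral_add_left (hmeas 0)]
        gcongr
        · exact hpar 0 zero_le_one
        · exact hpar 1 le_rfl
    _ = _ := by push_cast; ring

lemma continuous_integral_mul_ex {f : ℝ → ℂ} (hf : Integrable f) {θ : ℝ → ℝ} (hθ : Measurable θ) :
    Continuous fun y => ∫ ξ, f ξ * ex (θ ξ * y) := by
  apply continuous_of_dominated (bound := fun η => ‖f η‖)
  · exact fun y => (hf.mul_ex (hθ.mul_const y)).aestronglyMeasurable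
  · exact fun y => Filter.Eventually.of_forall fun η => by simp [norm_ex]
  · exact hf.norm
  · exact Filter.Eventually.of_forall fun η => continuous_const.mul (Continuous.ex_comp (by fun_prop))

/-- Bernstein's inequality in one variable: a function with frequencies in an interval of length
`4 / k` is controlled pointwise by its square average at scale `k`. -/
lemma exists_enorm_sq_integral_le : ∃ C : ℝ≥0, ∀ k b u : ℝ, 0 < k → ∀ f : ℝ → ℂ, Integrable f →
    ∀ θ : ℝ → ℝ, Measurable θ → (∀ ξ, f ξ ≠ 0 → |θ ξ - b| ≤ 2 / k) →
    ‖∫ ξ, f ξ * ex (θ ξ * u)‖ₑ ^ (2 : ℝ) ≤ C * (ENNReal.ofReal k⁻¹ *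
      ∫⁻ y, ENNReal.ofReal (decay 100 k (u - y)) * ‖∫ ξ, f ξ * ex (θ ξ * y)‖ₑ ^ (2 : ℝ)) := by
  obtain ⟨χ, hχ, hχc, hχ1, -⟩ := exists_bump 2 3 (by norm_num) (by norm_num)
  obtain ⟨C, hC, hK⟩ := kap_rescale_decay 100 hχ hχc
  refine ⟨C.toNNReal ^ 2 * decayMass, fun k b u hk f hf θ hθ hsupp => ?_⟩
  set G : ℝ → ℂ := fun y => ∫ ξ, f ξ * ex (θ ξ * y) with hG
  have hGc : Continuous G := continuous_integral_mul_ex hf hθ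
  set X : ℝ → ℂ := fun ξ => χ (k * (ξ - b)) with hX
  have hXs : ContDiff ℝ ∞ X := hχ.comp (by fun_prop)
  have hXc : HasCompactSupport X := rescale_hasCompactSupport hχc hk b
  have hrep : G u = ∫ y, kap X 0 (u - y) * G y := by
    rw [kap_convolve hXs hXc hf hθ (fun ξ hξ => hχ1 _ ?_)]
    · simp [hG]
    · have := hsupp ξ hξ
      rw [abs_mul, abs_of_pos hk]
      rwa [le_div_iff₀' hk] at this
  have hker : ∀ x, ‖kap X 0 x‖ₑ ≤ C.toNNReal * ENNReal.ofReal k⁻¹ *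
      ENNReal.ofReal (decay 100 k x) := fun x => by
    have h1 := hK k b 0 x hk
    have h2 : ‖kap X 0 x‖ ≤ C * k⁻¹ * decay 100 k x := by
      refine h1.trans (le_of_eq ?_)
      simp only [decay, abs_zero, zero_mul, add_zero, one_pow, mul_one, mul_zero, div_eq_mul_inv]
    rw [← ofReal_norm]
    refine (ENNReal.ofReal_le_ofReal h2).trans (le_of_eq ?_)
    rw [ENNReal.ofReal_mul (by positivity), ENNReal.ofReal_mul hC.le]
    rfl
  have hd : Measurable fun y => ENNReal.ofReal (decay 100 k (u - y)) :=
    ((measurable_decay 100 k).comp (measurable_const.sub measurable_id)).ennreal_ofReal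
  have hmass : ∫⁻ y, ENNReal.ofReal (decay 100 k (u - y)) ≤ ENNReal.ofReal k * decayMass := by
    rw [lintegral_sub_left_eq_self (fun y => ENNReal.ofReal (decay 100 k y))]
    exact lintegral_decay_le (by norm_num) hk
  have hkk : ENNReal.ofReal k⁻¹ * ENNReal.ofReal k = 1 := by
    rw [← ENNReal.ofReal_mul (by positivity), inv_mul_cancel₀ hk.ne', ENNReal.ofReal_one]
  set a := ENNReal.ofReal k⁻¹
  calc ‖G u‖ₑ ^ (2 : ℝ) ≤ (∫⁻ y, ‖kap X 0 (u - y) * G y‖ₑ) ^ (2 : ℝ) := by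
        rw [hrep]; gcongr; exact enorm_integral_le_lintegral_enorm _
    _ ≤ (∫⁻ y, C.toNNReal * a * (ENNReal.ofReal (decay 100 k (u - y)) * ‖G y‖ₑ)) ^ (2 : ℝ) := by
        gcongr with y
        rw [enorm_mul, ← mul_assoc]
        exact mul_le_mul_left (hker _) _
    _ = (C.toNNReal * a) ^ 2 *
        (∫⁻ y, ENNReal.ofReal (decay 100 k (u - y)) * ‖G y‖ₑ) ^ (2 : ℝ) := by
        rw [lintegral_const_mul' _ _ (by finiteness), ENNReal.mul_rpow_of_nonneg _ _ (by norm_num)]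
        norm_num
    _ ≤ (C.toNNReal * a) ^ 2 * ((ENNReal.ofReal k * decayMass) *
        ∫⁻ y, ENNReal.ofReal (decay 100 k (u - y)) * ‖G y‖ₑ ^ (2 : ℝ)) := by
        gcongr
        refine (lintegral_mul_rpow_le hd.aemeasurable hGc.enorm.aemeasurable
          (by norm_num)).trans ?_
        rw [show (2 : ℝ) - 1 = 1 by norm_num, ENNReal.rpow_one]
        gcongr
    _ = (a * ENNReal.ofReal k) * ((C.toNNReal ^ 2 * decayMass) * (a *
        ∫⁻ y, ENNReal.ofReal (decay 100 k (u - y)) * ‖G y‖ₑ ^ (2 : ℝ))) := by ring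
    _ = _ := by rw [hkk, one_mul]; push_cast; rfl

lemma decay_sub_le {k x y z : ℝ} (hk : 0 < k) (hx : |x - z| ≤ k / 2) :
    decay 100 k (x - y) ≤ 2 ^ 100 * decay 100 k (y - z) := by
  refine inv_pow_le_mul_inv_pow (by norm_num) (by positivity) ?_ 100
  rw [div_le_iff₀ (by norm_num)]
  have h : |y - z| ≤ |x - y| + |x - z| := by
    have := abs_sub_le y x z
    rwa [abs_sub_comm y x] at this
  have h1 : |y - z| / k ≤ |x - y| / k + 1 / 2 := by
    rw [div_le_iff₀ hk, add_mul, div_mul_cancel₀ _ hk.ne']; linarith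
  have : 0 ≤ |x - y| / k := by positivity
  linarith

/-- Local constancy: on a square of side `k`, the extension of an interval of length `1 / k` is
controlled by its weighted square average. -/
lemma exists_enorm_sq_extOp_le : ∃ C : ℝ≥0, ∀ k i : ℕ, i < k → ∀ g : ℝ → ℂ,
    IntegrableOn g (Set.Icc 0 1) → ∀ z x : ℝ × ℝ, x ∈ sqr z k →
    ‖extOp ((i : ℝ) / k) (((i : ℝ) + 1) / k) g x‖ₑ ^ (2 : ℝ) ≤
      C * (ENNReal.ofReal ((k : ℝ) ^ 2)⁻¹ *
        ∫⁻ y, ‖extOp ((i : ℝ) / k) (((i : ℝ) + 1) / k) g y‖ₑ ^ (2 : ℝ) *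
          ENNReal.ofReal (wtB z k y)) := by
  obtain ⟨C, hC⟩ := exists_enorm_sq_integral_le
  refine ⟨C ^ 2 * (2 ^ 100) ^ 2, fun k i hi g hg z x hx => ?_⟩
  have hk : (0 : ℝ) < k := by exact_mod_cast (by omega : 0 < k)
  set a : ℝ := (i : ℝ) / k with ha
  have ha0 : 0 ≤ a := by positivity
  have ha1 : a + 1 / k ≤ 1 := by
    rw [ha, ← add_div, div_le_one hk]; exact_mod_cast hi
  have hb : ((i : ℝ) + 1) / k = a + 1 / k := by rw [add_div]
  have hk1 : 0 < 1 / (k : ℝ) := by positivity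
  rw [hb, extOp_eq_extE]
  set f := (Set.Icc a (a + 1 / k)).indicator g with hf
  have hfi : Integrable f := (hg.mono_set (Set.Icc_subset_Icc ha0 ha1)).integrable_indicator
    measurableSet_Icc
  have hfs : ∀ ξ, f ξ ≠ 0 → a ≤ ξ ∧ ξ ≤ a + 1 / k := fun ξ hξ => by
    simpa using Set.mem_of_indicator_ne_zero (s := Set.Icc a (a + 1 / k)) hξ
  have h2k : (2 : ℝ) / k = 1 / k + 1 / k := by ring
  have hE : Continuous (extE f) := continuous_extE hfi
  obtain ⟨hx1, hx2⟩ := mem_sqr_iff.1 hx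
  have hfst : ∀ u v, ‖extE f (u, v)‖ₑ ^ (2 : ℝ) ≤ C * (ENNReal.ofReal (k : ℝ)⁻¹ *
      ∫⁻ y, ENNReal.ofReal (decay 100 k (u - y)) * ‖extE f (y, v)‖ₑ ^ (2 : ℝ)) := fun u v => by
    have := hC k a u hk (fun ξ => f ξ * ex (ξ ^ 2 * v)) (hfi.mul_ex (by fun_prop)) (fun ξ => ξ)
      measurable_id (fun ξ hξ => by
        obtain ⟨h1, h2⟩ := hfs ξ (left_ne_zero_of_mul hξ)
        rw [abs_le]; constructor <;> linarith)
    have e : ∀ y, ∫ ξ, f ξ * ex (ξ ^ 2 * v) * ex (ξ * y) = extE f (y, v) := fun y => by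
      unfold extE; congr 1; ext ξ; rw [mul_assoc, ← ex_add, add_comm]
    simpa only [e] using this
  have hsnd : ∀ u v, ‖extE f (u, v)‖ₑ ^ (2 : ℝ) ≤ C * (ENNReal.ofReal (k : ℝ)⁻¹ *
      ∫⁻ y, ENNReal.ofReal (decay 100 k (v - y)) * ‖extE f (u, y)‖ₑ ^ (2 : ℝ)) := fun u v => by
    have := hC k (a ^ 2) v hk (fun ξ => f ξ * ex (ξ * u)) (hfi.mul_ex (by fun_prop))
      (fun ξ => ξ ^ 2) (by fun_prop) (fun ξ hξ => by
        obtain ⟨h1, h2⟩ := hfs ξ (left_ne_zero_of_mul hξ)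
        have e : ξ ^ 2 - a ^ 2 = (ξ - a) * (ξ + a) := by ring
        rw [e, abs_of_nonneg (mul_nonneg (by linarith) (by linarith)), h2k]
        nlinarith)
    have e : ∀ y, ∫ ξ, f ξ * ex (ξ * u) * ex (ξ ^ 2 * y) = extE f (u, y) := fun y => by
      unfold extE; congr 1; ext ξ; rw [mul_assoc, ← ex_add]
    simpa only [e] using this
  have hdm : ∀ v : ℝ, Measurable fun y => ENNReal.ofReal (decay 100 k (v - y)) := fun v =>
    ((measurable_decay 100 k).comp (measurable_const.sub measurable_id)).ennreal_ofReal
  have hdec : ∀ {u y w : ℝ}, |u - w| ≤ (k : ℝ) / 2 → ENNReal.ofReal (decay 100 k (u - y)) ≤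
      2 ^ 100 * ENNReal.ofReal (decay 100 k (y - w)) := fun {u y w} h => by
    refine (ENNReal.ofReal_le_ofReal (decay_sub_le hk h)).trans (le_of_eq ?_)
    rw [ENNReal.ofReal_mul (by positivity), ENNReal.ofReal_pow (by norm_num)]
    norm_num
  have hm : Measurable fun y => ‖extE f y‖ₑ ^ (2 : ℝ) * ENNReal.ofReal (wtB z k y) :=
    (hE.measurable.enorm.pow_const _).mul (measurable_wtB z k).ennreal_ofReal
  set b := ENNReal.ofReal (k : ℝ)⁻¹
  calc ‖extE f x‖ₑ ^ (2 : ℝ)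
      ≤ C * (b * ∫⁻ y, ENNReal.ofReal (decay 100 k (x.1 - y)) *
          ‖extE f (y, x.2)‖ₑ ^ (2 : ℝ)) := hfst x.1 x.2
    _ ≤ C * (b * ∫⁻ y, ENNReal.ofReal (decay 100 k (x.1 - y)) *
          (C * (b * ∫⁻ w, ENNReal.ofReal (decay 100 k (x.2 - w)) *
            ‖extE f (y, w)‖ₑ ^ (2 : ℝ)))) := by
        gcongr with y
        exact hsnd y x.2
    _ ≤ C * (b * ∫⁻ y, (2 ^ 100 * ENNReal.ofReal (decay 100 k (y - z.1))) *
          (C * (b * ∫⁻ w, (2 ^ 100 * ENNReal.ofReal (decay 100 k (w - z.2))) *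
            ‖extE f (y, w)‖ₑ ^ (2 : ℝ)))) := by
        gcongr with y w
        · exact hdec hx1
        · exact hdec hx2
    _ = C * (b * ∫⁻ y, (C * b * (2 ^ 100) ^ 2) * ∫⁻ w, ‖extE f (y, w)‖ₑ ^ (2 : ℝ) *
          ENNReal.ofReal (wtB z k (y, w))) := by
        congr 3; ext y
        have : ∀ w, ‖extE f (y, w)‖ₑ ^ (2 : ℝ) * ENNReal.ofReal (wtB z k (y, w)) =
            ENNReal.ofReal (decay 100 k (y - z.1)) * (ENNReal.ofReal (decay 100 k (w - z.2)) *
              ‖extE f (y, w)‖ₑ ^ (2 : ℝ)) := fun w => by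
          rw [wtB_eq, ENNReal.ofReal_mul (decay_nonneg _ hk _)]; ring
        simp_rw [this, mul_assoc]
        rw [lintegral_const_mul' _ _ (by finiteness), lintegral_const_mul' _ _ (by finiteness)]
        ring
    _ = C * (b * ((C * b * (2 ^ 100) ^ 2) * ∫⁻ y, ‖extE f y‖ₑ ^ (2 : ℝ) *
          ENNReal.ofReal (wtB z k y))) := by
        rw [lintegral_const_mul' _ _ (by finiteness), Measure.volume_eq_prod,
          lintegral_prod _ hm.aemeasurable]
    _ = _ := by
        rw [← inv_pow, ENNReal.ofReal_pow (by positivity)]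
        push_cast; ring

end

noncomputable section

open scoped ENNReal NNReal

/-- The weighted square average of `F` over the square of center `z` and side `R`. -/
def sqAvg (R : ℝ) (z : ℝ × ℝ) (F : ℝ × ℝ → ℂ) : ℝ≥0∞ :=
  ENNReal.ofReal (R ^ 2)⁻¹ * ∫⁻ y, ‖F y‖ₑ ^ (2 : ℝ) * ENNReal.ofReal (wtB z R y)

lemma ofReal_shLp_sq {p : ℝ} (hp : 0 < p) (R : ℝ) {w : ℝ × ℝ → ℝ} (hw : Integrable w)
    (h0 : ∀ x, 0 ≤ w x) {F : ℝ × ℝ → ℂ} (hF : Continuous F) {K : ℝ} (hK : ∀ x, ‖F x‖ ≤ K) :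
    ENNReal.ofReal (shLp p R w F ^ 2) =
      (ENNReal.ofReal (R ^ 2)⁻¹ * ∫⁻ x, ‖F x‖ₑ ^ p * ENNReal.ofReal (w x)) ^ (2 / p) := by
  have hI : 0 ≤ ∫ x, ‖F x‖ ^ p * w x := integral_nonneg fun x => mul_nonneg (by positivity) (h0 x)
  rw [lintegral_enorm_rpow_mul hp.le hF.aestronglyMeasurable hK hw h0,
    ← ENNReal.ofReal_mul (by positivity), ENNReal.ofReal_rpow_of_nonneg (by positivity)
    (by positivity), shLp, ← Real.rpow_natCast, ← Real.rpow_mul (by positivity)]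
  congr 2; push_cast; ring

/-- The weighted square function of the pieces of length `1 / n` of `[i/k, (i+1)/k]`. -/
def pieceSum (p : ℝ) (n k : ℕ) (c : ℝ × ℝ) (g : ℝ → ℂ) (i : ℕ) : ℝ≥0∞ :=
  ∑ J ∈ Finset.range (n / k), wInt p c ((n : ℝ) ^ 2)
    (extOp ((i : ℝ) / k + (J : ℝ) / n) ((i : ℝ) / k + ((J : ℝ) + 1) / n) g) ^ (2 / p)

lemma piece_subset {n k i J : ℕ} (hn : 0 < n) (hkn : k ∣ n) (hi : i < k) (hJ : J < n / k) :
    Set.Icc ((i : ℝ) / k + (J : ℝ) / n) ((i : ℝ) / k + ((J : ℝ) + 1) / n) ⊆ Set.Icc 0 1 := by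
  obtain ⟨m, rfl⟩ := hkn
  have hk : 0 < k := by omega
  rw [Nat.mul_div_cancel_left m hk] at hJ
  have hk' : (0 : ℝ) < k := by exact_mod_cast hk
  have hm' : (0 : ℝ) < m := by exact_mod_cast (by omega : 0 < m)
  refine Set.Icc_subset_Icc (by positivity) ?_
  have h1 : (i : ℝ) + 1 ≤ k := by exact_mod_cast hi
  have h2 : (J : ℝ) + 1 ≤ m := by exact_mod_cast hJ
  calc (i : ℝ) / k + ((J : ℝ) + 1) / (k * m : ℕ) ≤ i / k + m / (k * m : ℕ) := by gcongr
    _ = ((i : ℝ) + 1) / k := by push_cast; field_simp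
    _ ≤ 1 := by rwa [div_le_one hk']

lemma interval_subset {k i : ℕ} (hi : i < k) :
    Set.Icc ((i : ℝ) / k) (((i : ℝ) + 1) / k) ⊆ Set.Icc 0 1 := by
  have hk' : (0 : ℝ) < k := by exact_mod_cast (by omega : 0 < k)
  refine Set.Icc_subset_Icc (by positivity) ?_
  rw [div_le_one hk']; exact_mod_cast hi

lemma bilIneq_one_iff {p : ℝ} (hp : 0 < p) {n k : ℕ} (hn : 0 < n) (hkn : k ∣ n) {M : ℝ}
    (hM : 0 ≤ M) :
    BilIneq p n k 1 M ↔ ∀ g : ℝ → ℂ, IntegrableOn g (Set.Icc 0 1) → ∀ c : ℝ × ℝ, ∀ i i' : ℕ,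
      i < k → i' < k → (i + 1 < i' ∨ i' + 1 < i) →
      ENNReal.ofReal (((n ^ 2 / k : ℕ) : ℝ) ^ 2)⁻¹ *
        ∑ a ∈ Finset.range (n ^ 2 / k), ∑ a' ∈ Finset.range (n ^ 2 / k),
          (sqAvg k (subCtr c ((n : ℝ) ^ 2) k a a')
            (extOp ((i : ℝ) / k) (((i : ℝ) + 1) / k) g) ^ (p / 4) *
          sqAvg k (subCtr c ((n : ℝ) ^ 2) k a a')
            (extOp ((i' : ℝ) / k) (((i' : ℝ) + 1) / k) g) ^ (p / 4)) ≤
      ENNReal.ofReal M ^ p * (ENNReal.ofReal (((n : ℝ) ^ 2) ^ 2)⁻¹ *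
        (pieceSum p n k c g i ^ (p / 4) * pieceSum p n k c g i' ^ (p / 4))) := by
  unfold BilIneq
  refine forall_congr' fun g => forall_congr' fun hg => forall_congr' fun c =>
    forall_congr' fun i => forall_congr' fun i' => forall_congr' fun hi => forall_congr' fun hi' =>
    forall_congr' fun _ => ?_
  have hn' : (0 : ℝ) < n := by exact_mod_cast hn
  have hk' : (0 : ℝ) < k := by exact_mod_cast (by omega : 0 < k)
  simp only [pow_one, Nat.sub_self, pow_zero, Finset.sum_range_one, Nat.cast_zero,
    add_zero, zero_add, ← add_div]
  set r := fun j a a' => shLp 2 k (wtB (subCtr c ((n : ℝ) ^ 2) k a a') k)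
    (extOp ((j : ℝ) / k) (((j : ℝ) + 1) / k) g) ^ 2 with hr
  set t := fun (j : ℕ) => ∑ J ∈ Finset.range (n / k), shLp p ((n : ℝ) ^ 2) (wB c ((n : ℝ) ^ 2))
    (extOp ((j : ℝ) / k + (J : ℝ) / n) ((j : ℝ) / k + ((J : ℝ) + 1) / n) g) ^ 2 with ht
  have hr0 : ∀ j a a', 0 ≤ r j a a' := fun j a a' => sq_nonneg _
  have ht0 : ∀ j, 0 ≤ t j := fun j => Finset.sum_nonneg fun _ _ => sq_nonneg _
  have hre : ∀ j < k, ∀ a a', ENNReal.ofReal (r j a a') = sqAvg k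
      (subCtr c ((n : ℝ) ^ 2) k a a') (extOp ((j : ℝ) / k) (((j : ℝ) + 1) / k) g) :=
    fun j hj a a' => by
      obtain ⟨hc, K, hK⟩ := extOp_props (hg.mono_set (interval_subset hj))
      simp only [hr]
      rw [ofReal_shLp_sq two_pos k (integrable_wtB _ hk') (wtB_nonneg _ hk') hc hK,
        div_self two_ne_zero, ENNReal.rpow_one, sqAvg]
  have hte : ∀ j < k, ENNReal.ofReal (t j) ^ (p / 4) =
      ENNReal.ofReal (((n : ℝ) ^ 2) ^ 2)⁻¹ ^ (1 / 2 : ℝ) * pieceSum p n k c g j ^ (p / 4) :=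
    fun j hj => by
      have e : ENNReal.ofReal (t j) =
          ENNReal.ofReal (((n : ℝ) ^ 2) ^ 2)⁻¹ ^ (2 / p) * pieceSum p n k c g j := by
        simp only [ht, pieceSum]
        rw [ENNReal.ofReal_sum_of_nonneg fun _ _ => sq_nonneg _, Finset.mul_sum]
        refine Finset.sum_congr rfl fun J hJ => ?_
        obtain ⟨hc, K, hK⟩ := extOp_props
          (hg.mono_set (piece_subset hn hkn hj (Finset.mem_range.1 hJ)))
        rw [ofReal_shLp_sq hp _ (integrable_wB c (by positivity)) (wB_nonneg c (by positivity)) hc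
          hK, ENNReal.mul_rpow_of_nonneg _ _ (by positivity), wInt]
      rw [e, ENNReal.mul_rpow_of_nonneg _ _ (by positivity), ← ENNReal.rpow_mul]
      congr 2; field_simp; norm_num
  rw [← ENNReal.ofReal_le_ofReal_iff (mul_nonneg (by positivity) (mul_nonneg
    (Real.rpow_nonneg (ht0 i) _) (Real.rpow_nonneg (ht0 i') _)))]
  have hL : ENNReal.ofReal ((((n ^ 2 / k : ℕ) : ℝ) ^ 2)⁻¹ *
      ∑ a ∈ Finset.range (n ^ 2 / k), ∑ a' ∈ Finset.range (n ^ 2 / k),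
        (r i a a' ^ (p / 4) * r i' a a' ^ (p / 4))) =
      ENNReal.ofReal (((n ^ 2 / k : ℕ) : ℝ) ^ 2)⁻¹ *
        ∑ a ∈ Finset.range (n ^ 2 / k), ∑ a' ∈ Finset.range (n ^ 2 / k),
          (sqAvg k (subCtr c ((n : ℝ) ^ 2) k a a')
            (extOp ((i : ℝ) / k) (((i : ℝ) + 1) / k) g) ^ (p / 4) *
          sqAvg k (subCtr c ((n : ℝ) ^ 2) k a a')
            (extOp ((i' : ℝ) / k) (((i' : ℝ) + 1) / k) g) ^ (p / 4)) := by
    have h0 : ∀ a a', 0 ≤ r i a a' ^ (p / 4) * r i' a a' ^ (p / 4) := fun a a' =>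
      mul_nonneg (Real.rpow_nonneg (hr0 _ _ _) _) (Real.rpow_nonneg (hr0 _ _ _) _)
    rw [ENNReal.ofReal_mul (by positivity), ENNReal.ofReal_sum_of_nonneg fun a _ =>
      Finset.sum_nonneg fun a' _ => h0 a a']
    congr 1
    refine Finset.sum_congr rfl fun a _ => ?_
    rw [ENNReal.ofReal_sum_of_nonneg fun a' _ => h0 a a']
    refine Finset.sum_congr rfl fun a' _ => ?_
    rw [ENNReal.ofReal_mul (Real.rpow_nonneg (hr0 _ _ _) _),
      ← ENNReal.ofReal_rpow_of_nonneg (hr0 _ _ _) (by positivity),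
      ← ENNReal.ofReal_rpow_of_nonneg (hr0 _ _ _) (by positivity), hre i hi, hre i' hi']
  have hR : ENNReal.ofReal (M ^ p * (t i ^ (p / 4) * t i' ^ (p / 4))) =
      ENNReal.ofReal M ^ p * (ENNReal.ofReal (((n : ℝ) ^ 2) ^ 2)⁻¹ *
        (pieceSum p n k c g i ^ (p / 4) * pieceSum p n k c g i' ^ (p / 4))) := by
    rw [ENNReal.ofReal_mul (by positivity), ENNReal.ofReal_mul (Real.rpow_nonneg (ht0 i) _),
      ← ENNReal.ofReal_rpow_of_nonneg hM hp.le,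
      ← ENNReal.ofReal_rpow_of_nonneg (ht0 i) (by positivity),
      ← ENNReal.ofReal_rpow_of_nonneg (ht0 i') (by positivity), hte i hi, hte i' hi']
    set β := ENNReal.ofReal (((n : ℝ) ^ 2) ^ 2)⁻¹
    have hβ : β ^ (1 / 2 : ℝ) * β ^ (1 / 2 : ℝ) = β := by
      rw [← ENNReal.rpow_add_of_nonneg _ _ (by norm_num) (by norm_num)]; norm_num
    conv_rhs => rw [← hβ]
    ring
  rw [hL, hR]

lemma inv_wB_le_of_mem_sqr {c x : ℝ × ℝ} {R : ℝ} (hR : 0 < R) (hx : x ∈ sqr c R) :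
    1 ≤ 2 ^ 100 * wB c R x := by
  obtain ⟨h1, h2⟩ := mem_sqr_iff.1 hx
  have h : √((x.1 - c.1) ^ 2 + (x.2 - c.2) ^ 2) ≤ R := by
    rw [Real.sqrt_le_left hR.le, ← sq_abs (x.1 - c.1), ← sq_abs (x.2 - c.2)]
    nlinarith [abs_nonneg (x.1 - c.1), abs_nonneg (x.2 - c.2)]
  have h' : √((x.1 - c.1) ^ 2 + (x.2 - c.2) ^ 2) / R ≤ 1 := (div_le_one hR).2 h
  rw [wB_eq, ← div_eq_mul_inv, one_le_div (by positivity)]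
  gcongr
  linarith

lemma lintegral_sqr_le_wInt (p : ℝ) (c : ℝ × ℝ) {R : ℝ} (hR : 0 < R) (F : ℝ × ℝ → ℂ) :
    ∫⁻ x in sqr c R, ‖F x‖ₑ ^ p ≤ 2 ^ 100 * wInt p c R F := by
  rw [wInt, ← lintegral_const_mul' _ _ (by simp)]
  refine (setLIntegral_mono' (measurableSet_sqr c R) fun x hx => ?_).trans
    (setLIntegral_le_lintegral _ _)
  have h := ENNReal.ofReal_le_ofReal (inv_wB_le_of_mem_sqr hR hx)
  rw [ENNReal.ofReal_one, ENNReal.ofReal_mul (by positivity), ENNReal.ofReal_pow (by norm_num),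
    ENNReal.ofReal_ofNat] at h
  calc ‖F x‖ₑ ^ p = ‖F x‖ₑ ^ p * 1 := (mul_one _).symm
    _ ≤ ‖F x‖ₑ ^ p * (2 ^ 100 * ENNReal.ofReal (wB c R x)) := by gcongr
    _ = _ := by ring

lemma wInt_sum_le {p : ℝ} (hp : 1 ≤ p) (c : ℝ × ℝ) {R : ℝ} (hR : 0 < R) (m : ℕ)
    {F : ℕ → ℝ × ℝ → ℂ} (hF : ∀ j < m, Continuous (F j)) {G : ℝ × ℝ → ℂ}
    (hG : ∀ x, G x = ∑ j ∈ Finset.range m, F j x) :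
    wInt p c R G ≤ (m : ℝ≥0∞) ^ (p - 1) * m *
      (∑ j ∈ Finset.range m, wInt p c R (F j) ^ (2 / p)) ^ (p / 2) := by
  calc wInt p c R G ≤ ∫⁻ x, (m : ℝ≥0∞) ^ (p - 1) *
        ∑ j ∈ Finset.range m, ‖F j x‖ₑ ^ p * ENNReal.ofReal (wB c R x) := by
        refine lintegral_mono fun x => ?_
        have := enorm_sum_rpow_le (Finset.range m) (fun j => F j x) hp
        rw [Finset.card_range] at this
        simp only [hG]
        rw [← Finset.sum_mul, ← mul_assoc]
        gcongr
    _ = (m : ℝ≥0∞) ^ (p - 1) * ∑ j ∈ Finset.range m, wInt p c R (F j) := by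
        rw [lintegral_const_mul' _ _ (by simp [hp]), lintegral_finsetSum']
        · rfl
        · intro j hj
          have h1 := (hF j (Finset.mem_range.1 hj)).measurable
          have h2 := (continuous_wB c hR).measurable
          exact ((h1.enorm.pow_const p).mul h2.ennreal_ofReal).aemeasurable
    _ ≤ (m : ℝ≥0∞) ^ (p - 1) * ∑ j ∈ Finset.range m,
          (∑ j ∈ Finset.range m, wInt p c R (F j) ^ (2 / p)) ^ (p / 2) := by
        gcongr with j hj
        exact ENNReal.le_sum_rpow_rpow (fun j => wInt p c R (F j)) hj (by linarith)
    _ = _ := by rw [Finset.sum_const, Finset.card_range, nsmul_eq_mul, mul_assoc]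

lemma extOp_unit_eq_sum {m : ℕ} (hm : 0 < m) {g : ℝ → ℂ} (hg : IntegrableOn g (Set.Icc 0 1))
    (x : ℝ × ℝ) : extOp 0 1 g x =
      ∑ q ∈ Finset.range m, extOp ((q : ℝ) / m) (((q : ℝ) + 1) / m) g x := by
  have hm' : (m : ℝ) ≠ 0 := by exact_mod_cast hm.ne'
  have hs : Monotone fun q : ℕ => (q : ℝ) / m := fun a b h => by dsimp only; gcongr
  have := extOp_eq_sum hs m (g := g) (by simpa [hm'] using hg) x
  simpa [hm'] using this

lemma extOp_interval_eq_sum {n k i : ℕ} (hn : 0 < n) (hkn : k ∣ n) (hi : i < k) {g : ℝ → ℂ}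
    (hg : IntegrableOn g (Set.Icc 0 1)) (x : ℝ × ℝ) :
    extOp ((i : ℝ) / k) (((i : ℝ) + 1) / k) g x = ∑ J ∈ Finset.range (n / k),
      extOp ((i : ℝ) / k + (J : ℝ) / n) ((i : ℝ) / k + ((J : ℝ) + 1) / n) g x := by
  have hs : Monotone fun J : ℕ => (i : ℝ) / k + (J : ℝ) / n := fun a b h => by dsimp only; gcongr
  have e : (i : ℝ) / k + ((n / k : ℕ) : ℝ) / n = ((i : ℝ) + 1) / k := by
    have hk : (k : ℝ) ≠ 0 := by exact_mod_cast (by omega : k ≠ 0)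
    have hn' : (n : ℝ) ≠ 0 := by exact_mod_cast hn.ne'
    rw [Nat.cast_div hkn hk]; field_simp
  have := extOp_eq_sum hs (n / k) (g := g)
    (by simpa only [Nat.cast_zero, zero_div, add_zero, e] using hg.mono_set (interval_subset hi)) x
  simpa only [Nat.cast_zero, zero_div, add_zero, e, Nat.cast_add, Nat.cast_one] using this

lemma exists_le_ofReal_rpow {K : ℝ≥0∞} (hK : K ≠ ∞) {p : ℝ} (hp : 1 ≤ p) :
    ∃ D : ℝ, 0 ≤ D ∧ K ≤ ENNReal.ofReal D ^ p := by
  refine ⟨max 1 K.toReal, by positivity, ?_⟩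
  calc K = ENNReal.ofReal K.toReal := (ENNReal.ofReal_toReal hK).symm
    _ ≤ ENNReal.ofReal (max 1 K.toReal) ^ (1 : ℝ) := by
        rw [ENNReal.rpow_one]; exact ENNReal.ofReal_le_ofReal (le_max_right _ _)
    _ ≤ _ := ENNReal.rpow_le_rpow_of_exponent_le (by simp) hp

lemma exists_decIneq {p : ℝ} (hp : 1 ≤ p) {m : ℕ} (hm : 0 < m) :
    ∃ D : ℝ, 0 ≤ D ∧ DecIneq p m D := by
  have hm' : (0 : ℝ) < m := by exact_mod_cast hm
  obtain ⟨D, hD, hK⟩ := exists_le_ofReal_rpow (K := 2 ^ 100 * ((m : ℝ≥0∞) ^ (p - 1) * m))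
    (ENNReal.mul_ne_top (by simp) (ENNReal.mul_ne_top (by simp [hp]) (by simp))) hp
  refine ⟨D, hD, (decIneq_iff (by linarith) hm hD).2 fun g hg c => ?_⟩
  refine (lintegral_sqr_le_wInt p c (by positivity) _).trans ?_
  refine (mul_le_mul_right (wInt_sum_le hp c (by positivity) m (fun q hq => ?_)
    (extOp_unit_eq_sum hm hg)) _).trans ?_
  · exact (extOp_props (hg.mono_set (interval_subset hq))).1
  · rw [← mul_assoc]
    gcongr

lemma wtB_le_wB {c z : ℝ × ℝ} {r R : ℝ} (hr : 0 < r) (hrR : r ≤ R) (h1 : |z.1 - c.1| ≤ R / 2)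
    (h2 : |z.2 - c.2| ≤ R / 2) (x : ℝ × ℝ) : wtB z r x ≤ 2 ^ 100 * wB c R x := by
  have hR : 0 < R := hr.trans_le hrR
  have hx : √((x.1 - c.1) ^ 2 + (x.2 - c.2) ^ 2) ≤ |x.1 - c.1| + |x.2 - c.2| := by
    rw [Real.sqrt_le_left (by positivity), ← sq_abs (x.1 - c.1), ← sq_abs (x.2 - c.2)]
    nlinarith [abs_nonneg (x.1 - c.1), abs_nonneg (x.2 - c.2)]
  have t1 := abs_sub_le x.1 z.1 c.1
  have t2 := abs_sub_le x.2 z.2 c.2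
  have s1 : |x.1 - z.1| / R ≤ |x.1 - z.1| / r := by gcongr
  have s2 : |x.2 - z.2| / R ≤ |x.2 - z.2| / r := by gcongr
  have hd : √((x.1 - c.1) ^ 2 + (x.2 - c.2) ^ 2) / R ≤
      1 + |x.1 - z.1| / R + |x.2 - z.2| / R := by
    rw [div_le_iff₀ hR]; field_simp; linarith
  set u := |x.1 - z.1| / r
  set v := |x.2 - z.2| / r
  have hu : 0 ≤ u := by positivity
  have hv : 0 ≤ v := by positivity
  rw [wB_eq, wtB_eq, decay, decay, ← mul_inv, ← mul_pow]
  refine inv_pow_le_mul_inv_pow two_pos (by positivity) ?_ 100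
  rw [div_le_iff₀ two_pos]
  nlinarith [mul_nonneg hu hv]

lemma abs_subCtr_sub_le {N r : ℝ} {a a' : ℕ} (c : ℝ × ℝ) (hr : 0 < r)
    (ha : (a : ℝ) + 1 ≤ N) (ha' : (a' : ℝ) + 1 ≤ N) :
    |(subCtr c (N * r) r a a').1 - c.1| ≤ N * r / 2 ∧
      |(subCtr c (N * r) r a a').2 - c.2| ≤ N * r / 2 := by
  simp only [subCtr]
  have := Nat.cast_nonneg (α := ℝ) a
  have := Nat.cast_nonneg (α := ℝ) a'
  constructor <;> rw [abs_le] <;> constructor <;> nlinarith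

lemma sqAvg_rpow_le {p : ℝ} (hp : 2 < p) {c z : ℝ × ℝ} {r R : ℝ} (hr : 0 < r) (hrR : r ≤ R)
    (h1 : |z.1 - c.1| ≤ R / 2) (h2 : |z.2 - c.2| ≤ R / 2) {F : ℝ × ℝ → ℂ} (hF : Continuous F) :
    sqAvg r z F ^ (p / 2) ≤ ENNReal.ofReal (r ^ 2)⁻¹ ^ (p / 2) *
      ((ENNReal.ofReal r ^ 2 * decayMass ^ 2) ^ (p / 2 - 1) * 2 ^ 100) * wInt p c R F := by
  rw [sqAvg, ENNReal.mul_rpow_of_nonneg _ _ (by linarith), mul_assoc]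
  gcongr
  have hw := (measurable_wtB z r).ennreal_ofReal
  have hFm := hF.measurable.enorm.pow_const (2 : ℝ)
  have h := lintegral_mul_rpow_le (μ := volume) hw.aemeasurable hFm.aemeasurable
    (by linarith : 1 < p / 2)
  simp_rw [mul_comm (‖F _‖ₑ ^ (2 : ℝ))]
  refine h.trans ?_
  rw [mul_assoc]
  refine mul_le_mul' (ENNReal.rpow_le_rpow (lintegral_wtB_le z hr) (by linarith)) ?_
  rw [wInt, ← lintegral_const_mul' _ _ (by simp)]
  refine lintegral_mono fun x => ?_
  have hx := ENNReal.ofReal_le_ofReal (wtB_le_wB hr hrR h1 h2 x)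
  rw [ENNReal.ofReal_mul (by positivity), ENNReal.ofReal_pow (by norm_num),
    ENNReal.ofReal_ofNat] at hx
  rw [← ENNReal.rpow_mul, mul_div_cancel₀ _ two_ne_zero]
  calc _ ≤ 2 ^ 100 * ENNReal.ofReal (wB c R x) * ‖F x‖ₑ ^ p := by gcongr
    _ = _ := by ring

lemma exists_bilIneq {p : ℝ} (hp : 2 < p) {n k : ℕ} (hn : 0 < n) (hkn : k ∣ n) :
    ∃ M : ℝ, 0 ≤ M ∧ BilIneq p n k 1 M := by
  have hn' : (0 : ℝ) < n := by exact_mod_cast hn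
  have hk : 0 < k := Nat.pos_of_dvd_of_pos hkn hn
  have hk' : (0 : ℝ) < k := by exact_mod_cast hk
  set A : ℝ≥0∞ := ENNReal.ofReal ((k : ℝ) ^ 2)⁻¹ ^ (p / 2) *
      ((ENNReal.ofReal k ^ 2 * decayMass ^ 2) ^ (p / 2 - 1) * 2 ^ 100) *
      (((n / k : ℕ) : ℝ≥0∞) ^ (p - 1) * (n / k : ℕ)) with hA
  have hAt : A ≠ ∞ := by
    refine ENNReal.mul_ne_top (ENNReal.mul_ne_top ?_ (ENNReal.mul_ne_top ?_ (by simp)))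
      (ENNReal.mul_ne_top ?_ (by simp))
    · exact ENNReal.rpow_ne_top_of_nonneg (by linarith) (by simp)
    · exact ENNReal.rpow_ne_top_of_nonneg (by linarith) (ENNReal.mul_ne_top (by simp) (by simp))
    · exact ENNReal.rpow_ne_top_of_nonneg (by linarith) (by simp)
  set N := n ^ 2 / k with hN
  have hNk : (N : ℝ) * k = (n : ℝ) ^ 2 := by
    have : N * k = n ^ 2 := Nat.div_mul_cancel (hkn.trans (dvd_pow_self n two_ne_zero))
    exact_mod_cast this
  have hkle : (k : ℝ) ≤ (n : ℝ) ^ 2 := by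
    exact_mod_cast (Nat.le_of_dvd hn hkn).trans (Nat.le_self_pow two_ne_zero n)
  set α := ENNReal.ofReal ((N : ℝ) ^ 2)⁻¹
  set β := ENNReal.ofReal (((n : ℝ) ^ 2) ^ 2)⁻¹ with hβ
  have hβ0 : β ≠ 0 := by rw [hβ, ENNReal.ofReal_ne_zero_iff]; positivity
  have hβt : β ≠ ∞ := ENNReal.ofReal_ne_top
  have hKt : α * (N * (N * (A ^ (1 / 2 : ℝ) * A ^ (1 / 2 : ℝ)))) * β⁻¹ ≠ ∞ := by
    have := ENNReal.rpow_ne_top_of_nonneg (by norm_num : (0 : ℝ) ≤ 1 / 2) hAt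
    have hNt : (N : ℝ≥0∞) ≠ ∞ := ENNReal.natCast_ne_top N
    exact ENNReal.mul_ne_top (ENNReal.mul_ne_top ENNReal.ofReal_ne_top (ENNReal.mul_ne_top
      hNt (ENNReal.mul_ne_top hNt (ENNReal.mul_ne_top this this)))) (ENNReal.inv_ne_top.2 hβ0)
  obtain ⟨M, hM, hK⟩ := exists_le_ofReal_rpow hKt (by linarith : 1 ≤ p)
  refine ⟨M, hM, (bilIneq_one_iff (by linarith) hn hkn hM).2 fun g hg c i i' hi hi' _ => ?_⟩
  have key : ∀ j < k, ∀ a < N, ∀ a' < N, sqAvg k (subCtr c ((n : ℝ) ^ 2) k a a')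
      (extOp ((j : ℝ) / k) (((j : ℝ) + 1) / k) g) ^ (p / 4) ≤
        A ^ (1 / 2 : ℝ) * pieceSum p n k c g j ^ (p / 4) := fun j hj a ha a' ha' => by
    have hctr := abs_subCtr_sub_le (N := N) (a := a) (a' := a') c hk' (by exact_mod_cast ha)
      (by exact_mod_cast ha')
    rw [hNk] at hctr
    have hc := (extOp_props (hg.mono_set (interval_subset hj))).1
    have h1 := sqAvg_rpow_le hp hk' hkle hctr.1 hctr.2 hc
    have h2 := wInt_sum_le (p := p) (by linarith) c (by positivity : 0 < (n : ℝ) ^ 2) (n / k)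
      (fun J hJ => (extOp_props (hg.mono_set (piece_subset hn hkn hj hJ))).1)
      (extOp_interval_eq_sum hn hkn hj hg)
    have h3 := h1.trans (mul_le_mul_right h2 _)
    rw [← mul_assoc] at h3
    have h4 := ENNReal.rpow_le_rpow h3 (by norm_num : (0 : ℝ) ≤ 1 / 2)
    rw [ENNReal.mul_rpow_of_nonneg _ _ (by norm_num : (0 : ℝ) ≤ 1 / 2), ← ENNReal.rpow_mul,
      ← ENNReal.rpow_mul] at h4
    rwa [show p / 2 * (1 / 2) = p / 4 by ring] at h4
  calc _ ≤ α * ∑ a ∈ Finset.range N, ∑ a' ∈ Finset.range N,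
        (A ^ (1 / 2 : ℝ) * pieceSum p n k c g i ^ (p / 4) *
          (A ^ (1 / 2 : ℝ) * pieceSum p n k c g i' ^ (p / 4))) := by
        gcongr with a ha a' ha'
        · exact key i hi a (Finset.mem_range.1 ha) a' (Finset.mem_range.1 ha')
        · exact key i' hi' a (Finset.mem_range.1 ha) a' (Finset.mem_range.1 ha')
    _ = α * (N * (N * (A ^ (1 / 2 : ℝ) * A ^ (1 / 2 : ℝ)))) * β⁻¹ *
        (β * (pieceSum p n k c g i ^ (p / 4) * pieceSum p n k c g i' ^ (p / 4))) := by
        simp only [Finset.sum_const, Finset.card_range, nsmul_eq_mul]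
        rw [mul_assoc _ β⁻¹, ← mul_assoc β⁻¹, ENNReal.inv_mul_cancel hβ0 hβt, one_mul]
        ring
    _ ≤ _ := by gcongr

lemma sqr_subset_iUnion (c : ℝ × ℝ) {N : ℕ} (hN : 0 < N) {r : ℝ} (hr : 0 < r) :
    sqr c (N * r) ⊆ ⋃ e : Fin N × Fin N, sqr (subCtr c (N * r) r e.1 e.2) r := by
  have key : ∀ t : ℝ, |t| ≤ N * r / 2 →
      ∃ a : Fin N, |t - (-(N * r / 2) + ((a : ℕ) + 1 / 2) * r)| ≤ r / 2 := fun t ht => by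
    obtain ⟨h1, h2⟩ := abs_le.1 ht
    set s := (t + N * r / 2) / r
    have hs : s * r = t + N * r / 2 := div_mul_cancel₀ _ hr.ne'
    have hs0 : 0 ≤ s := div_nonneg (by linarith) hr.le
    have hsN : s ≤ N := by rw [div_le_iff₀ hr]; linarith
    rcases hsN.lt_or_eq with hlt | heq
    · refine ⟨⟨⌊s⌋₊, (Nat.floor_lt hs0).2 hlt⟩, ?_⟩
      have g1 := Nat.floor_le hs0
      have g2 := Nat.lt_floor_add_one s
      simp only [abs_le]
      constructor <;> nlinarith
    · refine ⟨⟨N - 1, by omega⟩, ?_⟩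
      have : ((N - 1 : ℕ) : ℝ) = s - 1 := by rw [Nat.cast_sub hN, heq]; simp
      simp only [this, abs_le]
      constructor <;> nlinarith
  intro x hx
  obtain ⟨h1, h2⟩ := mem_sqr_iff.1 hx
  obtain ⟨a, ha⟩ := key _ h1
  obtain ⟨a', ha'⟩ := key _ h2
  refine Set.mem_iUnion.2 ⟨(a, a'), mem_sqr_iff.2 ⟨?_, ?_⟩⟩
  · simp only [subCtr]; convert ha using 2; ring
  · simp only [subCtr]; convert ha' using 2; ring

lemma lintegral_sqr_le_sum (c : ℝ × ℝ) {N : ℕ} (hN : 0 < N) {r : ℝ} (hr : 0 < r)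
    (Φ : ℝ × ℝ → ℝ≥0∞) : ∫⁻ x in sqr c (N * r), Φ x ≤
      ∑ a ∈ Finset.range N, ∑ a' ∈ Finset.range N,
        ∫⁻ x in sqr (subCtr c (N * r) r a a') r, Φ x := by
  calc _ ≤ _ := lintegral_mono_set (sqr_subset_iUnion c hN hr)
    _ ≤ _ := lintegral_iUnion_le _ _
    _ = _ := by
      rw [tsum_fintype, Fintype.sum_prod_type, Finset.sum_range]
      exact Finset.sum_congr rfl fun a _ => by rw [Finset.sum_range]

lemma sum_range_mul_eq {M : Type*} [AddCommMonoid M] (f : ℕ → M) (k m : ℕ) :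
    ∑ q ∈ Finset.range (k * m), f q =
      ∑ i ∈ Finset.range k, ∑ J ∈ Finset.range m, f (i * m + J) := by
  induction k with
  | zero => simp
  | succ k ih => rw [Nat.succ_mul, Finset.sum_range_add, ih, Finset.sum_range_succ]

lemma sum_pieceSum {p : ℝ} {n k : ℕ} (hn : 0 < n) (hkn : k ∣ n) (c : ℝ × ℝ) (g : ℝ → ℂ) :
    ∑ q ∈ Finset.range n, wInt p c ((n : ℝ) ^ 2)
      (extOp ((q : ℝ) / n) (((q : ℝ) + 1) / n) g) ^ (2 / p) =
      ∑ i ∈ Finset.range k, pieceSum p n k c g i := by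
  have hk : (k : ℝ) ≠ 0 := by exact_mod_cast (Nat.pos_of_dvd_of_pos hkn hn).ne'
  have hn' : (n : ℝ) ≠ 0 := by exact_mod_cast hn.ne'
  have h := sum_range_mul_eq (fun q => wInt p c ((n : ℝ) ^ 2)
      (extOp ((q : ℝ) / n) (((q : ℝ) + 1) / n) g) ^ (2 / p)) k (n / k)
  rw [Nat.mul_div_cancel' hkn] at h
  rw [h]
  refine Finset.sum_congr rfl fun i _ => Finset.sum_congr rfl fun J _ => ?_
  have e1 : ((i * (n / k) + J : ℕ) : ℝ) / n = (i : ℝ) / k + J / n := by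
    push_cast [Nat.cast_div hkn hk]; field_simp
  rw [add_div, e1, add_assoc, ← add_div]

/-- The pairs of indices below `k` at distance at least two. -/
def sepPairs (k : ℕ) : Finset (ℕ × ℕ) :=
  (Finset.range k ×ˢ Finset.range k).filter fun e => e.1 + 1 < e.2 ∨ e.2 + 1 < e.1

lemma sum_sq_le_diagonal_add (k : ℕ) (x : ℕ → ℝ≥0∞) : (∑ i ∈ Finset.range k, x i) ^ 2 ≤
    6 * ∑ i ∈ Finset.range k, x i ^ 2 + ∑ e ∈ sepPairs k, x e.1 * x e.2 := by
  have hmul : ∀ a b : ℝ≥0∞, a * b ≤ a ^ 2 + b ^ 2 := fun a b => by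
    rcases le_total a b with h | h
    · calc a * b ≤ b * b := by gcongr
        _ ≤ _ := by rw [sq b]; exact le_add_self
    · calc a * b ≤ a * a := by gcongr
        _ ≤ _ := by rw [sq a]; exact le_self_add
  have hcard : ∀ (P : ℕ → Prop) [DecidablePred P] (i : ℕ),
      (∀ j, P j → j ∈ Finset.Icc (i - 1) (i + 1)) → (((Finset.range k).filter P).card : ℝ≥0∞) ≤ 3 := fun P _ i h => by
    have h1 : (Finset.range k).filter P ⊆ Finset.Icc (i - 1) (i + 1) := fun j hj =>
      h j (Finset.mem_filter.1 hj).2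
    have h2 := Finset.card_le_card h1
    rw [Nat.card_Icc] at h2
    exact_mod_cast h2.trans (by omega : i + 1 + 1 - (i - 1) ≤ 3)
  rw [sq, Finset.sum_mul_sum, ← Finset.sum_product',
    ← Finset.sum_filter_add_sum_filter_not _ (fun e : ℕ × ℕ => e.1 + 1 < e.2 ∨ e.2 + 1 < e.1),
    add_comm]
  refine add_le_add ?_ le_rfl
  refine (Finset.sum_le_sum fun e _ => hmul _ _).trans ?_
  rw [Finset.sum_add_distrib, Finset.sum_filter, Finset.sum_filter]
  have h6 : (6 : ℝ≥0∞) * ∑ i ∈ Finset.range k, x i ^ 2 =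
      ∑ i ∈ Finset.range k, 3 * x i ^ 2 + ∑ i ∈ Finset.range k, 3 * x i ^ 2 := by
    rw [← Finset.mul_sum, ← add_mul]; norm_num
  rw [h6, Finset.sum_product, Finset.sum_product_right]
  refine add_le_add (Finset.sum_le_sum fun i _ => ?_) (Finset.sum_le_sum fun i _ => ?_)
  · dsimp only
    rw [← Finset.sum_filter, Finset.sum_const, nsmul_eq_mul]
    gcongr
    exact hcard _ i fun j hj => by simp only [Finset.mem_Icc]; omega
  · dsimp only
    rw [← Finset.sum_filter, Finset.sum_const, nsmul_eq_mul]
    gcongr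
    exact hcard _ i fun j hj => by simp only [Finset.mem_Icc]; omega

lemma card_sepPairs_le (k : ℕ) : ((sepPairs k).card : ℝ≥0∞) ≤ (k : ℝ≥0∞) ^ 2 := by
  have := Finset.card_filter_le (Finset.range k ×ˢ Finset.range k)
    fun e : ℕ × ℕ => e.1 + 1 < e.2 ∨ e.2 + 1 < e.1
  rw [Finset.card_product, Finset.card_range, ← sq] at this
  exact_mod_cast this

lemma sum_rpow_le_diagonal_add {p : ℝ} (hp4 : 4 < p) (hp6 : p < 6) (k : ℕ) (x : ℕ → ℝ≥0∞) :
    (∑ i ∈ Finset.range k, x i) ^ p ≤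
      864 * ((∑ i ∈ Finset.range k, (x i ^ p) ^ (1 / (p / 2))) ^ (p / 2) +
        ((k : ℝ≥0∞) ^ 2) ^ (p / 2 - 1) * ∑ e ∈ sepPairs k, x e.1 ^ (p / 2) * x e.2 ^ (p / 2)) := by
  have hx : ∀ i, (x i ^ p) ^ (1 / (p / 2)) = x i ^ 2 := fun i => by
    rw [← ENNReal.rpow_mul, show p * (1 / (p / 2)) = ((2 : ℕ) : ℝ) by push_cast; field_simp,
      ENNReal.rpow_natCast]
  have hpow : ∀ {b : ℝ≥0∞} (_ : 1 ≤ b) {s : ℝ} {j : ℕ}, s ≤ j → b ^ s ≤ b ^ j :=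
    fun hb s j hs => by
      rw [← ENNReal.rpow_natCast]; exact ENNReal.rpow_le_rpow_of_exponent_le hb hs
  have h := ENNReal.rpow_le_rpow (sum_sq_le_diagonal_add k x) (by linarith : 0 ≤ p / 2)
  rw [← ENNReal.rpow_natCast, ← ENNReal.rpow_mul,
    show ((2 : ℕ) : ℝ) * (p / 2) = p by push_cast; ring] at h
  refine h.trans ((ENNReal.rpow_add_le_mul_rpow_add_rpow _ _ (by linarith)).trans ?_)
  simp only [hx]
  rw [show (864 : ℝ≥0∞) = 2 ^ 2 * 6 ^ 3 by norm_num, mul_assoc, mul_add (6 ^ 3)]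
  refine mul_le_mul' (hpow (by norm_num) (by push_cast; linarith)) (add_le_add ?_ ?_)
  · rw [ENNReal.mul_rpow_of_nonneg _ _ (by linarith)]
    gcongr
    exact hpow (by norm_num) (by push_cast; linarith)
  · refine (ENNReal.rpow_sum_le_const_mul_sum_rpow _ _ (by linarith)).trans ?_
    simp only [ENNReal.mul_rpow_of_nonneg _ _ (by linarith : 0 ≤ p / 2)]
    refine le_trans ?_ (le_mul_of_one_le_left' (by norm_num))
    refine mul_le_mul' (ENNReal.rpow_le_rpow (card_sepPairs_le k) (by linarith)) le_rfl

lemma exists_lintegral_pair_le : ∃ C : ℝ≥0, ∀ p : ℝ, 4 < p → p < 6 → ∀ n k : ℕ, 0 < n →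
    k ∣ n → ∀ M : ℝ, 0 ≤ M → BilIneq p n k 1 M → ∀ g : ℝ → ℂ, IntegrableOn g (Set.Icc 0 1) →
    ∀ c : ℝ × ℝ, ∀ i i' : ℕ, i < k → i' < k → (i + 1 < i' ∨ i' + 1 < i) →
    ∫⁻ x in sqr c ((n : ℝ) ^ 2), ‖extOp ((i : ℝ) / k) (((i : ℝ) + 1) / k) g x‖ₑ ^ (p / 2) *
      ‖extOp ((i' : ℝ) / k) (((i' : ℝ) + 1) / k) g x‖ₑ ^ (p / 2) ≤
      C * (ENNReal.ofReal M ^ p *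
        (pieceSum p n k c g i ^ (p / 4) * pieceSum p n k c g i' ^ (p / 4))) := by
  obtain ⟨C, hC⟩ := exists_enorm_sq_extOp_le
  refine ⟨(max 1 C) ^ 6, fun p hp4 hp6 n k hn hkn M hM hbil g hg c i i' hi hi' hii => ?_⟩
  have hn' : (0 : ℝ) < n := by exact_mod_cast hn
  have hk : 0 < k := Nat.pos_of_dvd_of_pos hkn hn
  have hk' : (0 : ℝ) < k := by exact_mod_cast hk
  have hb := (bilIneq_one_iff (by linarith) hn hkn hM).1 hbil g hg c i i' hi hi' hii
  set N := n ^ 2 / k with hN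
  have hNk' : N * k = n ^ 2 := Nat.div_mul_cancel (hkn.trans (dvd_pow_self n two_ne_zero))
  have hNk : (N : ℝ) * k = (n : ℝ) ^ 2 := by exact_mod_cast hNk'
  have hN0 : 0 < N := Nat.pos_of_mul_pos_right (hNk' ▸ pow_pos hn 2)
  have hN0' : (0 : ℝ) < N := by exact_mod_cast hN0
  set E := fun j : ℕ => extOp ((j : ℝ) / k) (((j : ℝ) + 1) / k) g with hE
  set Q : ℝ≥0∞ := max 1 (C : ℝ≥0∞) with hQ
  have hpt : ∀ j < k, ∀ z x, x ∈ sqr z k → ‖E j x‖ₑ ^ (p / 2) ≤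
      Q ^ (p / 4) * sqAvg k z (E j) ^ (p / 4) := fun j hj z x hx => by
    have h := ENNReal.rpow_le_rpow (hC k j hj g hg z x hx) (by linarith : 0 ≤ p / 4)
    rw [← ENNReal.rpow_mul, show 2 * (p / 4) = p / 2 by ring] at h
    rw [← ENNReal.mul_rpow_of_nonneg _ _ (by linarith : 0 ≤ p / 4)]
    refine h.trans (ENNReal.rpow_le_rpow (mul_le_mul' (le_max_right _ _) le_rfl) (by linarith))
  have hQ2 : Q ^ (p / 4) * Q ^ (p / 4) ≤ Q ^ 6 := by
    rw [← ENNReal.rpow_add_of_nonneg _ _ (by linarith) (by linarith)]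
    exact ENNReal.rpow_le_pow_six (le_max_left _ _) (by linarith)
  set V := fun a a' : ℕ => sqAvg k (subCtr c ((n : ℝ) ^ 2) k a a') (E i) ^ (p / 4) *
    sqAvg k (subCtr c ((n : ℝ) ^ 2) k a a') (E i') ^ (p / 4) with hV
  have hsum : ∑ a ∈ Finset.range N, ∑ a' ∈ Finset.range N, V a a' ≤
      ENNReal.ofReal ((N : ℝ) ^ 2) * (ENNReal.ofReal M ^ p *
        (ENNReal.ofReal (((n : ℝ) ^ 2) ^ 2)⁻¹ *
        (pieceSum p n k c g i ^ (p / 4) * pieceSum p n k c g i' ^ (p / 4)))) := by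
    refine le_trans (le_of_eq ?_) (mul_le_mul_right hb _)
    rw [← mul_assoc, ← ENNReal.ofReal_mul (by positivity), mul_inv_cancel₀ (by positivity),
      ENNReal.ofReal_one, one_mul]
  have hone : ENNReal.ofReal ((k : ℝ) ^ 2) * ENNReal.ofReal ((N : ℝ) ^ 2) *
      ENNReal.ofReal (((n : ℝ) ^ 2) ^ 2)⁻¹ = 1 := by
    rw [← ENNReal.ofReal_mul (by positivity), ← ENNReal.ofReal_mul (by positivity), ← mul_pow,
      mul_comm (k : ℝ), hNk, mul_inv_cancel₀ (by positivity), ENNReal.ofReal_one]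
  calc ∫⁻ x in sqr c ((n : ℝ) ^ 2), ‖E i x‖ₑ ^ (p / 2) * ‖E i' x‖ₑ ^ (p / 2)
      ≤ ∑ a ∈ Finset.range N, ∑ a' ∈ Finset.range N,
        ∫⁻ x in sqr (subCtr c ((n : ℝ) ^ 2) k a a') k,
          ‖E i x‖ₑ ^ (p / 2) * ‖E i' x‖ₑ ^ (p / 2) := by
        have := lintegral_sqr_le_sum c hN0 hk'
          fun x => ‖E i x‖ₑ ^ (p / 2) * ‖E i' x‖ₑ ^ (p / 2)
        rwa [hNk] at this
    _ ≤ ∑ a ∈ Finset.range N, ∑ a' ∈ Finset.range N,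
        Q ^ 6 * ENNReal.ofReal ((k : ℝ) ^ 2) * V a a' := by
        refine Finset.sum_le_sum fun a _ => Finset.sum_le_sum fun a' _ => ?_
        calc _ ≤ ∫⁻ _ in sqr (subCtr c ((n : ℝ) ^ 2) k a a') k, Q ^ 6 * V a a' := by
              refine setLIntegral_mono' (measurableSet_sqr _ _) fun x hx => ?_
              refine (mul_le_mul' (hpt i hi _ x hx) (hpt i' hi' _ x hx)).trans ?_
              rw [mul_mul_mul_comm]
              exact mul_le_mul' hQ2 le_rfl
          _ = _ := by
              rw [setLIntegral_const, volume_sqr, ENNReal.ofReal_pow hk'.le]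
              ring
    _ = Q ^ 6 * ENNReal.ofReal ((k : ℝ) ^ 2) *
        ∑ a ∈ Finset.range N, ∑ a' ∈ Finset.range N, V a a' := by
        simp only [Finset.mul_sum]
    _ ≤ _ := mul_le_mul_right hsum _
    _ = Q ^ 6 * (ENNReal.ofReal ((k : ℝ) ^ 2) * ENNReal.ofReal ((N : ℝ) ^ 2) *
          ENNReal.ofReal (((n : ℝ) ^ 2) ^ 2)⁻¹) * (ENNReal.ofReal M ^ p *
        (pieceSum p n k c g i ^ (p / 4) * pieceSum p n k c g i' ^ (p / 4))) := by ring
    _ = _ := by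
        rw [hone, mul_one, hQ]
        push_cast
        rfl

lemma exists_decIneq_of_bilIneq : ∃ C : ℝ, 0 < C ∧ ∀ p : ℝ, 4 < p → p < 6 → ∀ n k : ℕ, 0 < n →
    k ∣ n → ∀ D : ℝ, 0 ≤ D → DecIneq p (n / k) D → ∀ M : ℝ, 0 ≤ M → BilIneq p n k 1 M →
    DecIneq p n (C * (D + k * M)) := by
  obtain ⟨C₁, hC₁⟩ := exists_subinterval_decoupling
  obtain ⟨C₂, hC₂⟩ := exists_lintegral_pair_le
  set K : ℝ≥0 := 864 * (C₁ + C₂) with hK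
  refine ⟨max 1 K, by positivity, fun p hp4 hp6 n k hn hkn D hD hdec M hM hbil => ?_⟩
  have hp0 : 0 < p := by linarith
  have hk : 0 < k := Nat.pos_of_dvd_of_pos hkn hn
  refine (decIneq_iff hp0 hn (by positivity)).2 fun g hg c => ?_
  rw [sum_pieceSum hn hkn]
  set S := ∑ i ∈ Finset.range k, pieceSum p n k c g i with hS
  set E := fun j : ℕ => extOp ((j : ℝ) / k) (((j : ℝ) + 1) / k) g with hE
  have hEm : ∀ i < k, Measurable fun x => ‖E i x‖ₑ := fun i hi =>
    (extOp_props (hg.mono_set (interval_subset hi))).1.measurable.enorm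
  set X := ENNReal.ofReal D ^ p with hX
  set Y := ENNReal.ofReal M ^ p with hY
  have hdiag : ∫⁻ x in sqr c ((n : ℝ) ^ 2),
      (∑ i ∈ Finset.range k, (‖E i x‖ₑ ^ p) ^ (1 / (p / 2))) ^ (p / 2) ≤
        C₁ * X * S ^ (p / 2) := by
    refine (lintegral_sum_rpow_le _ (fun i hi =>
      ((hEm i (Finset.mem_range.1 hi)).pow_const p).aemeasurable) (by linarith)).trans ?_
    have hS' : S ^ (p / 2) =
        (∑ i ∈ Finset.range k, (pieceSum p n k c g i ^ (p / 2)) ^ (2 / p)) ^ (p / 2) := by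
      have e : p / 2 * (2 / p) = 1 := by field_simp
      simp only [← ENNReal.rpow_mul, e, ENNReal.rpow_one, hS]
    rw [hS', ← ENNReal.sum_mul_rpow_rpow _ _ _ hp0, one_div_div]
    gcongr with i hi
    rw [mul_assoc]
    exact hC₁ p hp4 hp6 (n / k) (Nat.div_pos (Nat.le_of_dvd hn hkn) hk) D hD hdec k n i
      (Nat.mul_div_cancel' hkn).symm (Finset.mem_range.1 hi) g hg c
  have hpair : ∀ e ∈ sepPairs k, ∫⁻ x in sqr c ((n : ℝ) ^ 2),
      ‖E e.1 x‖ₑ ^ (p / 2) * ‖E e.2 x‖ₑ ^ (p / 2) ≤ C₂ * Y * S ^ (p / 2) := fun e he => by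
    obtain ⟨he1, he2⟩ := Finset.mem_filter.1 he
    obtain ⟨h1, h2⟩ := Finset.mem_product.1 he1
    have hle : ∀ i ∈ Finset.range k, pieceSum p n k c g i ≤ S := fun i hi =>
      Finset.single_le_sum (f := fun i => pieceSum p n k c g i) (fun _ _ => zero_le) hi
    refine (hC₂ p hp4 hp6 n k hn hkn M hM hbil g hg c e.1 e.2 (Finset.mem_range.1 h1)
      (Finset.mem_range.1 h2) he2).trans ?_
    rw [mul_assoc, show p / 2 = p / 4 + p / 4 by ring,
      ENNReal.rpow_add_of_nonneg _ _ (by linarith) (by linarith)]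
    gcongr
    · exact hle _ h1
    · exact hle _ h2
  have hkp : ((k : ℝ≥0∞) ^ 2) ^ (p / 2 - 1) * (k : ℝ≥0∞) ^ 2 = (k : ℝ≥0∞) ^ p := by
    rw [← ENNReal.rpow_natCast, ← ENNReal.rpow_mul,
      ← ENNReal.rpow_add_of_nonneg _ _ (by push_cast; linarith) (by norm_num)]
    congr 1; push_cast; ring
  have hkY : (k : ℝ≥0∞) ^ p * Y = ENNReal.ofReal (k * M) ^ p := by
    rw [hY, ← ENNReal.mul_rpow_of_nonneg _ _ hp0.le, ENNReal.ofReal_mul (by positivity),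
      ENNReal.ofReal_natCast]
  have hXW : X ≤ ENNReal.ofReal (D + k * M) ^ p := ENNReal.rpow_le_rpow
    (ENNReal.ofReal_le_ofReal (by have : 0 ≤ k * M := by positivity
                                  linarith)) hp0.le
  have hYW : (k : ℝ≥0∞) ^ p * Y ≤ ENNReal.ofReal (D + k * M) ^ p := by
    rw [hkY]
    exact ENNReal.rpow_le_rpow (ENNReal.ofReal_le_ofReal (by linarith)) hp0.le
  set W := ENNReal.ofReal (D + k * M) ^ p with hW
  have hKle : (K : ℝ≥0∞) ≤ ENNReal.ofReal (max 1 K) ^ p := by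
    calc (K : ℝ≥0∞) ≤ ENNReal.ofReal (max 1 K) ^ (1 : ℝ) := by
          rw [ENNReal.rpow_one, ← ENNReal.ofReal_coe_nnreal]
          exact ENNReal.ofReal_le_ofReal (le_max_right _ _)
      _ ≤ _ := ENNReal.rpow_le_rpow_of_exponent_le (by simp) (by linarith)
  have hmeas : Measurable fun x =>
      (∑ i ∈ Finset.range k, ‖E i x‖ₑ) ^ p := by
    refine Measurable.pow_const (Finset.measurable_fun_sum _ fun i hi =>
      hEm i (Finset.mem_range.1 hi)) _
  have hpm : ∀ e ∈ sepPairs k, Measurable fun x => ‖E e.1 x‖ₑ ^ (p / 2) * ‖E e.2 x‖ₑ ^ (p / 2) :=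
    fun e he => by
      obtain ⟨h1, h2⟩ := Finset.mem_product.1 (Finset.mem_filter.1 he).1
      exact ((hEm _ (Finset.mem_range.1 h1)).pow_const _).mul
        ((hEm _ (Finset.mem_range.1 h2)).pow_const _)
  have hkt : ((k : ℝ≥0∞) ^ 2) ^ (p / 2 - 1) ≠ ∞ :=
    ENNReal.rpow_ne_top_of_nonneg (by linarith) (by simp)
  calc ∫⁻ x in sqr c ((n : ℝ) ^ 2), ‖extOp 0 1 g x‖ₑ ^ p
      ≤ ∫⁻ x in sqr c ((n : ℝ) ^ 2), 864 *
        ((∑ i ∈ Finset.range k, (‖E i x‖ₑ ^ p) ^ (1 / (p / 2))) ^ (p / 2) +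
          ((k : ℝ≥0∞) ^ 2) ^ (p / 2 - 1) *
            ∑ e ∈ sepPairs k, ‖E e.1 x‖ₑ ^ (p / 2) * ‖E e.2 x‖ₑ ^ (p / 2)) := by
        refine lintegral_mono fun x => ?_
        rw [extOp_unit_eq_sum hk hg x]
        exact (ENNReal.rpow_le_rpow (enorm_sum_le _ _) hp0.le).trans
          (sum_rpow_le_diagonal_add hp4 hp6 k fun i => ‖E i x‖ₑ)
    _ = 864 * ((∫⁻ x in sqr c ((n : ℝ) ^ 2),
          (∑ i ∈ Finset.range k, (‖E i x‖ₑ ^ p) ^ (1 / (p / 2))) ^ (p / 2)) +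
        ((k : ℝ≥0∞) ^ 2) ^ (p / 2 - 1) * ∑ e ∈ sepPairs k, ∫⁻ x in sqr c ((n : ℝ) ^ 2),
          ‖E e.1 x‖ₑ ^ (p / 2) * ‖E e.2 x‖ₑ ^ (p / 2)) := by
        have hms := Finset.measurable_fun_sum (sepPairs k) hpm
        rw [lintegral_const_mul' _ _ (by simp), lintegral_add_right _ (hms.const_mul _),
          lintegral_const_mul' _ _ hkt, lintegral_finsetSum _ hpm]
    _ ≤ 864 * (C₁ * X * S ^ (p / 2) + ((k : ℝ≥0∞) ^ 2) ^ (p / 2 - 1) *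
          ∑ e ∈ sepPairs k, C₂ * Y * S ^ (p / 2)) := by
        gcongr with e he
        exact hpair e he
    _ ≤ 864 * (C₁ * X * S ^ (p / 2) + ((k : ℝ≥0∞) ^ 2) ^ (p / 2 - 1) *
          ((k : ℝ≥0∞) ^ 2 * (C₂ * Y * S ^ (p / 2)))) := by
        rw [Finset.sum_const, nsmul_eq_mul]
        gcongr
        exact card_sepPairs_le k
    _ = 864 * (C₁ * X + C₂ * ((((k : ℝ≥0∞) ^ 2) ^ (p / 2 - 1) * (k : ℝ≥0∞) ^ 2) * Y)) *
          S ^ (p / 2) := by ring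
    _ ≤ 864 * (C₁ * W + C₂ * W) * S ^ (p / 2) := by rw [hkp]; gcongr
    _ = K * W * S ^ (p / 2) := by rw [hK]; push_cast; ring
    _ ≤ ENNReal.ofReal (max 1 K) ^ p * W * S ^ (p / 2) := by gcongr
    _ = _ := by
        rw [hW, ← ENNReal.mul_rpow_of_nonneg _ _ hp0.le, ← ENNReal.ofReal_mul (by positivity)]

end

/-- `D_p(δ) ≤ c (D_p(δ/ν) + ν⁻¹ M_{p,1}(δ,ν))`, with `δ = 1/n`, `ν = 1/k`. -/
theorem linear_le_bilinear :
    ∃ c : ℝ, 0 < c ∧ ∀ p : ℝ, 4 < p → p < 6 → ∀ n k : ℕ, 0 < n → 100 < k → k ∣ n →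
      Dconst p n ≤ c * (Dconst p (n / k) + (k : ℝ) * Mconst p n k 1) := by
  obtain ⟨C, hC0, hC⟩ := exists_decIneq_of_bilIneq
  refine ⟨C, hC0, fun p hp4 hp6 n k hn hk hkn => ?_⟩
  have hk' : (0 : ℝ) < k := by exact_mod_cast (by omega : 0 < k)
  have hm : 0 < n / k := Nat.div_pos (Nat.le_of_dvd hn hkn) (by omega)
  have hle : ∀ D, 0 ≤ D → DecIneq p (n / k) D → ∀ M, 0 ≤ M → BilIneq p n k 1 M →
      Dconst p n ≤ C * (D + k * M) := fun D hD hdec M hM hbil =>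
    csInf_le ⟨0, fun _ h => h.1⟩ ⟨by positivity, hC p hp4 hp6 n k hn hkn D hD hdec M hM hbil⟩
  have h1 : ∀ D, 0 ≤ D → DecIneq p (n / k) D → (Dconst p n / C - D) / k ≤ Mconst p n k 1 :=
    fun D hD hdec => le_csInf (exists_bilIneq (by linarith) hn hkn) fun M ⟨hM, hbil⟩ => by
      have := hle D hD hdec M hM hbil
      rw [div_le_iff₀ hk', sub_le_iff_le_add, div_le_iff₀ hC0]
      linarith
  have h2 : Dconst p n / C - k * Mconst p n k 1 ≤ Dconst p (n / k) :=
    le_csInf (exists_decIneq (by linarith) hm) fun D ⟨hD, hdec⟩ => by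
      have := h1 D hD hdec
      rw [div_le_iff₀ hk'] at this
      linarith
  rw [sub_le_iff_le_add, div_le_iff₀ hC0] at h2
  linarith
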